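/- Let T: [0,1) → [0,1) be the irrational rotation Tx = x + α (mod 1), α irrational, preserving Lebesgue measure, and let ξ: [0,1) → 𝕋 be a cocycle. Then: (i) if ξ(x) = e^{2πicx} for a real constant c, then the spectral multiplicity of the weighted operator V_{ξ,T} is bounded by |c| + 1; (ii) if ξ is absolutely continuous of topological degree zero, then V_{ξ,T} has simple spectrum; (iii) if ξ is of bounded variation, then the spectral multiplicity of V_{ξ,T} is at most max(2, 2π·Var(ξ)/3). (Guenais) -/

import Mathlib

open MeasureTheory Real
open scoped intervalIntegral

attribute [local instance] ZeroLEOneClass.factZeroLtOne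

variable {H : Type*} [NormedAddCommGroup H] [InnerProductSpace ℂ H] [CompleteSpace H]

/-- The cyclic space generated by `x` under the unitary operator `V`:
the linear span of `{Vⁿ x : n ∈ ℤ}` (its closure is the cyclic subspace). -/
def zCyclicSpace (V : H ≃ₗᵢ[ℂ] H) (x : H) : Submodule ℂ H :=
  Submodule.span ℂ {y : H | ∃ n : ℤ, y = (V ^ n) x}

/-- The (essential supremum of the) spectral multiplicity of a unitary operator `V` is at
most `n` iff `H` is topologically generated by `n` cyclic subspaces. -/
def SpectralMultiplicityAtMost (V : H ≃ₗᵢ[ℂ] H) (n : ℕ) : Prop :=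
  ∃ x : Fin n → H, (⨆ i, zCyclicSpace V (x i)).topologicalClosure = ⊤

/-- The type of the weighted operator `V_{ξ,T} f(x) = ξ(x)·f(x+α)` over the rotation by `α`
on `L²` of the circle `[0,1)`. -/
def IsWeightedOperator (α : ℝ) (ξ : AddCircle (1 : ℝ) → ℂ)
    (V : Lp ℂ 2 (volume : Measure (AddCircle (1 : ℝ))) ≃ₗᵢ[ℂ]
         Lp ℂ 2 (volume : Measure (AddCircle (1 : ℝ)))) : Prop :=
  ∀ f : Lp ℂ 2 (volume : Measure (AddCircle (1 : ℝ))),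
    (V f : AddCircle (1 : ℝ) → ℂ) =ᵐ[volume] fun x => ξ x * f (x + (α : AddCircle (1 : ℝ)))

set_option linter.unusedSectionVars false

section SpectralMeasure

variable {X : Type*} [MetricSpace X] [CompactSpace X] [MeasurableSpace X] [BorelSpace X]

/-- A real-valued continuous function, viewed as complex-valued. -/
def complexify (f : C(X, ℝ)) : C(X, ℂ) := ⟨fun z => (f z : ℂ), by fun_prop⟩

@[simp] lemma complexify_apply (f : C(X, ℝ)) (z : X) : complexify f z = (f z : ℂ) := rfl

lemma inner_rep_nonneg (rep : C(X, ℂ) →⋆ₐ[ℂ] (H →L[ℂ] H)) (x : H) (f : C(X, ℝ))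
    (hf : ∀ z, 0 ≤ f z) :
    0 ≤ (inner ℂ x (rep (complexify f) x)).re := by
  set g : C(X, ℂ) := complexify ⟨fun z => √(f z), by fun_prop⟩ with hg
  have h : complexify f = star g * g := by
    ext z
    simp only [complexify_apply, ContinuousMap.mul_apply, ContinuousMap.star_apply, hg,
      ContinuousMap.coe_mk, RCLike.star_def, Complex.conj_ofReal]
    rw [← Complex.ofReal_mul, Real.mul_self_sqrt (hf z)]
  rw [h, map_mul, map_star, mul_apply_eq_comp, ContinuousLinearMap.star_eq_adjoint,
    ContinuousLinearMap.adjoint_inner_right]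
  exact inner_self_nonneg (𝕜 := ℂ)

theorem exists_spectralMeasure (rep : C(X, ℂ) →⋆ₐ[ℂ] (H →L[ℂ] H)) (x : H) :
    ∃ μ : Measure X, IsFiniteMeasure μ ∧
      ∀ f : C(X, ℂ), ∫ z, f z ∂μ = inner ℂ x (rep f x) := by
  let L : CompactlySupportedContinuousMap X ℝ →ₗ[ℝ] ℝ :=
    { toFun := fun f => (inner ℂ x (rep (complexify f.toContinuousMap) x)).re
      map_add' := fun f g => by
        have : complexify (f + g).toContinuousMap =
            complexify f.toContinuousMap + complexify g.toContinuousMap := by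
          ext z; simp
        rw [this, map_add, add_apply, inner_add_right, Complex.add_re]
      map_smul' := fun c f => by
        have : complexify (c • f).toContinuousMap =
            (c : ℂ) • complexify f.toContinuousMap := by
          ext z; simp
        rw [this, map_smul, smul_apply, inner_smul_right,
          Complex.re_ofReal_mul]; rfl }
  let Λ := PositiveLinearMap.mk₀ L fun f hf => inner_rep_nonneg rep x f.toContinuousMap fun z => by
    simpa using CompactlySupportedContinuousMap.le_def.1 hf z
  have key : ∀ f : C(X, ℝ), ∫ z, f z ∂(RealRMK.rieszMeasure Λ) =
      (inner ℂ x (rep (complexify f) x)).re := fun f => by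
    have := RealRMK.integral_rieszMeasure Λ (CompactlySupportedContinuousMap.continuousMapEquiv f)
    exact this
  have hfin : IsFiniteMeasure (RealRMK.rieszMeasure Λ) := inferInstance
  have hreal : ∀ f : C(X, ℝ), inner ℂ x (rep (complexify f) x) =
      (((inner ℂ x (rep (complexify f) x)).re : ℝ) : ℂ) := fun f => by
    have hs : star (complexify f) = complexify f := by
      ext z; simp
    apply (Complex.conj_eq_iff_re.1 _).symm
    rw [inner_conj_symm, ← ContinuousLinearMap.adjoint_inner_right,
      ← ContinuousLinearMap.star_eq_adjoint, ← map_star, hs]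
  refine ⟨_, hfin, fun f => ?_⟩
  have hf : f = complexify ⟨fun z => (f z).re, by fun_prop⟩ +
      Complex.I • complexify ⟨fun z => (f z).im, by fun_prop⟩ := by
    ext z
    simp [mul_comm Complex.I, Complex.re_add_im]
  have hint : ∀ g : C(X, ℝ), Integrable (fun z => (complexify g) z) (RealRMK.rieszMeasure Λ) :=
    fun g => (complexify g).continuous.integrable_of_hasCompactSupport
      (HasCompactSupport.of_compactSpace _)
  have hc : ∀ g : C(X, ℝ), ∫ z, (complexify g) z ∂(RealRMK.rieszMeasure Λ) =
      inner ℂ x (rep (complexify g) x) := fun g => by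
    rw [hreal, ← key]
    exact integral_ofReal
  rw [hf, map_add, map_smul, add_apply, smul_apply,
    inner_add_right, inner_smul_right, ← hc, ← hc]
  simp only [ContinuousMap.add_apply, ContinuousMap.smul_apply, smul_eq_mul]
  rw [integral_add (hint _) ((hint _).const_mul _), integral_const_mul]

/-- The scalar spectral measure of the vector `x` for the representation `rep` of `C(X, ℂ)`. -/
noncomputable def spectralMeasure (rep : C(X, ℂ) →⋆ₐ[ℂ] (H →L[ℂ] H)) (x : H) : Measure X :=
  (exists_spectralMeasure rep x).choose

variable (rep : C(X, ℂ) →⋆ₐ[ℂ] (H →L[ℂ] H))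

instance (x : H) : IsFiniteMeasure (spectralMeasure rep x) :=
  (exists_spectralMeasure rep x).choose_spec.1

lemma integral_spectralMeasure (x : H) (f : C(X, ℂ)) :
    ∫ z, f z ∂(spectralMeasure rep x) = inner ℂ x (rep f x) :=
  (exists_spectralMeasure rep x).choose_spec.2 f

lemma integrable_continuousMap (μ : Measure X) [IsFiniteMeasure μ] (f : C(X, ℂ)) :
    Integrable (fun z => f z) μ :=
  f.continuous.integrable_of_hasCompactSupport (HasCompactSupport.of_compactSpace _)

lemma measure_ext_complex {μ ν : Measure X} [IsFiniteMeasure μ] [IsFiniteMeasure ν]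
    (h : ∀ f : C(X, ℂ), ∫ z, f z ∂μ = ∫ z, f z ∂ν) : μ = ν := by
  refine ext_of_forall_integral_eq_of_IsFiniteMeasure fun f => ?_
  have := h (complexify f.toContinuousMap)
  have e : ∀ ρ : Measure X, ∫ z, (complexify f.toContinuousMap) z ∂ρ = ((∫ z, f z ∂ρ : ℝ) : ℂ) :=
    fun ρ => integral_ofReal
  rw [e, e] at this
  exact_mod_cast this

lemma spectralMeasure_eq {x : H} {ν : Measure X} [IsFiniteMeasure ν]
    (h : ∀ f : C(X, ℂ), ∫ z, f z ∂ν = inner ℂ x (rep f x)) : spectralMeasure rep x = ν :=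
  measure_ext_complex fun f => by rw [integral_spectralMeasure, h]

lemma inner_rep_rep (x y : H) (f g : C(X, ℂ)) :
    inner ℂ (rep f x) (rep g y) = inner ℂ x (rep (star f * g) y) := by
  rw [map_mul, map_star, mul_apply_eq_comp, ContinuousLinearMap.star_eq_adjoint,
    ContinuousLinearMap.adjoint_inner_right]

/-- Two vectors generate orthogonal cyclic subspaces. -/
def OrthCyclic (x y : H) : Prop := ∀ f : C(X, ℂ), inner ℂ x (rep f y) = 0

variable {rep} in
lemma OrthCyclic.symm {x y : H} (h : OrthCyclic rep x y) : OrthCyclic rep y x := fun f => by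
  have := h (star f)
  rw [map_star, ContinuousLinearMap.star_eq_adjoint,
    ContinuousLinearMap.adjoint_inner_right] at this
  rw [← inner_conj_symm, this, map_zero]

lemma spectralMeasure_add {x y : H} (h : OrthCyclic rep x y) :
    spectralMeasure rep (x + y) = spectralMeasure rep x + spectralMeasure rep y :=
  spectralMeasure_eq rep fun f => by
    rw [integral_add_measure (integrable_continuousMap _ f) (integrable_continuousMap _ f),
      integral_spectralMeasure, integral_spectralMeasure]
    simp [h f, h.symm f]

lemma spectralMeasure_parallelogram (x y : H) :
    spectralMeasure rep (x + y) + spectralMeasure rep (x - y) =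
      (2 : ENNReal) • (spectralMeasure rep x + spectralMeasure rep y) := by
  have : IsFiniteMeasure ((2 : ENNReal) • (spectralMeasure rep x + spectralMeasure rep y)) :=
    Measure.smul_finite _ (by simp)
  refine measure_ext_complex fun f => ?_
  rw [integral_add_measure (integrable_continuousMap _ f) (integrable_continuousMap _ f),
    integral_smul_measure,
    integral_add_measure (integrable_continuousMap _ f) (integrable_continuousMap _ f)]
  simp only [integral_spectralMeasure, inner_add_left, inner_sub_left, inner_add_right,
    inner_sub_right, map_add, map_sub]
  norm_num
  ring

lemma spectralMeasure_univ (x : H) : spectralMeasure rep x Set.univ = ENNReal.ofReal (‖x‖ ^ 2) := by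
  have := integral_spectralMeasure rep x 1
  simp only [ContinuousMap.one_apply, integral_const, map_one, one_apply_eq_self,
    inner_self_eq_norm_sq_to_K] at this
  have h2 : (spectralMeasure rep x).real Set.univ = ‖x‖ ^ 2 := by
    have h3 : (((spectralMeasure rep x).real Set.univ : ℝ) : ℂ) = ((‖x‖ ^ 2 : ℝ) : ℂ) := by
      simpa using this
    exact_mod_cast h3
  rw [← h2, Measure.real, ENNReal.ofReal_toReal (measure_ne_top _ _)]

lemma spectralMeasure_rep_absolutelyContinuous (f : C(X, ℂ)) (x : H) :
    spectralMeasure rep (rep f x) ≪ spectralMeasure rep x := by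
  set g : C(X, ℝ) := ⟨fun z => ‖f z‖ ^ 2, by fun_prop⟩ with hg
  have hgi : Integrable (fun z => g z) (spectralMeasure rep x) :=
    g.continuous.integrable_of_hasCompactSupport (HasCompactSupport.of_compactSpace _)
  have : IsFiniteMeasure ((spectralMeasure rep x).withDensity fun z => ENNReal.ofReal (g z)) :=
    isFiniteMeasure_withDensity_ofReal hgi.2
  rw [spectralMeasure_eq rep
    (ν := (spectralMeasure rep x).withDensity fun z => ENNReal.ofReal (g z))]
  · exact withDensity_absolutelyContinuous _ _
  intro p
  rw [integral_withDensity_eq_integral_toReal_smul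
      (by have := g.continuous.measurable; fun_prop) (by simp)]
  rw [← mul_apply_eq_comp, ← map_mul, inner_rep_rep, ← integral_spectralMeasure]
  refine integral_congr_ae (.of_forall fun z => ?_)
  have : (ENNReal.ofReal (g z)).toReal = ‖f z‖ ^ 2 := by
    rw [ENNReal.toReal_ofReal (by simp [hg])]; simp [hg]
  simp only [this, Complex.real_smul, ContinuousMap.mul_apply, ContinuousMap.star_apply]
  rw [Complex.ofReal_pow, ← Complex.conj_mul']
  simp only [RCLike.star_def]
  ring

end SpectralMeasure

section CyclicSpaces

variable {X : Type*} [MetricSpace X] [CompactSpace X] [MeasurableSpace X] [BorelSpace X]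

lemma spectralMeasure_add_le (rep : C(X, ℂ) →⋆ₐ[ℂ] (H →L[ℂ] H)) (x y : H) :
    spectralMeasure rep (x + y) ≤
      (2 : ENNReal) • (spectralMeasure rep x + spectralMeasure rep y) := by
  rw [← spectralMeasure_parallelogram]
  exact Measure.le_add_right le_rfl

/-- The vectors whose spectral measure is absolutely continuous with respect to `ρ`. -/
noncomputable def acSubmodule (rep : C(X, ℂ) →⋆ₐ[ℂ] (H →L[ℂ] H)) (ρ : Measure X) :
    Submodule ℂ H where
  carrier := {y | spectralMeasure rep y ≪ ρ}
  zero_mem' := by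
    have h : spectralMeasure rep (0 : H) = 0 := by
      rw [← Measure.measure_univ_eq_zero, spectralMeasure_univ]; simp
    rw [Set.mem_ofPred_eq, h]
    exact Measure.AbsolutelyContinuous.zero ρ
  add_mem' := fun {x y} hx hy => by
    refine (Measure.absolutelyContinuous_of_le (spectralMeasure_add_le rep x y)).trans ?_
    exact (Measure.AbsolutelyContinuous.add_left hx hy).smul_left _
  smul_mem' := fun c x hx => by
    have h : c • x = rep (algebraMap ℂ C(X, ℂ) c) x := by
      rw [AlgHomClass.commutes, Algebra.algebraMap_eq_smul_one]; simp
    rw [Set.mem_ofPred_eq, h]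
    exact (spectralMeasure_rep_absolutelyContinuous rep _ x).trans hx

variable (rep : C(X, ℂ) →⋆ₐ[ℂ] (H →L[ℂ] H))

lemma mem_acSubmodule {ρ : Measure X} {y : H} :
    y ∈ acSubmodule rep ρ ↔ spectralMeasure rep y ≪ ρ := Iff.rfl

lemma isClosed_acSubmodule (ρ : Measure X) : IsClosed (acSubmodule rep ρ : Set H) := by
  refine isClosed_of_closure_subset fun y hy E hE => ?_
  refine le_antisymm (ENNReal.le_of_forall_pos_le_add fun ε hε _ => ?_) zero_le
  obtain ⟨z, hz, hyz⟩ := Metric.mem_closure_iff.1 hy (√(ε / 2)) (by positivity)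
  have h1 := spectralMeasure_add_le rep z (y - z) E
  rw [add_sub_cancel] at h1
  have h2 : spectralMeasure rep z E = 0 := hz hE
  have h3 : spectralMeasure rep (y - z) E ≤ ENNReal.ofReal (ε / 2) := by
    refine (measure_mono (Set.subset_univ _)).trans ?_
    rw [spectralMeasure_univ]
    refine ENNReal.ofReal_le_ofReal ?_
    rw [dist_eq_norm] at hyz
    calc ‖y - z‖ ^ 2 ≤ (√((ε : ℝ) / 2)) ^ 2 := by gcongr
      _ = (ε : ℝ) / 2 := Real.sq_sqrt (by positivity)
  refine h1.trans ?_
  simp only [Measure.smul_apply, Measure.add_apply, h2, zero_add, smul_eq_mul]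
  calc 2 * spectralMeasure rep (y - z) E ≤ ENNReal.ofReal 2 * ENNReal.ofReal (ε / 2) := by
        gcongr; simp
    _ = ε := by
        rw [← ENNReal.ofReal_mul (by norm_num), mul_div_cancel₀ _ (by norm_num)]; simp

/-- A subspace stable under all the operators of a representation. -/
def IsRepInvariant (M : Submodule ℂ H) : Prop := ∀ (f : C(X, ℂ)), ∀ y ∈ M, rep f y ∈ M

lemma isInvariant_acSubmodule (ρ : Measure X) : IsRepInvariant rep (acSubmodule rep ρ) :=
  fun f y hy => (spectralMeasure_rep_absolutelyContinuous rep f y).trans hy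

/-- The closed invariant subspace generated by a set. -/
def repCyc (S : Set H) : Submodule ℂ H :=
  (Submodule.span ℂ {y | ∃ x ∈ S, ∃ f : C(X, ℂ), y = rep f x}).topologicalClosure

lemma rep_mem_repCyc {S : Set H} {x : H} (hx : x ∈ S) (f : C(X, ℂ)) : rep f x ∈ repCyc rep S :=
  Submodule.le_topologicalClosure _ (Submodule.subset_span ⟨x, hx, f, rfl⟩)

lemma mem_repCyc {S : Set H} {x : H} (hx : x ∈ S) : x ∈ repCyc rep S := by
  simpa using rep_mem_repCyc rep hx 1

lemma isClosed_repCyc (S : Set H) : IsClosed (repCyc rep S : Set H) :=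
  Submodule.isClosed_topologicalClosure _

instance (S : Set H) : CompleteSpace (repCyc rep S) := (isClosed_repCyc rep S).completeSpace_coe

variable {rep}

lemma repCyc_le {S : Set H} {M : Submodule ℂ H} (hM : IsClosed (M : Set H))
    (hinv : IsRepInvariant rep M) (hS : S ⊆ M) : repCyc rep S ≤ M := by
  refine Submodule.topologicalClosure_minimal _ (Submodule.span_le.2 ?_) hM
  rintro y ⟨x, hx, f, rfl⟩
  exact hinv f x (hS hx)

variable (rep) in
lemma isInvariant_repCyc (S : Set H) : IsRepInvariant rep (repCyc rep S) := by
  intro f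
  change repCyc rep S ≤ (repCyc rep S).comap (rep f : H →ₗ[ℂ] H)
  refine Submodule.topologicalClosure_minimal _ (Submodule.span_le.2 ?_)
    ((isClosed_repCyc rep S).preimage (rep f).continuous)
  rintro y ⟨x, hx, g, rfl⟩
  have : rep f (rep g x) = rep (f * g) x := by rw [map_mul, mul_apply_eq_comp]
  change rep f (rep g x) ∈ repCyc rep S
  rw [this]
  exact rep_mem_repCyc rep hx (f * g)

lemma repCyc_mono {S T : Set H} (h : S ⊆ T) : repCyc rep S ≤ repCyc rep T :=
  repCyc_le (isClosed_repCyc rep T) (isInvariant_repCyc rep T) fun _ hx => mem_repCyc rep (h hx)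

lemma IsRepInvariant.orthogonal {M : Submodule ℂ H} (h : IsRepInvariant rep M) :
    IsRepInvariant rep Mᗮ := by
  intro f y hy
  rw [Submodule.mem_orthogonal] at hy ⊢
  intro u hu
  have := hy _ (h (star f) u hu)
  rwa [map_star, ContinuousLinearMap.star_eq_adjoint,
    ContinuousLinearMap.adjoint_inner_left] at this

lemma mem_repCyc_orthogonal {S : Set H} {y : H} :
    y ∈ (repCyc rep S)ᗮ ↔ ∀ x ∈ S, OrthCyclic rep x y := by
  constructor
  · intro h x hx f
    exact (Submodule.mem_orthogonal _ _).1 ((isInvariant_repCyc rep S).orthogonal f y h) x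
      (mem_repCyc rep hx)
  · intro h
    have : repCyc rep S ≤ (Submodule.span ℂ {y})ᗮ := by
      refine Submodule.topologicalClosure_minimal _ (Submodule.span_le.2 ?_)
        (Submodule.isClosed_orthogonal _)
      rintro z ⟨x, hx, f, rfl⟩
      rw [SetLike.mem_coe, Submodule.mem_orthogonal_singleton_iff_inner_right]
      exact (h x hx).symm f
    rw [Submodule.mem_orthogonal]
    intro u hu
    exact Submodule.mem_orthogonal_singleton_iff_inner_left.1 (this hu)

lemma OrthCyclic.of_mem_repCyc {x y a b : H} (h : OrthCyclic rep x y)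
    (ha : a ∈ repCyc rep {x}) (hb : b ∈ repCyc rep {y}) : OrthCyclic rep a b := by
  have h1 : repCyc rep {y} ≤ (repCyc rep {x})ᗮ :=
    repCyc_le (Submodule.isClosed_orthogonal _) (isInvariant_repCyc rep _).orthogonal
      (Set.singleton_subset_iff.2 (mem_repCyc_orthogonal.2 (by simpa using h)))
  intro f
  exact (Submodule.mem_orthogonal _ _).1 (h1 (isInvariant_repCyc rep _ f b hb)) a ha

lemma absolutelyContinuous_of_hasSum {z : ℕ → H} {c : ℕ → ℂ} {x : H}
    (hc : ∀ n, c n ≠ 0) (hx : HasSum (fun n => c n • z n) x)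
    (horth : Pairwise fun i j => OrthCyclic rep (z i) (z j)) (n : ℕ) :
    z n ∈ acSubmodule rep (spectralMeasure rep x) := by
  have hcn : OrthCyclic rep (c n • z n) (x - c n • z n) := by
    intro f
    have h1 : HasSum (fun k => inner ℂ (z n) (rep f (c k • z k))) (inner ℂ (z n) (rep f x)) :=
      (hx.mapL (rep f)).mapL (innerSL ℂ (z n))
    have h2 : HasSum (fun k => inner ℂ (z n) (rep f (c k • z k)))
        (inner ℂ (z n) (rep f (c n • z n))) :=
      hasSum_single n fun k hk => by
        rw [map_smul, inner_smul_right, horth hk.symm f, mul_zero]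
    rw [inner_smul_left, map_sub, inner_sub_right, h1.unique h2, sub_self, mul_zero]
  have h3 := spectralMeasure_add rep hcn
  rw [add_sub_cancel] at h3
  have h4 : c n • z n ∈ acSubmodule rep (spectralMeasure rep x) := by
    rw [mem_acSubmodule, h3]
    exact Measure.absolutelyContinuous_of_le (Measure.le_add_right le_rfl)
  simpa [smul_smul, inv_mul_cancel₀ (hc n)] using
    (acSubmodule rep (spectralMeasure rep x)).smul_mem (c n)⁻¹ h4

/-- A closed invariant subspace of a separable space contains a vector of maximal spectral type. -/
theorem exists_maximal_spectralType [TopologicalSpace.SeparableSpace H] {K : Submodule ℂ H}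
    (hK : IsClosed (K : Set H)) (hinv : IsRepInvariant rep K) :
    ∃ x ∈ K, ∀ y ∈ K, spectralMeasure rep y ≪ spectralMeasure rep x := by
  have : CompleteSpace K := hK.completeSpace_coe
  set d := TopologicalSpace.denseSeq H
  set g : ℕ → H := fun n => K.starProjection (d n) with hg
  have hgK : ∀ n, g n ∈ K := fun n => Submodule.starProjection_apply_mem _ _
  set C : ℕ → Submodule ℂ H := fun n => repCyc rep (g '' Set.Iio n) with hC
  have hCK : ∀ n, C n ≤ K := fun n => repCyc_le hK hinv (by
    rintro _ ⟨j, -, rfl⟩; exact hgK j)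
  have hCmono : ∀ {i j}, i ≤ j → C i ≤ C j := fun h =>
    repCyc_mono (Set.image_mono (Set.Iio_subset_Iio h))
  set z : ℕ → H := fun n => g n - (C n).starProjection (g n) with hz
  have hzorth : ∀ n, z n ∈ (C n)ᗮ := fun n => Submodule.sub_starProjection_mem_orthogonal _
  have hzC : ∀ n, z n ∈ C (n + 1) := fun n =>
    Submodule.sub_mem _ (mem_repCyc rep ⟨n, by simp, rfl⟩)
      (hCmono n.le_succ (Submodule.starProjection_apply_mem _ _))
  have hzK : ∀ n, z n ∈ K := fun n => hCK _ (hzC n)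
  have horth' : ∀ i j, i < j → OrthCyclic rep (z i) (z j) := fun i j hij f =>
    (Submodule.mem_orthogonal _ _).1 ((isInvariant_repCyc rep _).orthogonal f _ (hzorth j)) _
      (hCmono hij (hzC i))
  have horth : Pairwise fun i j => OrthCyclic rep (z i) (z j) := fun i j hij => by
    rcases lt_or_gt_of_ne hij with h | h
    · exact horth' i j h
    · exact (horth' j i h).symm
  set c : ℕ → ℂ := fun n => ((1 / 2 : ℝ) ^ n / (1 + ‖z n‖) : ℝ) with hc
  have hc0 : ∀ n, c n ≠ 0 := fun n => by
    rw [hc, Ne, Complex.ofReal_eq_zero]; positivity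
  have hsum : Summable fun n => c n • z n := by
    refine Summable.of_norm_bounded (g := fun n => (1 / 2 : ℝ) ^ n) summable_geometric_two
      fun n => ?_
    rw [norm_smul, hc, Complex.norm_real, Real.norm_of_nonneg (by positivity), div_mul_eq_mul_div,
      div_le_iff₀ (by positivity)]
    gcongr
    linarith
  obtain ⟨x, hx⟩ := hsum
  have hmem := absolutelyContinuous_of_hasSum hc0 hx horth
  have hgmem : ∀ n, g n ∈ acSubmodule rep (spectralMeasure rep x) := by
    intro n
    induction n using Nat.strong_induction_on with
    | _ n ih =>
      have h1 : C n ≤ acSubmodule rep (spectralMeasure rep x) :=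
        repCyc_le (isClosed_acSubmodule rep _) (isInvariant_acSubmodule rep _) (by
          rintro _ ⟨j, hj, rfl⟩; exact ih j hj)
      have h2 : g n = z n + (C n).starProjection (g n) := by simp [hz]
      rw [h2]
      exact add_mem (hmem n) (h1 (Submodule.starProjection_apply_mem _ _))
  refine ⟨x, ?_, fun y hy => ?_⟩
  · exact hK.mem_of_tendsto hx (.of_forall fun s => K.sum_mem fun n _ => K.smul_mem _ (hzK n))
  · refine (isClosed_acSubmodule rep (spectralMeasure rep x)).closure_subset
      (Metric.mem_closure_iff.2 fun ε hε => ?_)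
    obtain ⟨n, hn⟩ := (TopologicalSpace.denseRange_denseSeq H).exists_dist_lt y hε
    refine ⟨g n, hgmem n, ?_⟩
    have hyy : y = K.starProjection y := (Submodule.starProjection_eq_self_iff.2 hy).symm
    rw [dist_eq_norm] at hn ⊢
    rw [hyy, hg, ← map_sub]
    exact (Submodule.norm_starProjection_apply_le _ _).trans_lt hn

/-- Iterating the choice of a vector of maximal spectral type. -/
theorem exists_maximal_chain [TopologicalSpace.SeparableSpace H] (m : ℕ) :
    ∃ x : ℕ → H, (∀ i < m, ∀ j < m, i ≠ j → OrthCyclic rep (x i) (x j)) ∧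
      ∀ y, (∀ j < m, OrthCyclic rep (x j) y) →
        ∀ j < m, spectralMeasure rep y ≪ spectralMeasure rep (x j) := by
  induction m with
  | zero => exact ⟨0, by simp, by simp⟩
  | succ m ih =>
    obtain ⟨x, h1, h2⟩ := ih
    obtain ⟨z, hz, hmax⟩ := exists_maximal_spectralType (rep := rep)
      (Submodule.isClosed_orthogonal (repCyc rep (x '' Set.Iio m)))
      (isInvariant_repCyc rep _).orthogonal
    rw [mem_repCyc_orthogonal] at hz
    have hz' : ∀ j < m, OrthCyclic rep (x j) z := fun j hj => hz _ ⟨j, hj, rfl⟩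
    have hlt : ∀ j < m, Function.update x m z j = x j := fun j hj =>
      Function.update_of_ne hj.ne _ _
    refine ⟨Function.update x m z, fun i hi j hj hij => ?_, fun y hy j hj => ?_⟩
    · rcases Nat.lt_succ_iff_lt_or_eq.1 hi with hi | rfl <;>
        rcases Nat.lt_succ_iff_lt_or_eq.1 hj with hj | rfl
      · rw [hlt i hi, hlt j hj]; exact h1 i hi j hj hij
      · rw [hlt i hi, Function.update_self]; exact hz' i hi
      · rw [hlt j hj, Function.update_self]; exact (hz' j hj).symm
      · exact absurd rfl hij
    · have hy' : ∀ j < m, OrthCyclic rep (x j) y := fun j hj => by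
        simpa [hlt j hj] using hy j (by omega)
      rcases Nat.lt_succ_iff_lt_or_eq.1 hj with hj | rfl
      · rw [hlt j hj]; exact h2 y hy' j hj
      · rw [Function.update_self]
        refine hmax y (mem_repCyc_orthogonal.2 ?_)
        rintro _ ⟨j, hj, rfl⟩
        exact hy' j hj

end CyclicSpaces

section CyclicIsometry

open scoped ENNReal

variable {X : Type*} [MetricSpace X] [CompactSpace X] [MeasurableSpace X] [BorelSpace X]

/-- Multiplication by a continuous function on `L²(μ)`. -/
noncomputable def mulContinuousL (μ : Measure X) [IsFiniteMeasure μ] (p : C(X, ℂ)) :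
    Lp ℂ 2 μ →L[ℂ] Lp ℂ 2 μ :=
  (ContinuousLinearMap.mul ℂ ℂ).holderL μ ∞ 2 2 (ContinuousMap.toLp ∞ μ ℂ p)

lemma coeFn_mulContinuousL (μ : Measure X) [IsFiniteMeasure μ] (p : C(X, ℂ)) (w : Lp ℂ 2 μ) :
    mulContinuousL μ p w =ᵐ[μ] fun z => p z * w z := by
  refine ((ContinuousLinearMap.mul ℂ ℂ).coeFn_holder (r := 2) (ContinuousMap.toLp ∞ μ ℂ p)
    w).trans ?_
  filter_upwards [ContinuousMap.coeFn_toLp (p := ∞) μ (𝕜 := ℂ) p] with z hz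
  rw [ContinuousLinearMap.mul_apply', hz]

lemma mulContinuousL_toLp (μ : Measure X) [IsFiniteMeasure μ] (p f : C(X, ℂ)) :
    mulContinuousL μ p (ContinuousMap.toLp 2 μ ℂ f) = ContinuousMap.toLp 2 μ ℂ (p * f) := by
  refine Lp.ext ((coeFn_mulContinuousL μ p _).trans ?_)
  filter_upwards [ContinuousMap.coeFn_toLp (p := 2) μ (𝕜 := ℂ) f,
    ContinuousMap.coeFn_toLp (p := 2) μ (𝕜 := ℂ) (p * f)] with z h1 h2
  rw [h1, h2, ContinuousMap.mul_apply]

variable (rep : C(X, ℂ) →⋆ₐ[ℂ] (H →L[ℂ] H))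

theorem exists_cyclicIsometry {x : H} {μ : Measure X} [IsFiniteMeasure μ]
    (hμ : spectralMeasure rep x = μ) :
    ∃ T : Lp ℂ 2 μ →ₗᵢ[ℂ] H, ∀ f, T (ContinuousMap.toLp 2 μ ℂ f) = rep f x := by
  let e : C(X, ℂ) →L[ℂ] Lp ℂ 2 μ := ContinuousMap.toLp 2 μ ℂ
  let L : C(X, ℂ) →ₗ[ℂ] H :=
    { toFun := fun f => rep f x
      map_add' := fun f g => by rw [map_add, add_apply]
      map_smul' := fun c f => by rw [map_smul, smul_apply, RingHom.id_apply] }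
  have hd : DenseRange e := ContinuousMap.toLp_denseRange ℂ μ ℂ (by simp)
  have hn : ∀ f, ‖L f‖ = ‖e f‖ := fun f => by
    have h1 : inner ℂ (e f) (e f) = inner ℂ (rep f x) (rep f x) := by
      rw [ContinuousMap.inner_toLp, inner_rep_rep, ← integral_spectralMeasure, hμ]
      refine integral_congr_ae (.of_forall fun z => ?_)
      simp [mul_comm]
    rw [inner_self_eq_norm_sq_to_K, inner_self_eq_norm_sq_to_K] at h1
    have h2 : ‖e f‖ ^ 2 = ‖rep f x‖ ^ 2 := by exact_mod_cast h1
    exact ((sq_eq_sq₀ (norm_nonneg _) (norm_nonneg _)).1 h2).symm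
  have hle : ∃ C, ∀ f, ‖L f‖ ≤ C * ‖(e : C(X, ℂ) →ₗ[ℂ] Lp ℂ 2 μ) f‖ :=
    ⟨1, fun f => by rw [one_mul]; exact (hn f).le⟩
  obtain ⟨E, hE⟩ : ∃ E : Lp ℂ 2 μ →L[ℂ] H, ∀ f, E (e f) = L f :=
    ⟨L.extendOfNorm e, fun f => LinearMap.extendOfNorm_eq hd hle f⟩
  have hnorm : ∀ u, ‖E u‖ = ‖u‖ := fun u => by
    refine hd.induction_on (p := fun u => ‖E u‖ = ‖u‖) u
      (isClosed_eq (by fun_prop) (by fun_prop)) fun f => ?_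
    rw [hE, hn]
  exact ⟨⟨E.toLinearMap, hnorm⟩, hE⟩

variable {rep} {x : H} {μ : Measure X} [IsFiniteMeasure μ] {T : Lp ℂ 2 μ →ₗᵢ[ℂ] H}

lemma cyclicIsometry_mem_repCyc (hT : ∀ f, T (ContinuousMap.toLp 2 μ ℂ f) = rep f x)
    (u : Lp ℂ 2 μ) : T u ∈ repCyc rep {x} := by
  refine (ContinuousMap.toLp_denseRange ℂ μ ℂ (by simp)).induction_on
    (p := fun u => T u ∈ repCyc rep {x}) u
    ((isClosed_repCyc rep _).preimage T.continuous) fun f => ?_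
  rw [hT]
  exact rep_mem_repCyc rep (Set.mem_singleton x) f

lemma rep_cyclicIsometry (hT : ∀ f, T (ContinuousMap.toLp 2 μ ℂ f) = rep f x)
    (p : C(X, ℂ)) (u : Lp ℂ 2 μ) : rep p (T u) = T (mulContinuousL μ p u) := by
  refine (ContinuousMap.toLp_denseRange ℂ μ ℂ (by simp)).induction_on
    (p := fun u => rep p (T u) = T (mulContinuousL μ p u)) u
    (isClosed_eq ((rep p).continuous.comp T.continuous)
      (T.continuous.comp (mulContinuousL μ p).continuous)) fun f => ?_
  rw [mulContinuousL_toLp, hT, hT, map_mul, mul_apply_eq_comp]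

/-- Every finite measure absolutely continuous with respect to the spectral measure of `x` is the
spectral measure of a vector in the cyclic space of `x`. -/
theorem exists_spectralMeasure_eq_of_absolutelyContinuous (x : H) {ν : Measure X}
    [IsFiniteMeasure ν] (hν : ν ≪ spectralMeasure rep x) :
    ∃ y ∈ repCyc rep {x}, spectralMeasure rep y = ν := by
  set μ := spectralMeasure rep x with hμ
  obtain ⟨T, hT⟩ := exists_cyclicIsometry rep hμ.symm
  set d : X → ℝ≥0∞ := ν.rnDeriv μ with hd
  have hdm : Measurable d := Measure.measurable_rnDeriv _ _
  set s : X → ℂ := fun z => ((√(d z).toReal : ℝ) : ℂ) with hs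
  have hsm : Measurable s := Complex.measurable_ofReal.comp hdm.ennreal_toReal.sqrt
  have hsq : ∀ z, ‖s z‖ ^ 2 = (d z).toReal := fun z => by
    rw [hs, Complex.norm_real, Real.norm_of_nonneg (Real.sqrt_nonneg _),
      Real.sq_sqrt ENNReal.toReal_nonneg]
  have hmem : MemLp s 2 μ := by
    rw [memLp_two_iff_integrable_sq_norm hsm.aestronglyMeasurable]
    simp_rw [hsq]
    exact Measure.integrable_toReal_rnDeriv
  refine ⟨T hmem.toLp, cyclicIsometry_mem_repCyc hT _, spectralMeasure_eq rep fun p => ?_⟩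
  rw [rep_cyclicIsometry hT, T.inner_map_map, L2.inner_def]
  rw [← integral_rnDeriv_smul hν (f := fun z => p z)]
  refine integral_congr_ae ?_
  filter_upwards [coeFn_mulContinuousL μ p hmem.toLp, hmem.coeFn_toLp] with z h1 h2
  rw [h1, h2, RCLike.inner_apply, mul_assoc, Complex.mul_conj', ← Complex.ofReal_pow, hsq,
    Complex.real_smul, mul_comm]

end CyclicIsometry

section ChaconBound

open scoped ENNReal

lemma norm_sq_eq_of_inner_self_eq {E : Type*} [NormedAddCommGroup E] [InnerProductSpace ℂ E]
    {x : E} {r : ℝ} (h : inner ℂ x x = (r : ℂ)) : ‖x‖ ^ 2 = r := by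
  rw [← inner_self_eq_norm_sq (𝕜 := ℂ), h]
  exact Complex.ofReal_re r

lemma mul_le_half_mul_add_div {q b P : ℝ} (hb : b ^ 2 ≤ P) :
    q * b ≤ (q ^ 2 * P + b ^ 2 / P) / 2 := by
  rcases ((sq_nonneg b).trans hb).eq_or_lt with h0 | h0
  · have : b = 0 := by nlinarith
    simp [this, ← h0]
  · have h : q ^ 2 * P + b ^ 2 / P - 2 * (q * b) = (q * P - b) ^ 2 / P := by
      field_simp
      ring
    have : 0 ≤ (q * P - b) ^ 2 / P := by positivity
    linarith

lemma sum_norm_adjoint_sq_le {L ι : Type*} [NormedAddCommGroup L] [InnerProductSpace ℂ L]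
    [CompleteSpace L] [Fintype ι] (T : ι → L →ₗᵢ[ℂ] H)
    (hT : ∀ i j, i ≠ j → ∀ u w, inner ℂ (T i u) (T j w) = 0) (y : H) :
    ∑ i, ‖ContinuousLinearMap.adjoint (T i).toContinuousLinearMap y‖ ^ 2 ≤ ‖y‖ ^ 2 := by
  classical
  set s : ι → L := fun i => ContinuousLinearMap.adjoint (T i).toContinuousLinearMap y with hs
  set v : H := ∑ i, T i (s i) with hv
  have hinner : ∀ i (w : L), inner ℂ (T i w) y = inner ℂ w (s i) := fun i w => by
    rw [hs, ContinuousLinearMap.adjoint_inner_right]; rfl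
  have h1 : inner ℂ v y = ((∑ i, ‖s i‖ ^ 2 : ℝ) : ℂ) := by
    rw [hv, sum_inner, Complex.ofReal_sum]
    refine Finset.sum_congr rfl fun i _ => ?_
    rw [hinner, inner_self_eq_norm_sq_to_K]
    norm_cast
  have h2 : inner ℂ v v = ((∑ i, ‖s i‖ ^ 2 : ℝ) : ℂ) := by
    rw [hv, sum_inner, Complex.ofReal_sum]
    refine Finset.sum_congr rfl fun i _ => ?_
    rw [inner_sum, Finset.sum_eq_single i (fun j _ hj => hT i j hj.symm _ _) (by simp),
      LinearIsometry.inner_map_map, inner_self_eq_norm_sq_to_K]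
    norm_cast
  have h3 : ‖v‖ ^ 2 = ∑ i, ‖s i‖ ^ 2 := norm_sq_eq_of_inner_self_eq h2
  have h4 : ∑ i, ‖s i‖ ^ 2 ≤ ‖v‖ * ‖y‖ := by
    have h := norm_inner_le_norm (𝕜 := ℂ) v y
    rwa [h1, Complex.norm_real, Real.norm_of_nonneg (by positivity)] at h
  nlinarith [sq_nonneg (‖v‖ - ‖y‖)]

variable {X : Type*} [MetricSpace X] [CompactSpace X] [MeasurableSpace X] [BorelSpace X]
  {rep : C(X, ℂ) →⋆ₐ[ℂ] (H →L[ℂ] H)} {μ : Measure X} [IsFiniteMeasure μ]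

lemma inner_mulContinuousL_left (p : C(X, ℂ)) (u w : Lp ℂ 2 μ) :
    inner ℂ (mulContinuousL μ (star p) u) w = inner ℂ u (mulContinuousL μ p w) := by
  rw [L2.inner_def, L2.inner_def]
  refine integral_congr_ae ?_
  filter_upwards [coeFn_mulContinuousL μ p w, coeFn_mulContinuousL μ (star p) u] with z h1 h2
  rw [h1, h2]
  simp only [RCLike.inner_apply, ContinuousMap.star_apply, RCLike.star_def, map_mul,
    Complex.conj_conj]
  ring

lemma adjoint_cyclicIsometry_rep {x : H} {T : Lp ℂ 2 μ →ₗᵢ[ℂ] H}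
    (hT : ∀ f, T (ContinuousMap.toLp 2 μ ℂ f) = rep f x) (q : C(X, ℂ)) (g : H) :
    ContinuousLinearMap.adjoint T.toContinuousLinearMap (rep q g) =
      mulContinuousL μ q (ContinuousLinearMap.adjoint T.toContinuousLinearMap g) := by
  refine ext_inner_left ℂ fun w => ?_
  rw [ContinuousLinearMap.adjoint_inner_right, ← inner_mulContinuousL_left,
    ContinuousLinearMap.adjoint_inner_right]
  change inner ℂ (T w) (rep q g) = inner ℂ (T (mulContinuousL μ (star q) w)) g
  rw [← rep_cyclicIsometry hT, map_star, ContinuousLinearMap.star_eq_adjoint,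
    ContinuousLinearMap.adjoint_inner_left]

lemma integrable_norm_sq_Lp (u : Lp ℂ 2 μ) : Integrable (fun z => ‖u z‖ ^ 2) μ :=
  (memLp_two_iff_integrable_sq_norm (Lp.aestronglyMeasurable u)).1 (Lp.memLp u)

lemma norm_sq_Lp_eq_integral (u : Lp ℂ 2 μ) : ‖u‖ ^ 2 = ∫ z, ‖u z‖ ^ 2 ∂μ := by
  refine norm_sq_eq_of_inner_self_eq ?_
  rw [L2.inner_def, ← integral_complex_ofReal]
  refine integral_congr_ae (.of_forall fun z => ?_)
  simp only [inner_self_eq_norm_sq_to_K]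
  norm_cast

/-- Vectors with a common spectral measure and orthogonal cyclic spaces cannot all be close to
one and the same orthonormal family inside a single cyclic space. -/
theorem sum_norm_inner_sq_le_of_orthCyclic {ι : Type*} [Fintype ι] {f : ι → H}
    (hf : ∀ i, spectralMeasure rep (f i) = μ)
    (horth : ∀ i j, i ≠ j → OrthCyclic rep (f i) (f j)) {κ : Type*} [Fintype κ]
    (g : H) (p : κ → C(X, ℂ)) (hg : Orthonormal ℂ fun k => rep (p k) g) :
    ∑ i, ∑ k, ‖inner ℂ (rep (p k) g) (f i)‖ ^ 2 ≤ μ.real Set.univ := by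
  classical
  choose T hT using fun i => exists_cyclicIsometry rep (hf i)
  have hTorth : ∀ i j, i ≠ j → ∀ u w, inner ℂ (T i u) (T j w) = 0 := fun i j hij u w => by
    simpa using (horth i j hij).of_mem_repCyc (cyclicIsometry_mem_repCyc (hT i) u)
      (cyclicIsometry_mem_repCyc (hT j) w) 1
  set φ : ι → Lp ℂ 2 μ := fun i => ContinuousLinearMap.adjoint (T i).toContinuousLinearMap g
    with hφ
  set Φ : X → ℝ := fun z => ∑ i, ‖φ i z‖ ^ 2 with hΦ
  have hΦle : ∀ i z, ‖φ i z‖ ^ 2 ≤ Φ z := fun i z =>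
    Finset.single_le_sum (f := fun i => ‖φ i z‖ ^ 2) (fun _ _ => by positivity) (Finset.mem_univ i)
  have hΦ0 : ∀ z, 0 ≤ Φ z := fun z => by positivity
  set a : ι → X → ℝ := fun i z => ‖φ i z‖ ^ 2 / Φ z with ha
  have ha0 : ∀ i z, 0 ≤ a i z := fun i z => by have := hΦ0 z; positivity
  have ha1 : ∀ i z, a i z ≤ 1 := fun i z => div_le_one_of_le₀ (hΦle i z) (hΦ0 z)
  have hΦint : Integrable Φ μ := integrable_finsetSum _ fun i _ => integrable_norm_sq_Lp (φ i)
  have haint : ∀ i, Integrable (a i) μ := fun i => by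
    refine (integrable_const (1 : ℝ)).mono'
      ((integrable_norm_sq_Lp (φ i)).aestronglyMeasurable.aemeasurable.div
        hΦint.aestronglyMeasurable.aemeasurable).aestronglyMeasurable (.of_forall fun z => ?_)
    rw [Real.norm_of_nonneg (ha0 i z)]
    exact ha1 i z
  have hqint : ∀ q : C(X, ℂ), Integrable (fun z => ‖q z‖ ^ 2 * Φ z) μ := fun q => by
    refine hΦint.bdd_mul (c := ‖q‖ ^ 2) (by fun_prop) (.of_forall fun z => ?_)
    rw [Real.norm_of_nonneg (by positivity)]
    gcongr
    exact q.norm_coe_le_norm z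
  have hq : ∀ q : C(X, ℂ), ∫ z, ‖q z‖ ^ 2 * Φ z ∂μ ≤ ‖rep q g‖ ^ 2 := fun q => by
    refine le_of_eq_of_le ?_ (sum_norm_adjoint_sq_le T hTorth (rep q g))
    simp_rw [adjoint_cyclicIsometry_rep (hT _), norm_sq_Lp_eq_integral]
    rw [← integral_finsetSum _ fun i _ => integrable_norm_sq_Lp _]
    refine integral_congr_ae ?_
    filter_upwards [ae_all_iff.2 fun i => coeFn_mulContinuousL μ q (φ i)] with z hz
    simp only [hΦ, Finset.mul_sum]
    refine Finset.sum_congr rfl fun i _ => ?_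
    rw [hz i, norm_mul, mul_pow]
  have hS : ∀ i, ∑ k, ‖inner ℂ (rep (p k) g) (f i)‖ ^ 2 ≤ ∫ z, a i z ∂μ := fun i => by
    set S := ∑ k, ‖inner ℂ (rep (p k) g) (f i)‖ ^ 2 with hS
    set q : C(X, ℂ) := ∑ k, inner ℂ (rep (p k) g) (f i) • p k with hqdef
    have hrep : rep q g = ∑ k, inner ℂ (rep (p k) g) (f i) • rep (p k) g := by
      rw [hqdef, map_sum, sum_apply]
      simp_rw [map_smul, smul_apply]
    have hN : ‖rep q g‖ ^ 2 = S := by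
      refine norm_sq_eq_of_inner_self_eq ?_
      rw [hrep, hg.inner_sum, hS, Complex.ofReal_sum]
      refine Finset.sum_congr rfl fun k _ => ?_
      rw [Complex.conj_mul', Complex.ofReal_pow]
    have hI : inner ℂ (rep q g) (f i) = (S : ℂ) := by
      rw [hrep, sum_inner, hS, Complex.ofReal_sum]
      refine Finset.sum_congr rfl fun k _ => ?_
      rw [inner_smul_left, Complex.conj_mul', Complex.ofReal_pow]
    have hf1 : f i = T i (ContinuousMap.toLp 2 μ ℂ 1) := by rw [hT, map_one, one_apply_eq_self]
    have hI2 : inner ℂ (rep q g) (f i) = ∫ z, starRingEnd ℂ (q z * φ i z) ∂μ := by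
      have : inner ℂ (rep q g) (f i) = inner ℂ (ContinuousLinearMap.adjoint
          (T i).toContinuousLinearMap (rep q g)) (ContinuousMap.toLp 2 μ ℂ 1) := by
        rw [ContinuousLinearMap.adjoint_inner_left, hf1]; rfl
      rw [this, adjoint_cyclicIsometry_rep (hT i), L2.inner_def]
      refine integral_congr_ae ?_
      filter_upwards [coeFn_mulContinuousL μ q (φ i),
        ContinuousMap.coeFn_toLp (p := 2) μ (𝕜 := ℂ) (1 : C(X, ℂ))] with z h1 h2
      rw [h1, h2, RCLike.inner_apply]
      simp
    have hSle : S ≤ ∫ z, (‖q z‖ ^ 2 * Φ z + a i z) / 2 ∂μ := by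
      have hSn : S = ‖inner ℂ (rep q g) (f i)‖ := by
        rw [hI, Complex.norm_real, Real.norm_of_nonneg (by positivity)]
      rw [hSn, hI2]
      refine norm_integral_le_of_norm_le (((hqint q).add (haint i)).div_const 2)
        (.of_forall fun z => ?_)
      rw [RCLike.norm_conj, norm_mul]
      exact mul_le_half_mul_add_div (hΦle i z)
    rw [integral_div, integral_add (hqint q) (haint i)] at hSle
    have := hq q
    rw [hN] at this
    linarith
  refine (Finset.sum_le_sum fun i _ => hS i).trans ?_
  rw [← integral_finsetSum _ fun i _ => haint i]
  calc ∫ z, ∑ i, a i z ∂μ ≤ ∫ _, (1 : ℝ) ∂μ := by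
        refine integral_mono (integrable_finsetSum _ fun i _ => haint i) (integrable_const _)
          fun z => ?_
        simp only [ha, ← Finset.sum_div]
        exact div_self_le_one _
    _ = μ.real Set.univ := by simp

end ChaconBound

section Criterion

lemma norm_add_sq_le_weighted {E : Type*} [NormedAddCommGroup E] (a b : E) {δ : ℝ} (hδ : 0 < δ) :
    ‖a + b‖ ^ 2 ≤ (1 + δ) * ‖a‖ ^ 2 + (1 + 1 / δ) * ‖b‖ ^ 2 := by
  have h1 : ‖a + b‖ ^ 2 ≤ (‖a‖ + ‖b‖) ^ 2 := by gcongr; exact norm_add_le a b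
  have h2 : δ * ‖a‖ ^ 2 + 1 / δ * ‖b‖ ^ 2 - 2 * ‖a‖ * ‖b‖ = (δ * ‖a‖ - ‖b‖) ^ 2 / δ := by
    field_simp
    ring
  have h3 : 0 ≤ (δ * ‖a‖ - ‖b‖) ^ 2 / δ := by positivity
  nlinarith

section

variable {X : Type*} [MetricSpace X] [CompactSpace X] [MeasurableSpace X] [BorelSpace X]
  {rep : C(X, ℂ) →⋆ₐ[ℂ] (H →L[ℂ] H)}

lemma orthonormal_rep_pow {u : C(X, ℂ)} (hu : star u * u = 1) {g : H} (hg : ‖g‖ = 1) {n : ℕ}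
    (horth : ∀ k, 0 < k → k < n → inner ℂ (rep (u ^ k) g) g = 0) :
    Orthonormal ℂ fun k : Fin n => rep (star u ^ (k : ℕ)) g := by
  have hu' : u * star u = 1 := by rw [mul_comm, hu]
  have hlt : ∀ j k : Fin n, j < k →
      inner ℂ (rep (star u ^ (j : ℕ)) g) (rep (star u ^ (k : ℕ)) g) = 0 := by
    intro j k hjk
    have hjk' : (j : ℕ) < k := hjk
    have h1 : star (star u ^ (j : ℕ)) * star u ^ (k : ℕ) = star (u ^ ((k : ℕ) - j)) := by
      obtain ⟨d, hd⟩ := Nat.exists_eq_add_of_lt hjk'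
      rw [hd, star_pow, star_star, star_pow, show (j : ℕ) + d + 1 - j = d + 1 by omega, add_assoc,
        pow_add, ← mul_assoc, ← mul_pow, hu', one_pow, one_mul]
    rw [inner_rep_rep, h1, map_star, ContinuousLinearMap.star_eq_adjoint,
      ContinuousLinearMap.adjoint_inner_right]
    exact horth _ (by omega) (by omega)
  refine ⟨fun k => ?_, fun j k hjk => ?_⟩
  · have h1 : ‖rep (star u ^ (k : ℕ)) g‖ ^ 2 = 1 := by
      refine norm_sq_eq_of_inner_self_eq ?_
      rw [inner_rep_rep, star_pow, star_star, ← mul_pow, hu', one_pow, map_one, one_apply_eq_self,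
        inner_self_eq_norm_sq_to_K, hg]
      simp
    exact (pow_eq_one_iff_of_nonneg (norm_nonneg _) (by norm_num)).1 h1
  · rcases lt_or_gt_of_ne hjk with h | h
    · exact hlt j k h
    · change inner ℂ _ _ = 0
      rw [← inner_conj_symm, hlt k j h, map_zero]

theorem exists_repCyc_range_eq_top [TopologicalSpace.SeparableSpace H] {u : C(X, ℂ)}
    (hu : star u * u = 1) {m : ℕ} {r : ℝ} (hr : 1 < (m + 1) * r) {D : Set H} (hD : Dense D)
    (happrox : ∀ S : Finset H, ↑S ⊆ D → ∀ ε > 0, ∃ (g : H) (n : ℕ), ‖g‖ = 1 ∧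
      (∀ k, 0 < k → k < n → inner ℂ (rep (u ^ k) g) g = 0) ∧
      ∀ f ∈ S, r * ‖f‖ ^ 2 - ε ≤ ∑ k ∈ Finset.range n, ‖inner ℂ g (rep (u ^ k) f)‖ ^ 2) :
    ∃ x : Fin m → H, repCyc rep (Set.range x) = ⊤ := by
  classical
  by_contra hcon
  obtain ⟨x, hx, hxmax⟩ := exists_maximal_chain (rep := rep) m
  have hP : repCyc rep (x '' Set.Iio m) ≠ ⊤ := fun h => hcon ⟨fun i => x i, by
    rw [← h]
    congr 1
    ext y
    simp only [Set.mem_range, Set.mem_image, Set.mem_Iio]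
    exact ⟨fun ⟨i, hi⟩ => ⟨i, i.2, hi⟩, fun ⟨j, hj, hy⟩ => ⟨⟨j, hj⟩, hy⟩⟩⟩
  obtain ⟨y₀, hy₀, hy₀0⟩ : ∃ y ∈ (repCyc rep (x '' Set.Iio m))ᗮ, y ≠ 0 :=
    Submodule.exists_mem_ne_zero_of_ne_bot fun h => hP ((Submodule.orthogonal_eq_bot_iff).1 h)
  set y : H := ((‖y₀‖⁻¹ : ℝ) : ℂ) • y₀ with hydef
  have hy : y ∈ (repCyc rep (x '' Set.Iio m))ᗮ := Submodule.smul_mem _ _ hy₀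
  have hynorm : ‖y‖ = 1 := by
    rw [hydef, norm_smul, Complex.norm_real, norm_inv, norm_norm,
      inv_mul_cancel₀ (norm_ne_zero_iff.2 hy₀0)]
  rw [mem_repCyc_orthogonal] at hy
  have hyo : ∀ j < m, OrthCyclic rep (x j) y := fun j hj => hy _ ⟨j, hj, rfl⟩
  set μ := spectralMeasure rep y with hμ
  have hμ1 : μ.real Set.univ = 1 := by
    rw [Measure.real, hμ, spectralMeasure_univ, hynorm]; simp
  set b : Fin (m + 1) → H := fun i => if (i : ℕ) < m then x i else y with hb
  have hborth : ∀ i j, i ≠ j → OrthCyclic rep (b i) (b j) := by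
    intro i j hij
    have hij' : (i : ℕ) ≠ j := fun h => hij (Fin.ext h)
    by_cases hi : (i : ℕ) < m <;> by_cases hj : (j : ℕ) < m
    · simp only [hb, hi, hj, if_true]; exact hx _ hi _ hj hij'
    · simp only [hb, hi, hj, if_true, if_false]; exact hyo _ hi
    · simp only [hb, hi, hj, if_true, if_false]; exact (hyo _ hj).symm
    · omega
  have hex : ∀ i, ∃ a ∈ repCyc rep {b i}, spectralMeasure rep a = μ := by
    intro i
    by_cases hi : (i : ℕ) < m
    · simp only [hb, hi, if_true]
      exact exists_spectralMeasure_eq_of_absolutelyContinuous _ (hxmax y hyo _ hi)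
    · simp only [hb, hi, if_false]
      exact ⟨y, mem_repCyc rep rfl, rfl⟩
  choose f hfmem hfμ using hex
  have hforth : ∀ i j, i ≠ j → OrthCyclic rep (f i) (f j) := fun i j hij =>
    (hborth i j hij).of_mem_repCyc (hfmem i) (hfmem j)
  have hfnorm : ∀ i, ‖f i‖ = 1 := fun i => by
    have h1 := spectralMeasure_univ rep (f i)
    rw [hfμ, hμ, spectralMeasure_univ, hynorm,
      ENNReal.ofReal_eq_ofReal_iff (by positivity) (by positivity), one_pow] at h1
    exact (pow_eq_one_iff_of_nonneg (norm_nonneg _) (by norm_num)).1 h1.symm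
  have hr0 : 0 < r := by
    by_contra h
    have : ((m : ℝ) + 1) * r ≤ 0 := mul_nonpos_of_nonneg_of_nonpos (by positivity) (not_lt.1 h)
    linarith
  obtain ⟨δ, hδ0, hδ1, hδ⟩ : ∃ δ : ℝ, 0 < δ ∧ δ < 1 ∧
      1 + δ < (m + 1) * (r * (1 - δ) ^ 2 - δ - (1 + 1 / δ) * δ ^ 2) := by
    have hcont : Continuous fun δ : ℝ =>
        ((m : ℝ) + 1) * (r * (1 - δ) ^ 2 - δ - (δ ^ 2 + δ)) - (1 + δ) := by fun_prop
    have h1 := (hcont.tendsto 0).eventually (lt_mem_nhds (a := 0) (by norm_num; linarith))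
    have h2 : ∀ᶠ δ : ℝ in nhds 0, δ < 1 := gt_mem_nhds one_pos
    obtain ⟨δ, ⟨h3, h4⟩, h5⟩ := ((((h1.and h2).filter_mono nhdsWithin_le_nhds).and
      (self_mem_nhdsWithin (a := (0 : ℝ)) (s := Set.Ioi 0))).exists)
    have h5' : 0 < δ := h5
    refine ⟨δ, h5, h4, ?_⟩
    have : (1 + 1 / δ) * δ ^ 2 = δ ^ 2 + δ := by field_simp
    rw [this]
    linarith
  choose f' hf'D hf' using fun i => Metric.dense_iff.1 hD (f i) δ hδ0
  obtain ⟨g, n, hg, horth, hgf⟩ := happrox (Finset.univ.image f') (by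
    intro z hz
    obtain ⟨i, -, rfl⟩ := Finset.mem_image.1 hz
    exact hf' i) δ hδ0
  have hon := orthonormal_rep_pow hu hg horth
  have hchacon := sum_norm_inner_sq_le_of_orthCyclic hfμ hforth g _ hon
  rw [hμ1] at hchacon
  have hi : ∀ i, r * (1 - δ) ^ 2 - δ - (1 + 1 / δ) * δ ^ 2 ≤
      (1 + δ) * ∑ k : Fin n, ‖inner ℂ (rep (star u ^ (k : ℕ)) g) (f i)‖ ^ 2 := by
    intro i
    have hdist : ‖f' i - f i‖ ≤ δ := by
      have := hf'D i
      rw [Metric.mem_ball, dist_eq_norm] at this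
      exact this.le
    have h1 := hgf (f' i) (Finset.mem_image_of_mem _ (Finset.mem_univ i))
    have h2 : ∀ k, inner ℂ g (rep (u ^ k) (f' i)) = inner ℂ (rep (star u ^ k) g) (f' i) :=
      fun k => by
        rw [← star_pow, map_star, ContinuousLinearMap.star_eq_adjoint,
          ContinuousLinearMap.adjoint_inner_left]
    simp_rw [h2] at h1
    rw [Finset.sum_range fun k => ‖inner ℂ (rep (star u ^ k) g) (f' i)‖ ^ 2] at h1
    have h3 : ∑ k : Fin n, ‖inner ℂ (rep (star u ^ (k : ℕ)) g) (f' i)‖ ^ 2 ≤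
        (1 + δ) * ∑ k : Fin n, ‖inner ℂ (rep (star u ^ (k : ℕ)) g) (f i)‖ ^ 2 +
        (1 + 1 / δ) * ∑ k : Fin n, ‖inner ℂ (rep (star u ^ (k : ℕ)) g) (f' i - f i)‖ ^ 2 := by
      rw [Finset.mul_sum, Finset.mul_sum, ← Finset.sum_add_distrib]
      refine Finset.sum_le_sum fun k _ => ?_
      refine le_trans (le_of_eq ?_) (norm_add_sq_le_weighted _ _ hδ0)
      rw [← inner_add_right, add_sub_cancel]
    have h4 : ∑ k : Fin n, ‖inner ℂ (rep (star u ^ (k : ℕ)) g) (f' i - f i)‖ ^ 2 ≤ δ ^ 2 :=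
      (hon.sum_inner_products_le _).trans (by gcongr)
    have h5 : (1 - δ) ^ 2 ≤ ‖f' i‖ ^ 2 := by
      have : 1 - δ ≤ ‖f' i‖ := by
        have := norm_sub_norm_le (f i) (f' i)
        rw [norm_sub_rev, hfnorm] at this
        linarith
      have h0 : 0 ≤ 1 - δ := by linarith
      gcongr
    have h6 : (1 + 1 / δ) * ∑ k : Fin n, ‖inner ℂ (rep (star u ^ (k : ℕ)) g) (f' i - f i)‖ ^ 2 ≤
        (1 + 1 / δ) * δ ^ 2 := by gcongr
    have h7 : r * (1 - δ) ^ 2 ≤ r * ‖f' i‖ ^ 2 := by gcongr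
    linarith
  have hsum := Finset.sum_le_sum fun i (_ : i ∈ Finset.univ) => hi i
  rw [← Finset.mul_sum, Finset.sum_const, Finset.card_univ, Fintype.card_fin, nsmul_eq_mul] at hsum
  push_cast at hsum
  have : (1 + δ) * ∑ i, ∑ k : Fin n, ‖inner ℂ (rep (star u ^ (k : ℕ)) g) (f i)‖ ^ 2 ≤
      (1 + δ) * 1 := by gcongr
  linarith

end

/-- A criterion bounding the spectral multiplicity of a unitary operator by partial approximation
of finite families of vectors by orthonormal orbits. -/
theorem spectralMultiplicityAtMost_of_approx [TopologicalSpace.SeparableSpace H]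
    (V : H ≃ₗᵢ[ℂ] H) {m : ℕ} {r : ℝ} (hr : 1 < (m + 1) * r) {D : Set H} (hD : Dense D)
    (happrox : ∀ S : Finset H, ↑S ⊆ D → ∀ ε > 0, ∃ (g : H) (n : ℕ), ‖g‖ = 1 ∧
      (∀ k, 0 < k → k < n → inner ℂ ((V ^ k) g) g = 0) ∧
      ∀ f ∈ S, r * ‖f‖ ^ 2 - ε ≤ ∑ k ∈ Finset.range n, ‖inner ℂ g ((V ^ k) f)‖ ^ 2) :
    SpectralMultiplicityAtMost V m := by
  set U : H →L[ℂ] H := V.toContinuousLinearEquiv.toContinuousLinearMap with hU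
  have hstar : star U = V.symm.toContinuousLinearEquiv.toContinuousLinearMap :=
    V.adjoint_eq_symm
  have hUU : star U * U = 1 := by
    rw [hstar]; ext z; simp [hU]
  have hUU' : U * star U = 1 := by
    rw [hstar]; ext z; simp [hU]
  have hnorm : IsStarNormal U := ⟨by rw [Commute, SemiconjBy, hUU, hUU']⟩
  let rep : C(spectrum ℂ U, ℂ) →⋆ₐ[ℂ] (H →L[ℂ] H) := cfcHom hnorm
  have hcont : Continuous rep := cfcHom_continuous hnorm
  let u : C(spectrum ℂ U, ℂ) := .restrict (spectrum ℂ U) (.id ℂ)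
  have hrepu : rep u = U := cfcHom_id hnorm
  have hu : star u * u = 1 := by
    apply cfcHom_injective hnorm
    change rep (star u * u) = rep 1
    rw [map_mul, map_star, hrepu, hUU, map_one]
  have hpow : ∀ (k : ℕ) (z : H), rep (u ^ k) z = (V ^ k) z := by
    intro k
    induction k with
    | zero => intro z; simp
    | succ k ih => intro z; rw [pow_succ, pow_succ, map_mul, mul_apply_eq_comp, ih, hrepu]; rfl
  obtain ⟨x, hx⟩ := exists_repCyc_range_eq_top (rep := rep) hu hr hD (by simpa only [hpow])
  refine ⟨x, ?_⟩
  set M : Submodule ℂ H := ⨆ i, zCyclicSpace V (x i) with hM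
  have hstep : ∀ (W : H →L[ℂ] H), (∀ (n : ℤ) (z : H), ∃ n' : ℤ, W ((V ^ n) z) = (V ^ n') z) →
      ∀ z ∈ M.topologicalClosure, W z ∈ M.topologicalClosure := by
    intro W hW
    change M.topologicalClosure ≤ M.topologicalClosure.comap (W : H →ₗ[ℂ] H)
    refine Submodule.topologicalClosure_minimal _ (iSup_le fun i => Submodule.span_le.2 ?_)
      (M.isClosed_topologicalClosure.preimage W.continuous)
    rintro _ ⟨n, rfl⟩
    obtain ⟨n', hn'⟩ := hW n (x i)
    refine M.le_topologicalClosure (Submodule.mem_iSup_of_mem i (Submodule.subset_span ⟨n', hn'⟩))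
  have hinv : IsRepInvariant rep M.topologicalClosure := by
    intro f
    refine ContinuousMap.induction_on_of_compact
      (p := fun f => ∀ z ∈ M.topologicalClosure, rep f z ∈ M.topologicalClosure)
      ?_ ?_ ?_ ?_ ?_ ?_ f
    · intro c z hz
      have h1 : (ContinuousMap.const (spectrum ℂ U) c) = algebraMap ℂ _ c := rfl
      rw [h1, AlgHomClass.commutes, Algebra.algebraMap_eq_smul_one, smul_apply, one_apply_eq_self]
      exact Submodule.smul_mem _ _ hz
    · change ∀ z ∈ M.topologicalClosure, rep u z ∈ M.topologicalClosure
      rw [hrepu]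
      exact hstep U fun n z => ⟨1 + n, by rw [zpow_add, zpow_one]; rfl⟩
    · change ∀ z ∈ M.topologicalClosure, rep (star u) z ∈ M.topologicalClosure
      rw [map_star, hrepu, hstar]
      exact hstep _ fun n z => ⟨-1 + n, by rw [zpow_add, zpow_neg_one]; rfl⟩
    · intro p q hp hq z hz
      rw [map_add, add_apply]
      exact add_mem (hp z hz) (hq z hz)
    · intro p q hp hq z hz
      rw [map_mul, mul_apply_eq_comp]
      exact hp _ (hq z hz)
    · intro p hp z hz
      have hclosed : IsClosed {q : C(spectrum ℂ U, ℂ) | rep q z ∈ M.topologicalClosure} :=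
        M.isClosed_topologicalClosure.preimage
          ((ContinuousLinearMap.apply ℂ H z).continuous.comp hcont)
      exact hclosed.mem_of_frequently_of_tendsto (hp.mono fun q hq => hq z hz) Filter.tendsto_id
  rw [eq_top_iff, ← hx]
  refine repCyc_le M.isClosed_topologicalClosure hinv ?_
  rintro _ ⟨i, rfl⟩
  exact M.le_topologicalClosure
    (Submodule.mem_iSup_of_mem i (Submodule.subset_span ⟨0, by simp⟩))

end Criterion

section WeightedOperator

/-- The cocycle `ξ(x) ξ(x + a) ⋯ ξ(x + (i - 1) a)` over the rotation by `a`. -/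
noncomputable def cocycleProd (a : AddCircle (1 : ℝ)) (ξ : AddCircle (1 : ℝ) → ℂ) (i : ℕ)
    (x : AddCircle (1 : ℝ)) : ℂ :=
  ∏ j ∈ Finset.range i, ξ (x + j • a)

lemma norm_cocycleProd {a : AddCircle (1 : ℝ)} {ξ : AddCircle (1 : ℝ) → ℂ} (hξ : ∀ x, ‖ξ x‖ = 1)
    (i : ℕ) (x : AddCircle (1 : ℝ)) : ‖cocycleProd a ξ i x‖ = 1 := by
  simp [cocycleProd, norm_prod, hξ]

variable {α : ℝ} {ξ : AddCircle (1 : ℝ) → ℂ}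
  {V : Lp ℂ 2 (volume : Measure (AddCircle (1 : ℝ))) ≃ₗᵢ[ℂ]
    Lp ℂ 2 (volume : Measure (AddCircle (1 : ℝ)))}

lemma IsWeightedOperator.aestronglyMeasurable (hV : IsWeightedOperator α ξ V) :
    AEStronglyMeasurable ξ (volume : Measure (AddCircle (1 : ℝ))) := by
  have h1 : MemLp (fun _ : AddCircle (1 : ℝ) => (1 : ℂ)) 2 volume := memLp_const 1
  refine (Lp.aestronglyMeasurable (V h1.toLp)).congr ((hV _).trans ?_)
  have h2 := (measurePreserving_add_right volume
    (α : AddCircle (1 : ℝ))).quasiMeasurePreserving.ae_eq_comp h1.coeFn_toLp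
  filter_upwards [h2] with x hx
  simp only [Function.comp_apply] at hx
  rw [hx, mul_one]

lemma aestronglyMeasurable_cocycleProd
    (h : AEStronglyMeasurable ξ (volume : Measure (AddCircle (1 : ℝ)))) (a : AddCircle (1 : ℝ))
    (i : ℕ) : AEStronglyMeasurable (cocycleProd a ξ i) volume := by
  unfold cocycleProd
  refine Finset.aestronglyMeasurable_fun_prod _ fun j _ => ?_
  exact h.comp_quasiMeasurePreserving
    (measurePreserving_add_right volume (j • a)).quasiMeasurePreserving

lemma IsWeightedOperator.pow_apply (hV : IsWeightedOperator α ξ V) (i : ℕ)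
    (f : Lp ℂ 2 (volume : Measure (AddCircle (1 : ℝ)))) :
    ((V ^ i) f : AddCircle (1 : ℝ) → ℂ) =ᵐ[volume]
      fun x => cocycleProd α ξ i x * f (x + i • (α : AddCircle (1 : ℝ))) := by
  induction i generalizing f with
  | zero => simp [cocycleProd]
  | succ i ih =>
    have h1 : (V ^ (i + 1)) f = (V ^ i) (V f) := by rw [pow_succ]; rfl
    rw [h1]
    have h2 := (measurePreserving_add_right volume
      (i • (α : AddCircle (1 : ℝ)))).quasiMeasurePreserving.ae_eq_comp (hV f)
    filter_upwards [ih (V f), h2] with x hx hx2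
    simp only [Function.comp_apply] at hx2
    rw [hx, hx2, cocycleProd, cocycleProd, Finset.prod_range_succ, succ_nsmul,
      ← add_assoc, mul_assoc]

end WeightedOperator

section WeightedEquidistribution

lemma measureReal_univ_addCircle_one :
    (volume : Measure (AddCircle (1 : ℝ))).real Set.univ = 1 := by
  simp [measureReal_def, AddCircle.measure_univ]

lemma sum_mul_pow_mul_one_sub (w : ℕ → ℝ) (z : ℂ) (h : ℕ) :
    (∑ i ∈ Finset.range h, (w i : ℂ) * z ^ i) * (1 - z) =
      w 0 - w h * z ^ h + ∑ i ∈ Finset.range h, ((w (i + 1) - w i : ℝ) : ℂ) * z ^ (i + 1) := by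
  induction h with
  | zero => simp
  | succ h ih =>
    rw [Finset.sum_range_succ, add_mul, ih, Finset.sum_range_succ]
    push_cast
    ring

/-- Weights of size at most `ℓ` and of total variation `O(ℓ)` along an orbit segment of
length at most `1 / ℓ`. -/
structure IsSlowWeight (C ℓ : ℝ) (h : ℕ) (w : ℕ → ℝ) : Prop where
  nonneg : ∀ i, 0 ≤ w i
  le : ∀ i, w i ≤ ℓ
  length : h * ℓ ≤ 1
  variation : ∑ i ∈ Finset.range h, |w (i + 1) - w i| ≤ C * ℓ

lemma IsSlowWeight.sum_le {C ℓ : ℝ} {h : ℕ} {w : ℕ → ℝ} (hw : IsSlowWeight C ℓ h w) :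
    ∑ i ∈ Finset.range h, w i ≤ 1 := by
  refine (Finset.sum_le_sum fun i _ => hw.le i).trans ?_
  simpa using hw.length

lemma norm_sum_slowWeight_mul_pow_le {C ℓ : ℝ} {h : ℕ} {w : ℕ → ℝ} (hw : IsSlowWeight C ℓ h w)
    {z : ℂ} (hz : ‖z‖ = 1) :
    ‖∑ i ∈ Finset.range h, (w i : ℂ) * z ^ i‖ * ‖1 - z‖ ≤ (2 + C) * ℓ := by
  rw [← norm_mul, sum_mul_pow_mul_one_sub]
  have h0 : ∀ i, ‖(w i : ℂ)‖ ≤ ℓ := fun i => by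
    rw [Complex.norm_real, Real.norm_of_nonneg (hw.nonneg i)]; exact hw.le i
  have h1 : ‖(w h : ℂ) * z ^ h‖ ≤ ℓ := by
    rw [norm_mul, norm_pow, hz, one_pow, mul_one]; exact h0 h
  have h2 : ‖∑ i ∈ Finset.range h, ((w (i + 1) - w i : ℝ) : ℂ) * z ^ (i + 1)‖ ≤ C * ℓ := by
    refine (norm_sum_le _ _).trans (le_trans (le_of_eq ?_) hw.variation)
    refine Finset.sum_congr rfl fun i _ => ?_
    rw [norm_mul, norm_pow, hz, one_pow, mul_one, Complex.norm_real, Real.norm_eq_abs]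
  calc _ ≤ ‖(w 0 : ℂ)‖ + ‖(w h : ℂ) * z ^ h‖ + _ :=
        (norm_add_le _ _).trans (add_le_add_left (norm_sub_le _ _) _)
    _ ≤ ℓ + ℓ + C * ℓ := add_le_add (add_le_add (h0 0) h1) h2
    _ = _ := by ring

/-- Equidistribution of an irrational orbit with respect to slowly varying weights. -/
theorem slowWeight_equidistribution {α : ℝ} (hα : Irrational α) (C : ℝ)
    (G : C(AddCircle (1 : ℝ), ℂ)) : ∀ ε > 0, ∃ η > 0, ∀ (ℓ : ℝ) (h : ℕ) (w : ℕ → ℝ),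
      0 < ℓ → ℓ < η → IsSlowWeight C ℓ h w →
      ‖∑ i ∈ Finset.range h, (w i : ℂ) * G (i • (α : AddCircle (1 : ℝ))) -
        (∑ i ∈ Finset.range h, (w i : ℂ)) * ∫ x, G x‖ ≤ ε := by
  set P : C(AddCircle (1 : ℝ), ℂ) → Prop := fun G => ∀ ε > 0, ∃ η > 0,
    ∀ (ℓ : ℝ) (h : ℕ) (w : ℕ → ℝ), 0 < ℓ → ℓ < η → IsSlowWeight C ℓ h w →
      ‖∑ i ∈ Finset.range h, (w i : ℂ) * G (i • (α : AddCircle (1 : ℝ))) -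
        (∑ i ∈ Finset.range h, (w i : ℂ)) * ∫ x, G x‖ ≤ ε with hP
  have hint : ∀ G : C(AddCircle (1 : ℝ), ℂ), Integrable (fun x => G x) volume := fun G =>
    G.continuous.integrable_of_hasCompactSupport (HasCompactSupport.of_compactSpace _)
  have hfourier : ∀ n : ℤ, P (fourier n) := by
    intro n
    by_cases hn : n = 0
    · subst hn
      intro ε hε
      refine ⟨1, one_pos, fun ℓ h w _ _ _ => ?_⟩
      simp [hε.le, measureReal_univ_addCircle_one]
    · have hI : ∫ x : AddCircle (1 : ℝ), fourier n x = 0 := by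
        have := fourierCoeff_fourier (T := 1) n
        have h2 := congrFun this 0
        rw [Pi.single_eq_of_ne (Ne.symm hn), fourierCoeff] at h2
        simpa [AddCircle.volume_eq_smul_haarAddCircle] using h2
      set z : ℂ := fourier n (α : AddCircle (1 : ℝ)) with hz
      have hzpow : ∀ i : ℕ, fourier n (i • (α : AddCircle (1 : ℝ))) = z ^ i := fun i => by
        rw [hz, fourier_apply, fourier_apply, smul_comm, AddCircle.toCircle_nsmul]
        simp
      have hz1 : ‖z‖ = 1 := by rw [hz, fourier_apply]; exact Circle.norm_coe _
      have hzne : z ≠ 1 := by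
        intro h
        rw [hz, fourier_coe_apply, Complex.exp_eq_one_iff] at h
        obtain ⟨k, hk⟩ := h
        have hk2 : (n : ℂ) * α = k := by
          have : (2 * π * Complex.I : ℂ) ≠ 0 := Complex.two_pi_I_ne_zero
          apply mul_left_cancel₀ this
          rw [mul_comm _ (k : ℂ), ← hk]
          simp; ring
        have hk3 : (n : ℝ) * α = k := by exact_mod_cast hk2
        exact (hα.intCast_mul hn).ne_int k hk3
      have hpos : 0 < ‖1 - z‖ := norm_pos_iff.2 (sub_ne_zero.2 hzne.symm)
      intro ε hε
      refine ⟨ε * ‖1 - z‖ / (2 + |C|), by positivity, fun ℓ h w hℓ hℓη hw => ?_⟩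
      rw [hI, mul_zero, sub_zero]
      simp_rw [hzpow]
      have h1 := norm_sum_slowWeight_mul_pow_le hw hz1
      have h2 : (2 + C) * ℓ ≤ (2 + |C|) * ℓ := by gcongr; exact le_abs_self C
      rw [lt_div_iff₀ (by positivity)] at hℓη
      nlinarith
  have hspan : ∀ G ∈ Submodule.span ℂ (Set.range (fourier (T := (1 : ℝ)))), P G := by
    intro G hG
    induction hG using Submodule.span_induction with
    | mem G hG => obtain ⟨n, rfl⟩ := hG; exact hfourier n
    | zero =>
      intro ε hε
      exact ⟨1, one_pos, fun ℓ h w _ _ _ => by simp [hε.le]⟩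
    | add F G _ _ hF hG =>
      intro ε hε
      obtain ⟨η₁, h₁, hF⟩ := hF (ε / 2) (by positivity)
      obtain ⟨η₂, h₂, hG⟩ := hG (ε / 2) (by positivity)
      refine ⟨min η₁ η₂, lt_min h₁ h₂, fun ℓ h w hℓ hη hw => ?_⟩
      have e1 := hF ℓ h w hℓ (hη.trans_le (min_le_left _ _)) hw
      have e2 := hG ℓ h w hℓ (hη.trans_le (min_le_right _ _)) hw
      have e3 := norm_add_le_of_le e1 e2
      refine le_trans (le_of_eq ?_) (e3.trans (by linarith))
      congr 1
      simp only [ContinuousMap.add_apply]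
      rw [integral_add (hint F) (hint G)]
      simp only [mul_add, Finset.sum_add_distrib]
      ring
    | smul c G _ hG =>
      intro ε hε
      obtain ⟨η, h₁, hG⟩ := hG (ε / (‖c‖ + 1)) (by positivity)
      refine ⟨η, h₁, fun ℓ h w hℓ hη hw => ?_⟩
      have e1 := hG ℓ h w hℓ hη hw
      have e2 : ‖c‖ * (ε / (‖c‖ + 1)) ≤ ε := by
        rw [mul_div_assoc', div_le_iff₀ (by positivity)]
        nlinarith [norm_nonneg c]
      refine le_trans (le_of_eq ?_) ((mul_le_mul_of_nonneg_left e1 (norm_nonneg c)).trans e2)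
      rw [← norm_mul]
      congr 1
      simp only [ContinuousMap.smul_apply, smul_eq_mul]
      rw [integral_const_mul, mul_sub, Finset.mul_sum]
      congr 1
      · exact Finset.sum_congr rfl fun i _ => by ring
      · ring
  intro ε hε
  have hG : G ∈ (Submodule.span ℂ (Set.range (fourier (T := (1 : ℝ))))).topologicalClosure := by
    rw [span_fourier_closure_eq_top]; trivial
  obtain ⟨F, hF, hFG⟩ := Metric.mem_closure_iff.1 hG (ε / 3) (by positivity)
  obtain ⟨η, hη, hFη⟩ := hspan F hF (ε / 3) (by positivity)
  refine ⟨η, hη, fun ℓ h w hℓ hlt hw => ?_⟩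
  have e1 := hFη ℓ h w hℓ hlt hw
  have hd : ∀ x, ‖(G - F) x‖ ≤ ε / 3 := fun x =>
    ((G - F).norm_coe_le_norm x).trans (by rw [← dist_eq_norm]; exact hFG.le)
  have hsumnorm : ∑ i ∈ Finset.range h, ‖(w i : ℂ)‖ ≤ 1 := by
    refine le_trans (le_of_eq (Finset.sum_congr rfl fun i _ => ?_)) hw.sum_le
    rw [Complex.norm_real, Real.norm_of_nonneg (hw.nonneg i)]
  have e2 : ‖∑ i ∈ Finset.range h, (w i : ℂ) * (G - F) (i • (α : AddCircle (1 : ℝ)))‖ ≤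
      ε / 3 := by
    refine (norm_sum_le _ _).trans ?_
    calc _ ≤ ∑ i ∈ Finset.range h, ‖(w i : ℂ)‖ * (ε / 3) :=
          Finset.sum_le_sum fun i _ => by
            rw [norm_mul]; exact mul_le_mul_of_nonneg_left (hd _) (norm_nonneg _)
      _ ≤ 1 * (ε / 3) := by rw [← Finset.sum_mul]; gcongr
      _ = ε / 3 := one_mul _
  have e3 : ‖(∑ i ∈ Finset.range h, (w i : ℂ)) * ∫ x, (G - F) x‖ ≤ ε / 3 := by
    rw [norm_mul]
    have h1 : ‖∫ x, (G - F) x‖ ≤ ε / 3 := by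
      have := norm_integral_le_of_norm_le_const (μ := (volume : Measure (AddCircle (1 : ℝ))))
        (.of_forall hd)
      simpa [measureReal_univ_addCircle_one] using this
    calc _ ≤ 1 * (ε / 3) := mul_le_mul ((norm_sum_le _ _).trans hsumnorm) h1 (norm_nonneg _)
          zero_le_one
      _ = ε / 3 := one_mul _
  have key : ∑ i ∈ Finset.range h, (w i : ℂ) * G (i • (α : AddCircle (1 : ℝ))) -
        (∑ i ∈ Finset.range h, (w i : ℂ)) * ∫ x, G x =
      (∑ i ∈ Finset.range h, (w i : ℂ) * F (i • (α : AddCircle (1 : ℝ))) -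
        (∑ i ∈ Finset.range h, (w i : ℂ)) * ∫ x, F x) +
      ∑ i ∈ Finset.range h, (w i : ℂ) * (G - F) (i • (α : AddCircle (1 : ℝ))) -
      (∑ i ∈ Finset.range h, (w i : ℂ)) * ∫ x, (G - F) x := by
    simp only [ContinuousMap.sub_apply]
    rw [integral_sub (hint G) (hint F)]
    simp only [mul_sub, Finset.sum_sub_distrib]
    ring
  rw [key]
  refine (norm_sub_le _ _).trans ?_
  have := norm_add_le_of_le e1 e2
  linarith

end WeightedEquidistribution

section Arc

/-- The arc `[0, ℓ)` of the circle. -/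
def arc (ℓ : ℝ) : Set (AddCircle (1 : ℝ)) := {y | (AddCircle.equivIco 1 0 y : ℝ) < ℓ}

lemma measurableSet_arc (ℓ : ℝ) : MeasurableSet (arc ℓ) :=
  measurableSet_lt (measurable_subtype_coe.comp (AddCircle.measurableEquivIco 1 0).measurable)
    measurable_const

lemma coe_mem_arc {ℓ x : ℝ} (hx : x ∈ Set.Ico (0 : ℝ) 1) :
    (x : AddCircle (1 : ℝ)) ∈ arc ℓ ↔ x < ℓ := by
  have hx' : x ∈ Set.Ico (0 : ℝ) (0 + 1) := by simpa using hx
  simp [arc, AddCircle.equivIco_coe_eq hx']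

lemma exists_coe_eq_of_mem_arc {ℓ : ℝ} {y : AddCircle (1 : ℝ)} (hy : y ∈ arc ℓ) :
    ∃ x ∈ Set.Ico (0 : ℝ) ℓ, (x : AddCircle (1 : ℝ)) = y :=
  ⟨AddCircle.equivIco 1 0 y, ⟨(AddCircle.equivIco 1 0 y).2.1, hy⟩, AddCircle.coe_equivIco⟩

lemma setIntegral_arc {E : Type*} [NormedAddCommGroup E] [NormedSpace ℝ E] {ℓ : ℝ} (h0 : 0 ≤ ℓ)
    (h1 : ℓ ≤ 1) (F : AddCircle (1 : ℝ) → E) :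
    ∫ y in arc ℓ, F y = ∫ x in (0 : ℝ)..ℓ, F x := by
  rw [← integral_indicator (measurableSet_arc ℓ), ← AddCircle.intervalIntegral_preimage 1 0,
    zero_add, intervalIntegral.integral_of_le zero_le_one, intervalIntegral.integral_of_le h0,
    integral_Ioc_eq_integral_Ioo, integral_Ioc_eq_integral_Ioo]
  have h2 : Set.Ioo (0 : ℝ) 1 ∩ Set.Ioo 0 ℓ = Set.Ioo 0 ℓ :=
    Set.inter_eq_right.2 (Set.Ioo_subset_Ioo_right h1)
  rw [← h2, ← setIntegral_indicator measurableSet_Ioo]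
  refine setIntegral_congr_fun measurableSet_Ioo fun x hx => ?_
  have hx' := coe_mem_arc (ℓ := ℓ) ⟨hx.1.le, hx.2⟩
  by_cases hxℓ : x < ℓ
  · rw [Set.indicator_of_mem (hx'.2 hxℓ), Set.indicator_of_mem (Set.mem_Ioo.2 ⟨hx.1, hxℓ⟩)]
  · rw [Set.indicator_of_notMem (fun h => hxℓ (hx'.1 h)),
      Set.indicator_of_notMem fun h => hxℓ h.2]

lemma measureReal_arc {ℓ : ℝ} (h0 : 0 ≤ ℓ) (h1 : ℓ ≤ 1) :
    (volume : Measure (AddCircle (1 : ℝ))).real (arc ℓ) = ℓ := by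
  have := setIntegral_arc h0 h1 (fun _ => (1 : ℝ))
  simpa using this

/-- Two points of the arc `[0, ℓ)` do not differ by a multiple `k α` at distance at least `ℓ` from
the integers. -/
lemma add_nsmul_notMem_arc {α ℓ : ℝ} {k : ℕ} (hk : ∀ p : ℤ, ℓ ≤ |k * α - p|)
    {y : AddCircle (1 : ℝ)} (hy : y ∈ arc ℓ) : y + k • (α : AddCircle (1 : ℝ)) ∉ arc ℓ := by
  intro hy2
  obtain ⟨s, hs, rfl⟩ := exists_coe_eq_of_mem_arc hy
  obtain ⟨t, ht, hst⟩ := exists_coe_eq_of_mem_arc hy2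
  have h0 : ((s + k * α - t : ℝ) : AddCircle (1 : ℝ)) = 0 := by
    have : ((k * α : ℝ) : AddCircle (1 : ℝ)) = k • (α : AddCircle (1 : ℝ)) := by
      rw [← nsmul_eq_mul]; rfl
    rw [AddCircle.coe_sub, AddCircle.coe_add, this, hst, sub_self]
  obtain ⟨p, hp⟩ := (AddCircle.coe_eq_zero_iff 1).1 h0
  have h1 := hk p
  have h2 : (k : ℝ) * α - p = t - s := by
    simp only [zsmul_eq_mul, mul_one] at hp
    linarith
  rw [h2] at h1
  have : |t - s| < ℓ := abs_sub_lt_of_nonneg_of_lt ht.1 ht.2 hs.1 hs.2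
  linarith

end Arc

section TowerCriterion

/-- A Rokhlin tower over the arc `[0, ℓ)`, together with weights `w` which bound from below the
correlations of the cocycle with the cocycle at the level `b`. -/
structure IsCocycleTower (α : ℝ) (ξ : AddCircle (1 : ℝ) → ℂ) (C r ℓ : ℝ) (h b : ℕ) (w : ℕ → ℝ) :
    Prop where
  pos : 0 < ℓ
  le_one : ℓ ≤ 1
  slow : IsSlowWeight C ℓ h w
  separated : ∀ k : ℕ, 0 < k → k < h → ∀ p : ℤ, ℓ ≤ |k * α - p|
  le_sum : r ≤ ∑ i ∈ Finset.range h, w i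
  overlap : ∀ i < h, ℓ * w i ≤
    ‖∫ x in (0 : ℝ)..ℓ, starRingEnd ℂ (cocycleProd α ξ b x) * cocycleProd α ξ i x‖ ^ 2

/-- The unit vector supported by the arc `[0, ℓ)` and proportional to the `b`-th cocycle. -/
noncomputable def towerBase (a : AddCircle (1 : ℝ)) (ξ : AddCircle (1 : ℝ) → ℂ) (ℓ : ℝ) (b : ℕ) :
    AddCircle (1 : ℝ) → ℂ :=
  (arc ℓ).indicator fun x => ((√ℓ)⁻¹ : ℝ) * cocycleProd a ξ b x

variable {α : ℝ} {ξ : AddCircle (1 : ℝ) → ℂ}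
  {V : Lp ℂ 2 (volume : Measure (AddCircle (1 : ℝ))) ≃ₗᵢ[ℂ]
    Lp ℂ 2 (volume : Measure (AddCircle (1 : ℝ)))}

lemma memLp_towerBase (hξ : ∀ x, ‖ξ x‖ = 1) (hm : AEStronglyMeasurable ξ volume)
    (a : AddCircle (1 : ℝ)) (ℓ : ℝ) (b : ℕ) : MemLp (towerBase a ξ ℓ b) 2 volume := by
  refine MemLp.of_bound (((aestronglyMeasurable_cocycleProd hm a b).const_mul _).indicator
    (measurableSet_arc ℓ)) ((√ℓ)⁻¹) (.of_forall fun x => ?_)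
  refine (norm_indicator_le_norm_self _ _).trans ?_
  rw [norm_mul, norm_cocycleProd hξ, mul_one, Complex.norm_real,
    Real.norm_of_nonneg (by positivity)]

lemma norm_toLp_towerBase (hξ : ∀ x, ‖ξ x‖ = 1) (hm : AEStronglyMeasurable ξ volume)
    (a : AddCircle (1 : ℝ)) {ℓ : ℝ} (h0 : 0 < ℓ) (h1 : ℓ ≤ 1) (b : ℕ) :
    ‖(memLp_towerBase hξ hm a ℓ b).toLp‖ = 1 := by
  have h2 : ‖(memLp_towerBase hξ hm a ℓ b).toLp‖ ^ 2 = 1 := by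
    rw [norm_sq_Lp_eq_integral]
    have : ∀ᵐ x, ‖((memLp_towerBase hξ hm a ℓ b).toLp : AddCircle (1 : ℝ) → ℂ) x‖ ^ 2 =
        (arc ℓ).indicator (fun _ => ℓ⁻¹) x := by
      filter_upwards [(memLp_towerBase hξ hm a ℓ b).coeFn_toLp] with x hx
      rw [hx, towerBase]
      by_cases hxa : x ∈ arc ℓ
      · rw [Set.indicator_of_mem hxa, Set.indicator_of_mem hxa, norm_mul, norm_cocycleProd hξ,
          mul_one, Complex.norm_real, norm_inv, inv_pow, Real.norm_eq_abs, sq_abs,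
          Real.sq_sqrt h0.le]
      · rw [Set.indicator_of_notMem hxa, Set.indicator_of_notMem hxa]; simp
    rw [integral_congr_ae this, integral_indicator (measurableSet_arc ℓ), setIntegral_const,
      measureReal_arc h0.le h1, smul_eq_mul, mul_inv_cancel₀ h0.ne']
  nlinarith [norm_nonneg (memLp_towerBase hξ hm a ℓ b).toLp]

lemma inner_pow_towerBase_eq_zero (hV : IsWeightedOperator α ξ V) (hξ : ∀ x, ‖ξ x‖ = 1)
    (hm : AEStronglyMeasurable ξ volume) {ℓ : ℝ} (b : ℕ) {k : ℕ}
    (hk : ∀ p : ℤ, ℓ ≤ |k * α - p|) :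
    inner ℂ ((V ^ k) (memLp_towerBase hξ hm α ℓ b).toLp) (memLp_towerBase hξ hm α ℓ b).toLp =
      0 := by
  rw [L2.inner_def]
  refine integral_eq_zero_of_ae ?_
  have h1 := (memLp_towerBase hξ hm α ℓ b).coeFn_toLp
  have h2 := (measurePreserving_add_right volume
    (k • (α : AddCircle (1 : ℝ)))).quasiMeasurePreserving.ae_eq_comp h1
  filter_upwards [h1, h2, hV.pow_apply k (memLp_towerBase hξ hm α ℓ b).toLp] with x hx1 hx2 hx3
  simp only [Function.comp_apply] at hx2
  rw [hx3, hx1, hx2]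
  by_cases hxa : x ∈ arc ℓ
  · rw [towerBase, Set.indicator_of_notMem (add_nsmul_notMem_arc hk hxa)]
    simp
  · rw [towerBase, Set.indicator_of_notMem hxa]
    simp

lemma norm_sq_sub_le_of_norm_sub_le {a b : ℂ} {B d : ℝ} (hb : ‖b‖ ≤ B) (hd : ‖a - b‖ ≤ d) :
    ‖b‖ ^ 2 - 2 * (B * d) ≤ ‖a‖ ^ 2 := by
  have h1 : ‖b‖ - d ≤ ‖a‖ := by
    have := norm_sub_norm_le b a
    rw [norm_sub_rev] at this
    linarith
  have hd0 : 0 ≤ d := (norm_nonneg _).trans hd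
  rcases le_or_gt d ‖b‖ with h | h
  · nlinarith [norm_nonneg a, norm_nonneg b]
  · nlinarith [norm_nonneg a, norm_nonneg b, sq_nonneg ‖a‖]

lemma norm_inner_towerBase_sq_ge (hV : IsWeightedOperator α ξ V) (hξ : ∀ x, ‖ξ x‖ = 1)
    (hm : AEStronglyMeasurable ξ volume) {ℓ : ℝ} (h0 : 0 < ℓ) (h1 : ℓ ≤ 1) (b i : ℕ)
    (F : C(AddCircle (1 : ℝ), ℂ)) {ω W : ℝ}
    (hω : ∀ x ∈ arc ℓ, ‖F (x + i • (α : AddCircle (1 : ℝ))) - F (i • (α : AddCircle (1 : ℝ)))‖ ≤ ω)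
    (hW : ℓ * W ≤
      ‖∫ x in (0 : ℝ)..ℓ, starRingEnd ℂ (cocycleProd α ξ b x) * cocycleProd α ξ i x‖ ^ 2) :
    W * ‖F (i • (α : AddCircle (1 : ℝ)))‖ ^ 2 - 2 * (‖F‖ * ω) * ℓ ≤
      ‖inner ℂ (memLp_towerBase hξ hm α ℓ b).toLp
        ((V ^ i) (ContinuousMap.toLp 2 volume ℂ F))‖ ^ 2 := by
  set y : AddCircle (1 : ℝ) := i • (α : AddCircle (1 : ℝ)) with hy
  set u : AddCircle (1 : ℝ) → ℂ :=
    fun x => starRingEnd ℂ (cocycleProd α ξ b x) * cocycleProd α ξ i x with hu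
  have hum : AEStronglyMeasurable u volume :=
    (continuous_star.comp_aestronglyMeasurable (aestronglyMeasurable_cocycleProd hm α b)).mul
      (aestronglyMeasurable_cocycleProd hm α i)
  have hu1 : ∀ x, ‖u x‖ = 1 := fun x => by
    simp [hu, norm_cocycleProd hξ]
  have hFc : Continuous fun x => F (x + y) := by fun_prop
  have hint1 : Integrable (fun x => u x * F (x + y)) (volume.restrict (arc ℓ)) := by
    refine Integrable.of_bound (hum.mul hFc.aestronglyMeasurable).restrict ‖F‖
      (.of_forall fun x => ?_)
    rw [norm_mul, hu1, one_mul]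
    exact F.norm_coe_le_norm _
  have hint2 : Integrable (fun x => u x * F y) (volume.restrict (arc ℓ)) := by
    refine Integrable.of_bound (hum.mul_const _).restrict ‖F‖ (.of_forall fun x => ?_)
    rw [norm_mul, hu1, one_mul]
    exact F.norm_coe_le_norm _
  have hin : inner ℂ (memLp_towerBase hξ hm α ℓ b).toLp
      ((V ^ i) (ContinuousMap.toLp 2 volume ℂ F)) =
      ((√ℓ)⁻¹ : ℝ) * ∫ x in arc ℓ, u x * F (x + y) := by
    rw [L2.inner_def, ← integral_const_mul, ← integral_indicator (measurableSet_arc ℓ)]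
    refine integral_congr_ae ?_
    have e1 := (memLp_towerBase hξ hm α ℓ b).coeFn_toLp
    have e2 := (measurePreserving_add_right volume y).quasiMeasurePreserving.ae_eq_comp
      (ContinuousMap.coeFn_toLp (p := 2) (𝕜 := ℂ) volume F)
    filter_upwards [e1, e2, hV.pow_apply i (ContinuousMap.toLp 2 volume ℂ F)] with x hx1 hx2 hx3
    simp only [Function.comp_apply] at hx2
    rw [hx3, hx1, hx2, towerBase]
    by_cases hxa : x ∈ arc ℓ
    · rw [Set.indicator_of_mem hxa, Set.indicator_of_mem hxa]
      simp only [hu, RCLike.inner_apply, map_mul, Complex.conj_ofReal]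
      ring
    · rw [Set.indicator_of_notMem hxa, Set.indicator_of_notMem hxa]
      simp
  have hs : 0 < √ℓ := Real.sqrt_pos.2 h0
  have hss : √ℓ * √ℓ = ℓ := Real.mul_self_sqrt h0.le
  have hsinv : ‖(((√ℓ)⁻¹ : ℝ) : ℂ)‖ = (√ℓ)⁻¹ := by
    rw [Complex.norm_real, Real.norm_of_nonneg (by positivity)]
  have hvol : volume (arc ℓ) < ⊤ := measure_lt_top _ _
  set B : ℂ := ((√ℓ)⁻¹ : ℝ) * (F y * ∫ x in arc ℓ, u x) with hB
  have hIle : ‖∫ x in arc ℓ, u x‖ ≤ ℓ := by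
    have := norm_setIntegral_le_of_norm_le_const (f := u) hvol fun x _ => (hu1 x).le
    rwa [measureReal_arc h0.le h1, one_mul] at this
  have hBle : ‖B‖ ≤ ‖F‖ * √ℓ := by
    rw [hB, norm_mul, hsinv, norm_mul, inv_mul_le_iff₀ hs]
    calc _ ≤ ‖F‖ * ℓ := mul_le_mul (F.norm_coe_le_norm _) hIle (norm_nonneg _) (norm_nonneg _)
      _ = _ := by linear_combination (-‖F‖) * hss
  have hBsub : ‖inner ℂ (memLp_towerBase hξ hm α ℓ b).toLp
      ((V ^ i) (ContinuousMap.toLp 2 volume ℂ F)) - B‖ ≤ √ℓ * ω := by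
    have : F y * ∫ x in arc ℓ, u x = ∫ x in arc ℓ, u x * F y := by
      rw [integral_mul_const, mul_comm]
    rw [hin, hB, this, ← mul_sub, norm_mul, hsinv, ← integral_sub hint1 hint2, inv_mul_le_iff₀ hs]
    have h2 := norm_setIntegral_le_of_norm_le_const (f := fun x => u x * F (x + y) - u x * F y)
      (C := ω) hvol fun x hx => by
        rw [← mul_sub, norm_mul, hu1, one_mul]; exact hω x hx
    rw [measureReal_arc h0.le h1] at h2
    refine h2.trans (le_of_eq ?_)
    linear_combination (-ω) * hss
  have hmain := norm_sq_sub_le_of_norm_sub_le hBle hBsub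
  have hBsq : W * ‖F y‖ ^ 2 ≤ ‖B‖ ^ 2 := by
    rw [hB, norm_mul, hsinv, norm_mul, mul_pow, mul_pow, inv_pow, Real.sq_sqrt h0.le,
      setIntegral_arc h0.le h1 u, ← mul_assoc, mul_comm ℓ⁻¹, mul_assoc, mul_comm W]
    refine mul_le_mul_of_nonneg_left ?_ (by positivity)
    rw [le_inv_mul_iff₀ h0]
    exact hW
  have : ‖F‖ * √ℓ * (√ℓ * ω) = ‖F‖ * ω * ℓ := by
    linear_combination (‖F‖ * ω) * hss
  rw [this] at hmain
  linarith

lemma exists_le_sum_norm_inner_towerBase (hα : Irrational α) (hV : IsWeightedOperator α ξ V)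
    (hξ : ∀ x, ‖ξ x‖ = 1) (hm : AEStronglyMeasurable ξ volume) (C r : ℝ)
    (F : C(AddCircle (1 : ℝ), ℂ)) {ε : ℝ} (hε : 0 < ε) :
    ∃ η > 0, ∀ (ℓ : ℝ) (h b : ℕ) (w : ℕ → ℝ), ℓ < η → IsCocycleTower α ξ C r ℓ h b w →
      r * ‖ContinuousMap.toLp 2 volume ℂ F‖ ^ 2 - ε ≤
      ∑ i ∈ Finset.range h, ‖inner ℂ (memLp_towerBase hξ hm α ℓ b).toLp
        ((V ^ i) (ContinuousMap.toLp 2 volume ℂ F))‖ ^ 2 := by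
  let G : C(AddCircle (1 : ℝ), ℂ) := ⟨fun x => ((‖F x‖ ^ 2 : ℝ) : ℂ), by fun_prop⟩
  obtain ⟨η₁, hη₁, hequi⟩ := slowWeight_equidistribution hα C G (ε / 2) (by positivity)
  set ω : ℝ := ε / (4 * (‖F‖ + 1)) with hω
  have hω0 : 0 < ω := by positivity
  have huc := CompactSpace.uniformContinuous_of_continuous F.continuous
  obtain ⟨η₂, hη₂, huc⟩ := Metric.uniformContinuous_iff.1 huc ω hω0
  refine ⟨min η₁ η₂, lt_min hη₁ hη₂, fun ℓ h b w hℓ hT => ?_⟩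
  have hFω : 2 * (‖F‖ * ω) ≤ ε / 2 := by
    rw [hω, ← mul_assoc, mul_div_assoc', div_le_iff₀ (by positivity)]
    nlinarith [norm_nonneg F]
  have hnorm : ‖ContinuousMap.toLp 2 volume ℂ F‖ ^ 2 = ∫ x, ‖F x‖ ^ 2 := by
    rw [norm_sq_Lp_eq_integral]
    refine integral_congr_ae ?_
    filter_upwards [ContinuousMap.coeFn_toLp (p := 2) (𝕜 := ℂ) volume F] with x hx
    rw [hx]
  have e1 := hequi ℓ h w hT.pos (hℓ.trans_le (min_le_left _ _)) hT.slow
  have hGint : ∫ x, G x = ((∫ x, ‖F x‖ ^ 2 : ℝ) : ℂ) := integral_complex_ofReal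
  have e2 : (∑ i ∈ Finset.range h, w i) * (∫ x, ‖F x‖ ^ 2) - ε / 2 ≤
      ∑ i ∈ Finset.range h, w i * ‖F (i • (α : AddCircle (1 : ℝ)))‖ ^ 2 := by
    rw [hGint] at e1
    have : (∑ i ∈ Finset.range h, (w i : ℂ) * G (i • (α : AddCircle (1 : ℝ))) -
        (∑ i ∈ Finset.range h, (w i : ℂ)) * ((∫ x, ‖F x‖ ^ 2 : ℝ) : ℂ)) =
        ((∑ i ∈ Finset.range h, w i * ‖F (i • (α : AddCircle (1 : ℝ)))‖ ^ 2 -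
          (∑ i ∈ Finset.range h, w i) * (∫ x, ‖F x‖ ^ 2) : ℝ) : ℂ) := by
      simp only [G, ContinuousMap.coe_mk]
      push_cast
      rfl
    rw [this, Complex.norm_real, Real.norm_eq_abs] at e1
    linarith [neg_le_of_abs_le e1]
  have hnn : 0 ≤ ∫ x, ‖F x‖ ^ 2 := integral_nonneg fun x => by positivity
  have e3 : r * (∫ x, ‖F x‖ ^ 2) ≤ (∑ i ∈ Finset.range h, w i) * (∫ x, ‖F x‖ ^ 2) :=
    mul_le_mul_of_nonneg_right hT.le_sum hnn
  have e4 : ∑ i ∈ Finset.range h, (w i * ‖F (i • (α : AddCircle (1 : ℝ)))‖ ^ 2 -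
      2 * (‖F‖ * ω) * ℓ) ≤ ∑ i ∈ Finset.range h, ‖inner ℂ (memLp_towerBase hξ hm α ℓ b).toLp
        ((V ^ i) (ContinuousMap.toLp 2 volume ℂ F))‖ ^ 2 := by
    refine Finset.sum_le_sum fun i hi => ?_
    refine norm_inner_towerBase_sq_ge hV hξ hm hT.pos hT.le_one b i F (fun x hx => ?_)
      (hT.overlap i (Finset.mem_range.1 hi))
    obtain ⟨s, hs, rfl⟩ := exists_coe_eq_of_mem_arc hx
    rw [← dist_eq_norm]
    refine (huc ?_).le
    rw [dist_eq_norm, add_sub_cancel_right]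
    calc ‖(s : AddCircle (1 : ℝ))‖ ≤ ‖s‖ := QuotientAddGroup.norm_mk_le_norm
      _ = s := Real.norm_of_nonneg hs.1
      _ < ℓ := hs.2
      _ < η₂ := hℓ.trans_le (min_le_right _ _)
  rw [Finset.sum_sub_distrib, Finset.sum_const, Finset.card_range, nsmul_eq_mul] at e4
  have e5 : (h : ℝ) * (2 * (‖F‖ * ω) * ℓ) ≤ ε / 2 := by
    have := hT.slow.length
    have h3 : 0 ≤ 2 * (‖F‖ * ω) := by positivity
    nlinarith
  rw [hnorm]
  linarith

/-- If a weighted operator over an irrational rotation has cocycle towers over arbitrarily short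
arcs, with weights of total mass at least `r > 1 / (m + 1)`, then its multiplicity is at most
`m`. -/
theorem spectralMultiplicityAtMost_of_cocycleTower (hα : Irrational α)
    (hV : IsWeightedOperator α ξ V) (hξ : ∀ x, ‖ξ x‖ = 1) {m : ℕ} {C r : ℝ}
    (hr : 1 < (m + 1) * r)
    (htower : ∀ η > 0, ∃ (ℓ : ℝ) (h b : ℕ) (w : ℕ → ℝ), ℓ < η ∧ IsCocycleTower α ξ C r ℓ h b w) :
    SpectralMultiplicityAtMost V m := by
  have hm := hV.aestronglyMeasurable
  have hdense : DenseRange (ContinuousMap.toLp (E := ℂ) 2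
      (volume : Measure (AddCircle (1 : ℝ))) ℂ) :=
    ContinuousMap.toLp_denseRange ℂ volume ℂ (by simp)
  have : TopologicalSpace.SeparableSpace (Lp ℂ 2 (volume : Measure (AddCircle (1 : ℝ)))) :=
    hdense.separableSpace (ContinuousMap.toLp 2 volume ℂ).continuous
  refine spectralMultiplicityAtMost_of_approx V hr hdense fun S hS ε hε => ?_
  have hη : ∃ η > 0, ∀ f ∈ S, ∀ (ℓ : ℝ) (h b : ℕ) (w : ℕ → ℝ), ℓ < η →
      IsCocycleTower α ξ C r ℓ h b w → r * ‖f‖ ^ 2 - ε ≤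
      ∑ i ∈ Finset.range h, ‖inner ℂ (memLp_towerBase hξ hm α ℓ b).toLp ((V ^ i) f)‖ ^ 2 := by
    classical
    clear htower
    induction S using Finset.induction_on with
    | empty => exact ⟨1, one_pos, by simp⟩
    | insert f S _ ih =>
      rw [Finset.coe_insert, Set.insert_subset_iff] at hS
      obtain ⟨η₁, h₁, ih⟩ := ih hS.2
      obtain ⟨F, rfl⟩ := hS.1
      obtain ⟨η₂, h₂, hF⟩ := exists_le_sum_norm_inner_towerBase hα hV hξ hm C r F hε
      refine ⟨min η₁ η₂, lt_min h₁ h₂, fun f hf ℓ h b w hℓ hT => ?_⟩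
      rcases Finset.mem_insert.1 hf with rfl | hf
      · exact hF ℓ h b w (hℓ.trans_le (min_le_right _ _)) hT
      · exact ih f hf ℓ h b w (hℓ.trans_le (min_le_left _ _)) hT
  obtain ⟨η, hη0, hη⟩ := hη
  obtain ⟨ℓ, h, b, w, hℓ, hT⟩ := htower η hη0
  exact ⟨(memLp_towerBase hξ hm α ℓ b).toLp, h,
    norm_toLp_towerBase hξ hm α hT.pos hT.le_one b,
    fun k hk hkh => inner_pow_towerBase_eq_zero hV hξ hm b (hT.separated k hk hkh),
    fun f hf => hη f hf ℓ h b w hℓ hT⟩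

end TowerCriterion

section RotationTower

/-- A pair of consecutive one-sided approximations `p / q < α < p' / q'` spanning the lattice
`ℤ²`, where the left one is the coarser. -/
structure IsApproxPair (α : ℝ) (q q' : ℕ) (p p' : ℤ) : Prop where
  det : q * p' - q' * p = 1
  pos : 0 < p' - q' * α
  lt : p' - q' * α < q * α - p
  le : q ≤ q'
  one_le : 1 ≤ q'

lemma le_abs_mul_sub_of_det {α : ℝ} {q q' : ℕ} {p p' : ℤ} (hdet : q * p' - q' * p = 1)
    (h : 0 < q * α - p) (h' : 0 < p' - q' * α) {i : ℕ} (hi : 0 < i) (hiq : i < q') (P : ℤ) :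
    q * α - p ≤ |i * α - P| := by
  obtain ⟨a, ha⟩ : ∃ a : ℤ, a = i * p' - P * q' := ⟨_, rfl⟩
  obtain ⟨b, hb⟩ : ∃ b : ℤ, b = q * P - p * i := ⟨_, rfl⟩
  have hi1 : (i : ℤ) = a * q + b * q' := by
    rw [ha, hb]; linear_combination (-(i : ℤ)) * hdet
  have hP1 : P = a * p + b * p' := by
    rw [ha, hb]; linear_combination (-P) * hdet
  have hdetR : (q : ℝ) * p' - q' * p = 1 := by exact_mod_cast hdet
  have hval : (i : ℝ) * α - P = a * (q * α - p) - b * (p' - q' * α) := by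
    have h1 : (i : ℝ) = a * q + b * q' := by exact_mod_cast hi1
    have h2 : (P : ℝ) = a * p + b * p' := by exact_mod_cast hP1
    rw [h1, h2]; ring
  have hiZ : (0 : ℤ) < i := by exact_mod_cast hi
  have hiqZ : (i : ℤ) < q' := by exact_mod_cast hiq
  have hq0 : (0 : ℤ) ≤ q := by positivity
  have hq0' : (0 : ℤ) < q' := hiZ.trans hiqZ
  rw [hval]
  rcases le_or_gt b 0 with hb0 | hb0
  · have ha1 : 1 ≤ a := by
      by_contra hcon
      have : a ≤ 0 := by omega
      nlinarith [mul_nonneg (neg_nonneg.2 this) hq0, mul_nonneg (neg_nonneg.2 hb0) hq0'.le]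
    have ha1R : (1 : ℝ) ≤ a := by exact_mod_cast ha1
    have hb0R : (b : ℝ) ≤ 0 := by exact_mod_cast hb0
    refine le_trans ?_ (le_abs_self _)
    nlinarith
  · have ha1 : a ≤ -1 := by
      by_contra hcon
      have : 0 ≤ a := by omega
      nlinarith [mul_nonneg this hq0]
    have ha1R : (a : ℝ) ≤ -1 := by exact_mod_cast ha1
    have hb0R : (0 : ℝ) < b := by exact_mod_cast hb0
    refine le_trans ?_ (neg_le_abs _)
    nlinarith

lemma exists_isApproxPair (N : ℕ) : ∀ {α : ℝ}, Irrational α →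
    ∃ q q' p p', IsApproxPair α q q' p p' ∧ N ≤ q + q' := by
  induction N with
  | zero =>
    intro α hα
    refine ⟨0, 1, -1, ⌈α⌉, ⟨by simp, ?_, ?_, zero_le_one, le_rfl⟩, by simp⟩
    · have h1 := Int.le_ceil α
      have h2 : α ≠ ⌈α⌉ := hα.ne_int _
      have := lt_of_le_of_ne h1 h2
      push_cast
      linarith
    · have := Int.ceil_lt_add_one α
      push_cast
      linarith
  | succ N ih =>
    intro α hα
    obtain ⟨q, q', p, p', hs, hN⟩ := ih hα.neg
    set e : ℝ := q * -α - p with he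
    set e' : ℝ := p' - q' * -α with he'
    have h0 : 0 < e' := hs.pos
    have h1 : e' < e := hs.lt
    set a : ℕ := ⌊e / e'⌋₊ with ha
    have ha1 : 1 ≤ a := Nat.le_floor (by rw [Nat.cast_one, one_le_div h0]; exact h1.le)
    have hale : a * e' ≤ e := by
      rw [← le_div_iff₀ h0]; exact Nat.floor_le (div_nonneg (h0.le.trans h1.le) h0.le)
    have halt : e < (a + 1) * e' := by
      rw [← div_lt_iff₀ h0]; exact Nat.lt_floor_add_one _
    have hq' := hs.one_le
    have hle : q' ≤ a * q' := by nlinarith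
    refine ⟨q', q + a * q', -p', -(p + a * p'), ⟨?_, ?_, ?_, by omega, by omega⟩, by omega⟩
    · have := hs.det
      push_cast
      linear_combination this
    · have hne : ((q + a * q' : ℕ) : ℝ) * α ≠ (-(p + a * p') : ℤ) :=
        (hα.natCast_mul (by omega)).ne_int _
      have hval : ((-(p + a * p') : ℤ) : ℝ) - ((q + a * q' : ℕ) : ℝ) * α = e - a * e' := by
        rw [he, he']; push_cast; ring
      have : ((-(p + a * p') : ℤ) : ℝ) - ((q + a * q' : ℕ) : ℝ) * α ≠ 0 :=
        sub_ne_zero.2 hne.symm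
      rw [hval] at this ⊢
      exact lt_of_le_of_ne (by linarith) this.symm
    · have : ((-(p + a * p') : ℤ) : ℝ) - ((q + a * q' : ℕ) : ℝ) * α = e - a * e' := by
        rw [he, he']; push_cast; ring
      rw [this]
      have h2 : (q' : ℝ) * α - ((-p' : ℤ) : ℝ) = e' := by rw [he']; push_cast; ring
      rw [h2]
      linarith

lemma exists_rotation_tower {α : ℝ} (hα : Irrational α) {η : ℝ} (hη : 0 < η) :
    ∃ (ℓ : ℝ) (h : ℕ), 0 < ℓ ∧ ℓ < η ∧ 3 / 5 ≤ h * ℓ ∧ h * ℓ ≤ 1 ∧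
      ∀ k : ℕ, 0 < k → k < h → ∀ p : ℤ, ℓ ≤ |k * α - p| := by
  obtain ⟨N, hN⟩ := exists_nat_gt (2 / η)
  obtain ⟨q, q', p, p', hs, hNq⟩ := exists_isApproxPair (N + 1) hα
  set e : ℝ := q * α - p with he
  set e' : ℝ := p' - q' * α with he'
  have h0 : 0 < e' := hs.pos
  have h1 : e' < e := hs.lt
  have hid : q * e' + q' * e = 1 := by
    have : (q : ℝ) * p' - q' * p = 1 := by exact_mod_cast hs.det
    rw [he, he']; linear_combination this
  have hqq : (q : ℝ) ≤ q' := by exact_mod_cast hs.le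
  have hq'1 : (1 : ℝ) ≤ q' := by exact_mod_cast hs.one_le
  have hq0 : (0 : ℝ) ≤ q := by positivity
  have hsmall : ∀ {h : ℕ} {ℓ : ℝ}, 0 < ℓ → q' ≤ h → h * ℓ ≤ 1 → ℓ < η := by
    intro h ℓ hℓ hh hhℓ
    have h2 : (N : ℝ) < 2 * h := by
      have : N < 2 * h := by have := hs.le; omega
      exact_mod_cast this
    rw [div_lt_iff₀ hη] at hN
    by_contra hcon
    have : η ≤ ℓ := not_lt.1 hcon
    have hhpos : (0 : ℝ) ≤ h := by positivity
    nlinarith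
  rcases le_or_gt (3 / 5) (q' * e) with hc | hc
  · have h2 : q' * e ≤ 1 := by nlinarith
    exact ⟨e, q', h0.trans h1, hsmall (h0.trans h1) le_rfl h2, hc, h2,
      fun k hk hkq P => le_abs_mul_sub_of_det hs.det (h0.trans h1) h0 hk hkq P⟩
  · have h2 : ((q + q' : ℕ) : ℝ) * e' ≤ 1 := by push_cast; nlinarith
    refine ⟨e', q + q', h0, hsmall h0 (by omega) h2, by push_cast; nlinarith, h2,
      fun k hk hkq P => ?_⟩
    have hdet : (q' : ℤ) * (-(p + p')) - ((q + q' : ℕ) : ℤ) * (-p') = 1 := by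
      have := hs.det; push_cast; linear_combination this
    have h3 := le_abs_mul_sub_of_det (α := -α) hdet (by push_cast; linarith)
      (by push_cast; linarith) hk hkq (-P)
    have e1 : (k : ℝ) * -α - ((-P : ℤ) : ℝ) = -(k * α - P) := by push_cast; ring
    have e2 : (q' : ℝ) * -α - ((-p' : ℤ) : ℝ) = e' := by rw [he']; push_cast; ring
    rwa [e1, abs_neg, e2] at h3

/-- Rokhlin towers for irrational rotations: short arcs `[0, ℓ)` with `h` disjoint translates which
fill up a prescribed proportion `τ ≤ 3 / 5` of the circle. -/
theorem exists_rotation_tower_of_le {α : ℝ} (hα : Irrational α) {τ : ℝ} (hτ0 : 0 < τ)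
    (hτ : τ ≤ 3 / 5) {η : ℝ} (hη : 0 < η) :
    ∃ (ℓ : ℝ) (h : ℕ), 0 < ℓ ∧ ℓ < η ∧ τ ≤ h * ℓ ∧ h * ℓ ≤ τ + ℓ ∧ h * ℓ ≤ 1 ∧
      ∀ k : ℕ, 0 < k → k < h → ∀ p : ℤ, ℓ ≤ |k * α - p| := by
  obtain ⟨ℓ, h, hℓ, hℓη, hh, hh1, hsep⟩ := exists_rotation_tower hα hη
  have hle : ⌈τ / ℓ⌉₊ ≤ h := Nat.ceil_le.2 ((div_le_iff₀ hℓ).2 (hτ.trans hh))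
  refine ⟨ℓ, ⌈τ / ℓ⌉₊, hℓ, hℓη, ?_, ?_, le_trans ?_ hh1,
    fun k hk hkh => hsep k hk (hkh.trans_le hle)⟩
  · rw [← div_le_iff₀ hℓ]; exact Nat.le_ceil _
  · have := Nat.ceil_lt_add_one (div_pos hτ0 hℓ).le
    have h2 : (⌈τ / ℓ⌉₊ : ℝ) * ℓ ≤ (τ / ℓ + 1) * ℓ := by gcongr
    rwa [add_mul, div_mul_cancel₀ _ hℓ.ne', one_mul] at h2
  · gcongr

end RotationTower

section Levels

variable {α ℓ : ℝ} {h : ℕ}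

lemma add_fract_coe_addCircle (x : ℝ) (j : ℕ) :
    (x : AddCircle (1 : ℝ)) + j • (α : AddCircle (1 : ℝ)) =
      ((x + Int.fract (j * α) : ℝ) : AddCircle (1 : ℝ)) := by
  have h1 : ((j * α : ℝ) : AddCircle (1 : ℝ)) = j • (α : AddCircle (1 : ℝ)) := by
    rw [← nsmul_eq_mul]; rfl
  have h2 : ((Int.fract (j * α) : ℝ) : AddCircle (1 : ℝ)) = ((j * α : ℝ) : AddCircle (1 : ℝ)) := by
    rw [Int.fract, AddCircle.coe_sub, sub_eq_self, AddCircle.coe_eq_zero_iff]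
    exact ⟨⌊(j : ℝ) * α⌋, by simp⟩
  rw [AddCircle.coe_add, h2, h1]

lemma cocycleProd_coe_eq_prod_fract (ξ : AddCircle (1 : ℝ) → ℂ) (i : ℕ) (x : ℝ) :
    cocycleProd α ξ i x =
      ∏ j ∈ Finset.range i, ξ ((x + Int.fract (j * α) : ℝ) : AddCircle (1 : ℝ)) := by
  simp only [cocycleProd, add_fract_coe_addCircle]

lemma fract_add_le_one (hℓ : ℓ ≤ 1) (hsep : ∀ k : ℕ, 0 < k → k < h → ∀ p : ℤ, ℓ ≤ |k * α - p|)
    {j : ℕ} (hj : j < h) : Int.fract (j * α) + ℓ ≤ 1 := by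
  rcases Nat.eq_zero_or_pos j with rfl | hj0
  · simpa using hℓ
  · have h1 := hsep j hj0 hj (⌊(j : ℝ) * α⌋ + 1)
    have h2 : (j : ℝ) * α - ((⌊(j : ℝ) * α⌋ + 1 : ℤ) : ℝ) = Int.fract (j * α) - 1 := by
      rw [Int.fract]; push_cast; ring
    rw [h2, abs_of_nonpos (by linarith [Int.fract_lt_one ((j : ℝ) * α)])] at h1
    linarith

lemma le_abs_fract_sub_fract
    (hsep : ∀ k : ℕ, 0 < k → k < h → ∀ p : ℤ, ℓ ≤ |k * α - p|) {j k : ℕ} (hj : j < h) (hk : k < h)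
    (hjk : j ≠ k) : ℓ ≤ |Int.fract (j * α) - Int.fract (k * α)| := by
  wlog hlt : k < j generalizing j k
  · rw [abs_sub_comm]
    exact this hk hj hjk.symm (by omega)
  have h1 := hsep (j - k) (by omega) (by omega) (⌊(j : ℝ) * α⌋ - ⌊(k : ℝ) * α⌋)
  have h2 : ((j - k : ℕ) : ℝ) * α - ((⌊(j : ℝ) * α⌋ - ⌊(k : ℝ) * α⌋ : ℤ) : ℝ) =
      Int.fract (j * α) - Int.fract (k * α) := by
    rw [Nat.cast_sub hlt.le, Int.fract, Int.fract]; push_cast; ring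
  rwa [h2] at h1

/-- The increments of a monotone function along separated intervals of equal length add up to at
most its total increment. -/
lemma sum_sub_le_of_separated {ι : Type*} {M : ℝ → ℝ} (hM : MonotoneOn M (Set.Icc 0 1))
    {t : ι → ℝ} (hℓ : 0 ≤ ℓ) (s : Finset ι) (ht : ∀ j ∈ s, 0 ≤ t j)
    (hsep : ∀ j ∈ s, ∀ k ∈ s, j ≠ k → ℓ ≤ |t j - t k|) {b : ℝ} (hb0 : 0 ≤ b) (hb : b ≤ 1)
    (htb : ∀ j ∈ s, t j + ℓ ≤ b) : ∑ j ∈ s, (M (t j + ℓ) - M (t j)) ≤ M b - M 0 := by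
  classical
  induction s using Finset.induction_on_max_value t generalizing b with
  | empty =>
    have := hM (Set.left_mem_Icc.2 zero_le_one) ⟨hb0, hb⟩ hb0
    simpa using this
  | insert a s has hmax ih =>
    have hta := ht a (Finset.mem_insert_self _ _)
    have htab := htb a (Finset.mem_insert_self _ _)
    have hle : ∀ j ∈ s, t j + ℓ ≤ t a := fun j hj => by
      have h1 := hsep a (Finset.mem_insert_self _ _) j (Finset.mem_insert_of_mem hj)
        (fun h => has (h ▸ hj))
      rw [abs_of_nonneg (sub_nonneg.2 (hmax j hj))] at h1
      linarith
    have h2 := ih (fun j hj => ht j (Finset.mem_insert_of_mem hj))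
      (fun j hj k hk => hsep j (Finset.mem_insert_of_mem hj) k (Finset.mem_insert_of_mem hk))
      hta (by linarith) hle
    rw [Finset.sum_insert has]
    have h3 := hM (a := t a + ℓ) ⟨by linarith, by linarith⟩ ⟨hb0, hb⟩ htab
    linarith

end Levels

section AbsolutelyContinuous

lemma exists_continuousMap_addCircle_integral_sub_le {g : ℝ → ℝ}
    (hg : IntervalIntegrable g volume 0 1) {ε : ℝ} (hε : 0 < ε) :
    ∃ P : C(AddCircle (1 : ℝ), ℂ), ∫ t in (0 : ℝ)..1, ‖(g t : ℂ) - P t‖ ≤ ε := by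
  have h1 : MemLp (fun t => (g t : ℂ)) 1 (volume.restrict (Set.Ioc (0 : ℝ) (0 + 1))) := by
    rw [memLp_one_iff_integrable, zero_add]
    exact ((intervalIntegrable_iff_integrableOn_Ioc_of_le zero_le_one).1 hg).ofReal
  have h2 := memLp_one_iff_integrable.1 h1.memLp_liftIoc
  obtain ⟨P, hP, -⟩ := h2.exists_boundedContinuous_integral_sub_le hε
  refine ⟨P.toContinuousMap, le_trans (le_of_eq ?_) hP⟩
  rw [← AddCircle.intervalIntegral_preimage 1 0, zero_add]
  refine intervalIntegral.integral_congr_ae (.of_forall fun t ht => ?_)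
  rw [Set.uIoc_of_le zero_le_one] at ht
  rw [AddCircle.liftIoc_coe_apply (by simpa using ht)]
  rfl

/-- Birkhoff sums of an absolutely continuous function of degree zero are almost constant on the
base of a tower. -/
lemma exists_abs_sum_sub_le_of_tower {α : ℝ} (hα : Irrational α) {φ g : ℝ → ℝ}
    (hdeg : ∀ x : ℝ, φ (x + 1) = φ x) (hgint : ∀ a b : ℝ, IntervalIntegrable g volume a b)
    (hac : ∀ x : ℝ, φ x = φ 0 + ∫ t in (0 : ℝ)..x, g t) {δ : ℝ} (hδ : 0 < δ) :
    ∃ η > 0, ∀ (ℓ : ℝ) (h : ℕ), 0 < ℓ → ℓ < η → ℓ ≤ 1 → h * ℓ ≤ 1 →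
      (∀ k : ℕ, 0 < k → k < h → ∀ p : ℤ, ℓ ≤ |k * α - p|) → ∀ i ≤ h, ∀ x ∈ Set.Icc 0 ℓ,
      |∑ j ∈ Finset.range i, (φ (x + Int.fract (j * α)) - φ (Int.fract (j * α)))| ≤ δ := by
  obtain ⟨P, hP⟩ := exists_continuousMap_addCircle_integral_sub_le (hgint 0 1)
    (ε := δ / 4) (by positivity)
  have hPc : Continuous fun t : ℝ => P t := P.continuous.comp (AddCircle.continuous_mk' 1)
  have hPi : ∀ a b : ℝ, IntervalIntegrable (fun t : ℝ => P t) volume a b :=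
    fun a b => hPc.intervalIntegrable a b
  have hgi : ∀ a b : ℝ, IntervalIntegrable (fun t : ℝ => (g t : ℂ)) volume a b :=
    fun a b => ⟨(hgint a b).1.ofReal, (hgint a b).2.ofReal⟩
  have hsub : ∀ a b : ℝ, IntervalIntegrable (fun t : ℝ => (g t : ℂ) - P t) volume a b :=
    fun a b => (hgi a b).sub (hPi a b)
  have hmean : ‖∫ x, P x‖ ≤ δ / 4 := by
    have h1 : ∫ t in (0 : ℝ)..1, (g t : ℂ) = 0 := by
      rw [intervalIntegral.integral_ofReal]
      have h2 := hac 1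
      have h3 := hdeg 0
      rw [zero_add] at h3
      have : ∫ t in (0 : ℝ)..1, g t = 0 := by linarith
      rw [this, Complex.ofReal_zero]
    have h2 : ∫ x, P x = -∫ t in (0 : ℝ)..1, ((g t : ℂ) - P t) := by
      rw [intervalIntegral.integral_sub (hgi 0 1) (hPi 0 1), h1,
        ← AddCircle.intervalIntegral_preimage 1 0, zero_add]
      ring
    rw [h2, norm_neg]
    exact (intervalIntegral.norm_integral_le_integral_norm zero_le_one).trans hP
  set M : ℝ → ℝ := fun y => ∫ t in (0 : ℝ)..y, ‖(g t : ℂ) - P t‖ with hM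
  have hMsub : ∀ a b, M b - M a = ∫ t in a..b, ‖(g t : ℂ) - P t‖ := fun a b =>
    intervalIntegral.integral_interval_sub_left (hsub 0 b).norm (hsub 0 a).norm
  have hMmono : Monotone M := fun a b hab => by
    have : 0 ≤ M b - M a := by
      rw [hMsub]; exact intervalIntegral.integral_nonneg hab fun _ _ => norm_nonneg _
    linarith
  obtain ⟨η₁, hη₁, hequi⟩ := slowWeight_equidistribution hα 0 P (δ / 4) (by positivity)
  have huc := CompactSpace.uniformContinuous_of_continuous P.continuous
  obtain ⟨η₂, hη₂, huc⟩ := Metric.uniformContinuous_iff.1 huc (δ / 4) (by positivity)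
  refine ⟨min η₁ η₂, lt_min hη₁ hη₂, fun ℓ h hℓ hlt hℓ1 hhℓ hsep i hi x hx => ?_⟩
  set t : ℕ → ℝ := fun j => Int.fract (j * α) with ht
  have hiℓ : i * ℓ ≤ 1 := by
    refine le_trans ?_ hhℓ
    gcongr
  have hφ : ∀ j, ((φ (x + t j) - φ (t j) : ℝ) : ℂ) =
      (∫ s in (t j)..(x + t j), ((g s : ℂ) - P s)) + ∫ s in (t j)..(x + t j), P s := fun j => by
    rw [intervalIntegral.integral_sub (hgi _ _) (hPi _ _), sub_add_cancel,
      intervalIntegral.integral_ofReal, hac (x + t j), hac (t j),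
      ← intervalIntegral.integral_interval_sub_left (hgint 0 (x + t j)) (hgint 0 (t j))]
    push_cast
    ring
  have e1 : ‖∑ j ∈ Finset.range i, ∫ s in (t j)..(x + t j), ((g s : ℂ) - P s)‖ ≤ δ / 4 := by
    refine (norm_sum_le _ _).trans ?_
    calc ∑ j ∈ Finset.range i, ‖∫ s in (t j)..(x + t j), ((g s : ℂ) - P s)‖
        ≤ ∑ j ∈ Finset.range i, (M (t j + ℓ) - M (t j)) := by
          refine Finset.sum_le_sum fun j _ => ?_
          refine (intervalIntegral.norm_integral_le_integral_norm (by linarith [hx.1])).trans ?_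
          rw [← hMsub]
          have := hMmono (show x + t j ≤ t j + ℓ by linarith [hx.2])
          linarith
      _ ≤ M 1 - M 0 := by
          refine sum_sub_le_of_separated (hMmono.monotoneOn _) hℓ.le _
            (fun j _ => Int.fract_nonneg _) (fun j hj k hk hjk => ?_) zero_le_one le_rfl
            fun j hj => ?_
          · exact le_abs_fract_sub_fract hsep ((Finset.mem_range.1 hj).trans_le hi)
              ((Finset.mem_range.1 hk).trans_le hi) hjk
          · exact fract_add_le_one hℓ1 hsep ((Finset.mem_range.1 hj).trans_le hi)
      _ ≤ δ / 4 := by rw [hMsub]; exact hP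
  have htj : ∀ j : ℕ, ((t j : ℝ) : AddCircle (1 : ℝ)) = j • (α : AddCircle (1 : ℝ)) := fun j => by
    have := add_fract_coe_addCircle (α := α) 0 j
    rw [AddCircle.coe_zero, zero_add, zero_add] at this
    exact this.symm
  have e2 : ‖∑ j ∈ Finset.range i, ((∫ s in (t j)..(x + t j), P s) - x * P (t j))‖ ≤ δ / 4 := by
    refine (norm_sum_le _ _).trans ?_
    calc ∑ j ∈ Finset.range i, ‖(∫ s in (t j)..(x + t j), P s) - x * P (t j)‖
        ≤ ∑ j ∈ Finset.range i, δ / 4 * ℓ := by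
          refine Finset.sum_le_sum fun j _ => ?_
          have h1 : (∫ s in (t j)..(x + t j), P s) - x * P (t j) =
              ∫ s in (t j)..(x + t j), (P s - P (t j)) := by
            rw [intervalIntegral.integral_sub (hPi _ _) (by simp), intervalIntegral.integral_const]
            simp
          rw [h1]
          refine (intervalIntegral.norm_integral_le_of_norm_le_const (C := δ / 4)
            fun s hs => ?_).trans ?_
          · rw [Set.uIoc_of_le (by linarith [hx.1])] at hs
            rw [← dist_eq_norm]
            refine (huc ?_).le
            rw [dist_eq_norm, ← AddCircle.coe_sub]
            calc ‖((s - t j : ℝ) : AddCircle (1 : ℝ))‖ ≤ ‖s - t j‖ :=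
                  QuotientAddGroup.norm_mk_le_norm
              _ = s - t j := Real.norm_of_nonneg (by linarith [hs.1])
              _ ≤ ℓ := by linarith [hs.2, hx.2]
              _ < η₂ := hlt.trans_le (min_le_right _ _)
          · rw [add_sub_cancel_right, abs_of_nonneg hx.1]
            gcongr
            exact hx.2
      _ = i * ℓ * (δ / 4) := by simp; ring
      _ ≤ δ / 4 := by nlinarith
  have e3 : ‖∑ j ∈ Finset.range i, (x : ℂ) * P (t j)‖ ≤ δ / 2 := by
    have hslow : IsSlowWeight 0 ℓ i fun _ => ℓ :=
      ⟨fun _ => hℓ.le, fun _ => le_rfl, hiℓ, by simp⟩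
    have h1 := hequi ℓ i _ hℓ (hlt.trans_le (min_le_left _ _)) hslow
    simp only [← htj] at h1
    rw [← Finset.mul_sum] at h1 ⊢
    rw [norm_mul, Complex.norm_real, Real.norm_of_nonneg hx.1]
    have h2 : ‖(∑ j ∈ Finset.range i, (ℓ : ℂ)) * ∫ x, P x‖ ≤ δ / 4 := by
      rw [Finset.sum_const, Finset.card_range, nsmul_eq_mul, norm_mul, norm_mul, Complex.norm_real,
        Real.norm_of_nonneg hℓ.le, Complex.norm_natCast]
      nlinarith [norm_nonneg (∫ x, P x), mul_nonneg (Nat.cast_nonneg (α := ℝ) i) hℓ.le]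
    calc x * ‖∑ j ∈ Finset.range i, P (t j)‖ ≤ ℓ * ‖∑ j ∈ Finset.range i, P (t j)‖ := by
          gcongr; exact hx.2
      _ = ‖(ℓ : ℂ) * ∑ j ∈ Finset.range i, P (t j)‖ := by
          rw [norm_mul, Complex.norm_real, Real.norm_of_nonneg hℓ.le]
      _ ≤ δ / 4 + δ / 4 := by
          have := norm_add_le_of_le h1 h2
          rwa [sub_add_cancel] at this
      _ = δ / 2 := by ring
  have e4 : ((∑ j ∈ Finset.range i, (φ (x + t j) - φ (t j)) : ℝ) : ℂ) =
      (∑ j ∈ Finset.range i, ∫ s in (t j)..(x + t j), ((g s : ℂ) - P s)) +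
      (∑ j ∈ Finset.range i, ((∫ s in (t j)..(x + t j), P s) - x * P (t j))) +
      ∑ j ∈ Finset.range i, (x : ℂ) * P (t j) := by
    rw [Complex.ofReal_sum, ← Finset.sum_add_distrib, ← Finset.sum_add_distrib]
    refine Finset.sum_congr rfl fun j _ => ?_
    rw [hφ]; ring
  rw [← Real.norm_eq_abs, ← Complex.norm_real, e4]
  refine (norm_add_le_of_le (norm_add_le_of_le e1 e2) e3).trans (le_of_eq (by ring))

theorem spectralMultiplicityAtMost_one_of_absolutelyContinuous {α : ℝ} (hα : Irrational α)
    {φ g : ℝ → ℝ} {ξ : AddCircle (1 : ℝ) → ℂ}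
    (hdeg : ∀ x : ℝ, φ (x + 1) = φ x) (hgint : ∀ a b : ℝ, IntervalIntegrable g volume a b)
    (hac : ∀ x : ℝ, φ x = φ 0 + ∫ t in (0 : ℝ)..x, g t)
    (hξ : ∀ x : ℝ, ξ (x : AddCircle (1 : ℝ)) = Complex.exp (2 * π * Complex.I * φ x))
    {V : Lp ℂ 2 (volume : Measure (AddCircle (1 : ℝ))) ≃ₗᵢ[ℂ]
      Lp ℂ 2 (volume : Measure (AddCircle (1 : ℝ)))}
    (hV : IsWeightedOperator α ξ V) : SpectralMultiplicityAtMost V 1 := by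
  have hexp : ∀ y : ℝ, Complex.exp (2 * π * Complex.I * y) =
      Complex.exp (Complex.I * (2 * π * y : ℝ)) := fun y => by
    congr 1; push_cast; ring
  have hnorm : ∀ x, ‖ξ x‖ = 1 := fun x => by
    obtain ⟨y, rfl⟩ := QuotientAddGroup.mk_surjective x
    have := hξ y
    rw [hexp, mul_comm] at this
    exact this ▸ Complex.norm_exp_ofReal_mul_I _
  have hφc : Continuous φ := by
    rw [funext hac]
    exact continuous_const.add (intervalIntegral.continuous_primitive hgint 0)
  have hcoc : ∀ (i : ℕ) (x : ℝ), cocycleProd α ξ i x =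
      Complex.exp (Complex.I *
        (2 * π * ∑ j ∈ Finset.range i, φ (x + Int.fract (j * α)) : ℝ)) := fun i x => by
    rw [cocycleProd_coe_eq_prod_fract]
    simp only [hξ]
    rw [← Complex.exp_sum, ← Finset.mul_sum, ← Complex.ofReal_sum, hexp]
  obtain ⟨η₁, hη₁, hbirk⟩ := exists_abs_sum_sub_le_of_tower hα hdeg hgint hac
    (δ := 1 / (40 * π)) (by positivity)
  refine spectralMultiplicityAtMost_of_cocycleTower hα hV hnorm (C := 0)
    (r := 3 / 5 * (19 / 20) ^ 2) (by norm_num) fun η hη => ?_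
  obtain ⟨ℓ, h, hℓ, hlt, hh, -, hh1, hsep⟩ := exists_rotation_tower_of_le hα
    (τ := 3 / 5) (by norm_num) le_rfl (η := min η (min η₁ 1)) (by positivity)
  have hℓη := hlt.trans_le (min_le_left _ _)
  have hℓη₁ := hlt.trans_le ((min_le_right _ _).trans (min_le_left _ _))
  have hℓ1 := (hlt.trans_le ((min_le_right _ _).trans (min_le_right _ _))).le
  refine ⟨ℓ, h, 0, fun _ => ℓ * (19 / 20) ^ 2, hℓη, hℓ, hℓ1,
    ⟨fun _ => by positivity, fun _ => by nlinarith, hh1, by simp⟩, hsep, ?_, fun i hi => ?_⟩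
  · simp only [Finset.sum_const, Finset.card_range, nsmul_eq_mul]
    nlinarith
  · have hb := hbirk ℓ h hℓ hℓη₁ hℓ1 hh1 hsep i hi.le
    have h0 : ∀ x, cocycleProd (α : AddCircle (1 : ℝ)) ξ 0 x = 1 := fun x => by simp [cocycleProd]
    simp only [h0, map_one, one_mul]
    have hclose : ∀ x ∈ Set.Icc 0 ℓ, ‖cocycleProd α ξ i x -
        cocycleProd α ξ i ((0 : ℝ) : AddCircle (1 : ℝ))‖ ≤ 1 / 20 := by
      intro x hx
      rw [hcoc, hcoc]
      have h1 : Complex.exp (Complex.I *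
            (2 * π * ∑ j ∈ Finset.range i, φ (x + Int.fract (j * α)) : ℝ)) -
          Complex.exp (Complex.I *
            (2 * π * ∑ j ∈ Finset.range i, φ (0 + Int.fract (j * α)) : ℝ)) =
          Complex.exp (Complex.I *
            (2 * π * ∑ j ∈ Finset.range i, φ (0 + Int.fract (j * α)) : ℝ)) *
          (Complex.exp (Complex.I * (2 * π * ∑ j ∈ Finset.range i,
            (φ (x + Int.fract (j * α)) - φ (Int.fract (j * α))) : ℝ)) - 1) := by
        rw [mul_sub, ← Complex.exp_add, mul_one]
        congr 2
        simp only [zero_add, Finset.sum_sub_distrib]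
        push_cast
        ring
      rw [h1, norm_mul, Complex.norm_exp_I_mul_ofReal, one_mul]
      refine (Real.norm_exp_I_mul_ofReal_sub_one_le).trans ?_
      rw [Real.norm_eq_abs, abs_mul, abs_of_pos (by positivity)]
      calc 2 * π * _ ≤ 2 * π * (1 / (40 * π)) := by
            gcongr; exact hb x hx
        _ = 1 / 20 := by field_simp; norm_num
    have hc : Continuous fun x : ℝ => cocycleProd α ξ i x := by
      simp only [hcoc]
      fun_prop
    set a : ℂ := cocycleProd α ξ i ((0 : ℝ) : AddCircle (1 : ℝ)) with ha
    have ha1 : ‖a‖ = 1 := norm_cocycleProd hnorm i _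
    have h2 : ‖(∫ x in (0 : ℝ)..ℓ, cocycleProd α ξ i x) - ℓ * a‖ ≤ 1 / 20 * ℓ := by
      have h3 : (∫ x in (0 : ℝ)..ℓ, cocycleProd α ξ i x) - ℓ * a =
          ∫ x in (0 : ℝ)..ℓ, (cocycleProd α ξ i x - a) := by
        rw [intervalIntegral.integral_sub (hc.intervalIntegrable _ _) (by simp),
          intervalIntegral.integral_const]
        simp
      rw [h3]
      refine (intervalIntegral.norm_integral_le_of_norm_le_const (C := 1 / 20)
        fun x hx => ?_).trans ?_
      · rw [Set.uIoc_of_le hℓ.le] at hx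
        exact hclose x ⟨hx.1.le, hx.2⟩
      · rw [sub_zero, abs_of_pos hℓ]
    have h4 : ℓ * (19 / 20) ≤ ‖∫ x in (0 : ℝ)..ℓ, cocycleProd α ξ i x‖ := by
      have h5 := norm_sub_norm_le ((ℓ : ℂ) * a) (∫ x in (0 : ℝ)..ℓ, cocycleProd α ξ i x)
      rw [norm_sub_rev] at h5
      rw [norm_mul, ha1, mul_one, Complex.norm_real, Real.norm_of_nonneg hℓ.le] at h5
      linarith
    calc ℓ * (ℓ * (19 / 20) ^ 2) = (ℓ * (19 / 20)) ^ 2 := by ring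
      _ ≤ _ := by gcongr

end AbsolutelyContinuous

section BoundedVariation

lemma aestronglyMeasurable_coe_addCircle {F : AddCircle (1 : ℝ) → ℂ}
    (hF : AEStronglyMeasurable F volume) {ℓ : ℝ} (hℓ : ℓ ≤ 1) :
    AEStronglyMeasurable (fun x : ℝ => F x) (volume.restrict (Set.Ioc 0 ℓ)) := by
  have h1 := hF.comp_measurePreserving (AddCircle.measurePreserving_mk 1 0)
  refine AEStronglyMeasurable.mono_measure h1 (Measure.restrict_mono ?_ le_rfl)
  rw [zero_add]
  exact Set.Ioc_subset_Ioc_right hℓ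

lemma re_conj_mul_eq_one_sub {a b : ℂ} (ha : ‖a‖ = 1) (hb : ‖b‖ = 1) :
    (starRingEnd ℂ a * b).re = 1 - ‖b - a‖ ^ 2 / 2 := by
  have h1 : ‖a‖ ^ 2 = a.re * a.re + a.im * a.im := by
    rw [← Complex.normSq_eq_norm_sq, Complex.normSq_apply]
  have h2 : ‖b‖ ^ 2 = b.re * b.re + b.im * b.im := by
    rw [← Complex.normSq_eq_norm_sq, Complex.normSq_apply]
  rw [← Complex.normSq_eq_norm_sq, Complex.normSq_apply]
  rw [ha] at h1
  rw [hb] at h2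
  simp only [Complex.mul_re, Complex.conj_re, Complex.conj_im, Complex.sub_re, Complex.sub_im]
  linarith

/-- A unimodular function which oscillates less than a monotone function with values in `[0, D]`
has a mean of modulus at least `√(1 - D² / 4)`. -/
lemma sq_mul_le_norm_integral_sq {u : ℝ → ℂ} {γ : ℝ → ℝ} {ℓ D : ℝ} (hℓ : 0 ≤ ℓ)
    (hu : AEStronglyMeasurable u (volume.restrict (Set.Ioc 0 ℓ))) (hu1 : ∀ x, ‖u x‖ = 1)
    (hγ : MonotoneOn γ (Set.Icc 0 ℓ)) (h0 : ∀ x ∈ Set.Icc 0 ℓ, 0 ≤ γ x)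
    (hD : ∀ x ∈ Set.Icc 0 ℓ, γ x ≤ D)
    (hle : ∀ x ∈ Set.Icc 0 ℓ, ∀ y ∈ Set.Icc 0 ℓ, ‖u x - u y‖ ≤ |γ x - γ y|) :
    ℓ ^ 2 * (1 - D ^ 2 / 4) ≤ ‖∫ x in (0 : ℝ)..ℓ, u x‖ ^ 2 := by
  have hui : IntervalIntegrable u volume 0 ℓ := by
    rw [intervalIntegrable_iff_integrableOn_Ioc_of_le hℓ]
    exact Integrable.of_bound hu 1 (.of_forall fun x => (hu1 x).le)
  have hγi : IntervalIntegrable γ volume 0 ℓ :=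
    MonotoneOn.intervalIntegrable (by rwa [Set.uIcc_of_le hℓ])
  have hγ2i : IntervalIntegrable (fun x => γ x ^ 2) volume 0 ℓ := by
    refine MonotoneOn.intervalIntegrable ?_
    rw [Set.uIcc_of_le hℓ]
    intro x hx y hy hxy
    have := hγ hx hy hxy
    have := h0 x hx
    simp only
    gcongr
  set I : ℂ := ∫ x in (0 : ℝ)..ℓ, u x with hI
  set G : ℝ := ∫ x in (0 : ℝ)..ℓ, γ x with hG
  set Q : ℝ := ∫ x in (0 : ℝ)..ℓ, γ x ^ 2 with hQ
  have hquad : ∀ c : ℝ, IntervalIntegrable (fun x => 1 - (γ x - c) ^ 2 / 2) volume 0 ℓ ∧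
      ∫ x in (0 : ℝ)..ℓ, (1 - (γ x - c) ^ 2 / 2) = ℓ - Q / 2 + c * G - c ^ 2 / 2 * ℓ := by
    intro c
    have e : (fun x => 1 - (γ x - c) ^ 2 / 2) =
        fun x => (1 - c ^ 2 / 2) + (c * γ x - (1 / 2) * γ x ^ 2) := by
      funext x; ring
    rw [e]
    have i1 : IntervalIntegrable (fun x => c * γ x - (1 / 2) * γ x ^ 2) volume 0 ℓ :=
      (hγi.const_mul c).sub (hγ2i.const_mul _)
    refine ⟨(by simp : IntervalIntegrable (fun _ => 1 - c ^ 2 / 2) volume 0 ℓ).add i1, ?_⟩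
    rw [intervalIntegral.integral_add (by simp) i1,
      intervalIntegral.integral_sub (hγi.const_mul c) (hγ2i.const_mul _),
      intervalIntegral.integral_const, intervalIntegral.integral_const_mul,
      intervalIntegral.integral_const_mul]
    simp only [sub_zero, smul_eq_mul]
    ring
  have hfix : ∀ y ∈ Set.Icc 0 ℓ, ℓ - Q / 2 + γ y * G - γ y ^ 2 / 2 * ℓ ≤
      (starRingEnd ℂ I * u y).re := by
    intro y hy
    have e1 : (starRingEnd ℂ I * u y).re = ∫ x in (0 : ℝ)..ℓ, (starRingEnd ℂ (u y) * u x).re := by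
      have h1 : (starRingEnd ℂ I * u y).re = (starRingEnd ℂ (u y) * I).re := by
        simp only [Complex.mul_re, Complex.conj_re, Complex.conj_im]; ring
      rw [h1, hI, ← intervalIntegral.integral_const_mul]
      exact (Complex.reCLM.intervalIntegral_comp_comm (hui.const_mul _)).symm
    rw [e1, ← (hquad (γ y)).2]
    refine intervalIntegral.integral_mono_on hℓ (hquad (γ y)).1 ?_ fun x hx => ?_
    · have := hui.const_mul (starRingEnd ℂ (u y))
      exact ⟨Complex.reCLM.integrable_comp this.1, Complex.reCLM.integrable_comp this.2⟩
    · rw [re_conj_mul_eq_one_sub (hu1 y) (hu1 x)]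
      have := pow_le_pow_left₀ (norm_nonneg _) (hle x hx y hy) 2
      rw [sq_abs] at this
      linarith
  have hfinal : ℓ * (ℓ - Q / 2) + G * G - Q / 2 * ℓ ≤ ‖I‖ ^ 2 := by
    have e1 : ‖I‖ ^ 2 = ∫ y in (0 : ℝ)..ℓ, (starRingEnd ℂ I * u y).re := by
      have h1 : ‖I‖ ^ 2 = (starRingEnd ℂ I * I).re := by
        rw [← Complex.normSq_eq_norm_sq, Complex.normSq_apply]
        simp only [Complex.mul_re, Complex.conj_re, Complex.conj_im]; ring
      rw [h1]
      conv_lhs => rw [hI, ← intervalIntegral.integral_const_mul]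
      exact (Complex.reCLM.intervalIntegral_comp_comm (hui.const_mul _)).symm
    have e2 : (fun y => ℓ - Q / 2 + γ y * G - γ y ^ 2 / 2 * ℓ) =
        fun y => (ℓ - Q / 2) + (G * γ y - (ℓ / 2) * γ y ^ 2) := by
      funext y; ring
    have i1 : IntervalIntegrable (fun x => G * γ x - (ℓ / 2) * γ x ^ 2) volume 0 ℓ :=
      (hγi.const_mul _).sub (hγ2i.const_mul _)
    have i2 : IntervalIntegrable (fun x => (ℓ - Q / 2) + (G * γ x - (ℓ / 2) * γ x ^ 2))
        volume 0 ℓ :=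
      (by simp : IntervalIntegrable (fun _ => ℓ - Q / 2) volume 0 ℓ).add i1
    have e3 : ∫ y in (0 : ℝ)..ℓ, ((ℓ - Q / 2) + (G * γ y - (ℓ / 2) * γ y ^ 2)) =
        ℓ * (ℓ - Q / 2) + G * G - Q / 2 * ℓ := by
      rw [intervalIntegral.integral_add (by simp) i1,
        intervalIntegral.integral_sub (hγi.const_mul _) (hγ2i.const_mul _),
        intervalIntegral.integral_const, intervalIntegral.integral_const_mul,
        intervalIntegral.integral_const_mul]
      simp only [sub_zero, smul_eq_mul]
      ring
    rw [e1, ← e3]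
    refine intervalIntegral.integral_mono_on hℓ i2 ?_ fun y hy => ?_
    · have := hui.const_mul (starRingEnd ℂ I)
      exact ⟨Complex.reCLM.integrable_comp this.1, Complex.reCLM.integrable_comp this.2⟩
    · exact (le_of_eq (congrFun e2 y).symm).trans (hfix y hy)
  have hQG : Q ≤ D * G := by
    rw [hG, ← intervalIntegral.integral_const_mul]
    refine intervalIntegral.integral_mono_on hℓ hγ2i (hγi.const_mul D) fun x hx => ?_
    have := h0 x hx
    have := hD x hx
    nlinarith
  nlinarith [sq_nonneg (ℓ * D / 2 - G)]

lemma abs_max_one_sub_sq_sub_le (x y : ℝ) :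
    |max 0 (1 - x ^ 2 / 4) - max 0 (1 - y ^ 2 / 4)| ≤ |x - y| := by
  have key : ∀ z : ℝ, max 0 (1 - z ^ 2 / 4) = 1 - (min |z| 2) ^ 2 / 4 := fun z => by
    rcases le_total |z| 2 with h | h
    · rw [min_eq_left h, sq_abs, max_eq_right]
      nlinarith [sq_abs z, abs_nonneg z]
    · rw [min_eq_right h, max_eq_left]
      · norm_num
      · nlinarith [sq_abs z]
  rw [key, key]
  set a := min |x| 2
  set b := min |y| 2
  have ha0 : 0 ≤ a := le_min (abs_nonneg _) (by norm_num)
  have hb0 : 0 ≤ b := le_min (abs_nonneg _) (by norm_num)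
  have ha2 : a ≤ 2 := min_le_right _ _
  have hb2 : b ≤ 2 := min_le_right _ _
  have hab : |a - b| ≤ |x - y| := by
    refine (abs_min_sub_min_le_max _ _ _ _).trans ?_
    rw [sub_self, abs_zero, max_eq_left (abs_nonneg _)]
    exact abs_abs_sub_abs_le _ _
  refine le_trans ?_ hab
  have : 1 - a ^ 2 / 4 - (1 - b ^ 2 / 4) = -((a - b) * ((a + b) / 4)) := by ring
  rw [this, abs_neg, abs_mul, abs_of_nonneg (by positivity : 0 ≤ (a + b) / 4)]
  nlinarith [abs_nonneg (a - b)]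

/-- Points of an interval of length `w` have a member whose mean squared distance to the others is
at most `w² / 2`. -/
lemma exists_sum_sq_sub_le {ι : Type*} {s : Finset ι} (hs : s.Nonempty) {p : ι → ℝ} {a w : ℝ}
    (h0 : ∀ i ∈ s, a ≤ p i) (h1 : ∀ i ∈ s, p i ≤ a + w) :
    ∃ b ∈ s, ∑ i ∈ s, (p i - p b) ^ 2 ≤ s.card * (w ^ 2 / 2) := by
  refine Finset.exists_le_of_sum_le hs ?_
  set P := ∑ i ∈ s, (p i - a) with hP
  set Q := ∑ i ∈ s, (p i - a) ^ 2 with hQ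
  have e : ∑ b ∈ s, ∑ i ∈ s, (p i - p b) ^ 2 = 2 * (s.card * Q - P ^ 2) := by
    have h2 : ∀ b ∈ s, ∑ i ∈ s, (p i - p b) ^ 2 =
        Q - 2 * P * (p b - a) + s.card * (p b - a) ^ 2 := fun b _ => by
      have : ∀ i ∈ s, (p i - p b) ^ 2 =
          (p i - a) ^ 2 - (p i - a) * (2 * (p b - a)) + (p b - a) ^ 2 := fun i _ => by ring
      rw [Finset.sum_congr rfl this, Finset.sum_add_distrib, Finset.sum_sub_distrib,
        ← Finset.sum_mul, Finset.sum_const, nsmul_eq_mul, ← hP, ← hQ]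
      ring
    rw [Finset.sum_congr rfl h2, Finset.sum_add_distrib, Finset.sum_sub_distrib,
      ← Finset.mul_sum, ← Finset.mul_sum, Finset.sum_const, nsmul_eq_mul, ← hP, ← hQ]
    ring
  have hQP : Q ≤ w * P := by
    rw [hP, Finset.mul_sum]
    refine Finset.sum_le_sum fun i hi => ?_
    have := h0 i hi
    have := h1 i hi
    nlinarith
  rw [e, Finset.sum_const, nsmul_eq_mul]
  have hc : (0 : ℝ) ≤ s.card := by positivity
  nlinarith [sq_nonneg (s.card * w / 2 - P), mul_le_mul_of_nonneg_left hQP hc]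

/-- Among `h` points of `[0, n w]`, one of them has many close neighbours. -/
lemma exists_le_sum_max_one_sub_sq {h n : ℕ} (hh : 0 < h) (hn : 0 < n) {w : ℝ} (hw : 0 < w)
    (hw2 : w ^ 2 ≤ 8) {p : ℕ → ℝ} (h0 : ∀ i < h, 0 ≤ p i) (h1 : ∀ i < h, p i ≤ n * w) :
    ∃ b < h, (h / n : ℝ) * (1 - w ^ 2 / 8) ≤
      ∑ i ∈ Finset.range h, max 0 (1 - (p i - p b) ^ 2 / 4) := by
  set f : ℕ → ℕ := fun i => ⌈p i / w⌉₊ - 1 with hf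
  have hn' : (0 : ℝ) < n := by exact_mod_cast hn
  obtain ⟨k, -, hk⟩ := Finset.exists_le_card_fiber_of_nsmul_le_card_of_maps_to
    (s := Finset.range h) (t := Finset.range n) (f := f) (b := (h / n : ℝ))
    (fun i hi => by
      have h2 : ⌈p i / w⌉₊ ≤ n :=
        Nat.ceil_le.2 ((div_le_iff₀ hw).2 (h1 i (Finset.mem_range.1 hi)))
      simp only [hf, Finset.mem_range]
      omega)
    (Finset.nonempty_range_iff.2 hn.ne')
    (by rw [Finset.card_range, Finset.card_range, nsmul_eq_mul, mul_div_cancel₀ _ hn'.ne'])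
  set s := {i ∈ Finset.range h | f i = k} with hs
  have hspos : (0 : ℝ) < s.card := lt_of_lt_of_le (by positivity) hk
  have hsne : s.Nonempty := Finset.card_pos.1 (by exact_mod_cast hspos)
  have hbounds : ∀ i ∈ s, k * w ≤ p i ∧ p i ≤ k * w + w := by
    intro i hi
    rw [hs, Finset.mem_filter, Finset.mem_range] at hi
    obtain ⟨hih, hik⟩ := hi
    have h3 : p i ≤ ⌈p i / w⌉₊ * w := (div_le_iff₀ hw).1 (Nat.le_ceil _)
    rcases Nat.eq_zero_or_pos ⌈p i / w⌉₊ with hz | hz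
    · have hk0 : k = 0 := by rw [← hik, hf]; simp only; omega
      rw [hz] at h3
      have := h0 i hih
      subst hk0
      push_cast at h3 ⊢
      constructor <;> linarith
    · have hk0 : ⌈p i / w⌉₊ = k + 1 := by rw [← hik, hf]; simp only; omega
      rw [hk0] at h3
      have h4 : (k : ℝ) < p i / w := Nat.lt_ceil.1 (by omega)
      rw [lt_div_iff₀ hw] at h4
      push_cast at h3
      constructor <;> linarith
  obtain ⟨b, hb, hsum⟩ := exists_sum_sq_sub_le hsne (fun i hi => (hbounds i hi).1)
    fun i hi => (hbounds i hi).2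
  refine ⟨b, Finset.mem_range.1 (Finset.mem_filter.1 hb).1, ?_⟩
  calc (h / n : ℝ) * (1 - w ^ 2 / 8) ≤ s.card * (1 - w ^ 2 / 8) :=
        mul_le_mul_of_nonneg_right hk (by linarith)
    _ ≤ ∑ i ∈ s, (1 - (p i - p b) ^ 2 / 4) := by
        rw [Finset.sum_sub_distrib, ← Finset.sum_div, Finset.sum_const, nsmul_eq_mul, mul_one]
        linarith
    _ ≤ ∑ i ∈ s, max 0 (1 - (p i - p b) ^ 2 / 4) :=
        Finset.sum_le_sum fun i _ => le_max_right _ _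
    _ ≤ _ := Finset.sum_le_sum_of_subset_of_nonneg (Finset.filter_subset _ _)
        fun i _ _ => le_max_left _ _

end BoundedVariation

section BoundedVariationCocycle

lemma norm_prod_sub_prod_le {ι : Type*} (s : Finset ι) {a b : ι → ℂ} (ha : ∀ j, ‖a j‖ = 1)
    (hb : ∀ j, ‖b j‖ = 1) : ‖∏ j ∈ s, a j - ∏ j ∈ s, b j‖ ≤ ∑ j ∈ s, ‖a j - b j‖ := by
  classical
  induction s using Finset.induction_on with
  | empty => simp
  | insert k s hk ih =>
    rw [Finset.prod_insert hk, Finset.prod_insert hk, Finset.sum_insert hk]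
    have h1 : a k * ∏ j ∈ s, a j - b k * ∏ j ∈ s, b j =
        (a k - b k) * ∏ j ∈ s, a j + b k * (∏ j ∈ s, a j - ∏ j ∈ s, b j) := by ring
    rw [h1]
    refine (norm_add_le _ _).trans ?_
    rw [norm_mul, norm_mul, hb, one_mul, norm_prod, Finset.prod_congr rfl fun j _ => ha j,
      Finset.prod_const_one, mul_one]
    linarith

/-- The correlation of two cocycle products, bounded through the total variation of the
factors in which they differ. -/
lemma sq_mul_le_norm_integral_cocycleProd {α : ℝ} {ξ : AddCircle (1 : ℝ) → ℂ}
    (hm : AEStronglyMeasurable ξ volume) (hξ1 : ∀ x, ‖ξ x‖ = 1) {M : ℝ → ℝ}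
    (hM : MonotoneOn M (Set.Icc 0 1))
    (hξM : ∀ x y, 0 ≤ x → x ≤ y → y ≤ 1 → ‖ξ (x : ℝ) - ξ (y : ℝ)‖ ≤ M y - M x)
    {ℓ : ℝ} {h : ℕ} (hℓ : 0 < ℓ) (hℓ1 : ℓ ≤ 1)
    (hsep : ∀ k : ℕ, 0 < k → k < h → ∀ p : ℤ, ℓ ≤ |k * α - p|) {b i : ℕ} (hbi : b ≤ i)
    (hih : i ≤ h) :
    ℓ ^ 2 * (1 - (∑ j ∈ Finset.Ico b i,
        (M (Int.fract (j * α) + ℓ) - M (Int.fract (j * α)))) ^ 2 / 4) ≤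
      ‖∫ x in (0 : ℝ)..ℓ, starRingEnd ℂ (cocycleProd α ξ b x) * cocycleProd α ξ i x‖ ^ 2 := by
  set t : ℕ → ℝ := fun j => Int.fract (j * α) with ht
  have ht0 : ∀ j, 0 ≤ t j := fun j => Int.fract_nonneg _
  have htℓ : ∀ j ∈ Finset.Ico b i, t j + ℓ ≤ 1 := fun j hj =>
    fract_add_le_one hℓ1 hsep ((Finset.mem_Ico.1 hj).2.trans_le hih)
  have hprod : ∀ x : ℝ, starRingEnd ℂ (cocycleProd α ξ b x) * cocycleProd α ξ i x =
      ∏ j ∈ Finset.Ico b i, ξ ((x + t j : ℝ) : AddCircle (1 : ℝ)) := fun x => by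
    have h1 : cocycleProd α ξ i x = cocycleProd α ξ b x *
        ∏ j ∈ Finset.Ico b i, ξ ((x + t j : ℝ) : AddCircle (1 : ℝ)) := by
      rw [cocycleProd_coe_eq_prod_fract, cocycleProd_coe_eq_prod_fract,
        Finset.prod_range_mul_prod_Ico _ hbi]
    rw [h1, ← mul_assoc, ← Complex.normSq_eq_conj_mul_self, Complex.normSq_eq_norm_sq,
      norm_cocycleProd hξ1]
    simp
  set γ : ℝ → ℝ := fun x => ∑ j ∈ Finset.Ico b i, (M (x + t j) - M (t j)) with hγ
  have hmem : ∀ j ∈ Finset.Ico b i, ∀ x ∈ Set.Icc 0 ℓ, x + t j ∈ Set.Icc (0 : ℝ) 1 :=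
    fun j hj x hx => ⟨by linarith [hx.1, ht0 j], by linarith [hx.2, htℓ j hj]⟩
  have hγmono : MonotoneOn γ (Set.Icc 0 ℓ) := fun x hx y hy hxy =>
    Finset.sum_le_sum fun j hj => by
      have := hM (hmem j hj x hx) (hmem j hj y hy) (by linarith)
      linarith
  have hosc : ∀ x ∈ Set.Icc 0 ℓ, ∀ y ∈ Set.Icc 0 ℓ, x ≤ y →
      ‖starRingEnd ℂ (cocycleProd α ξ b x) * cocycleProd α ξ i x -
        starRingEnd ℂ (cocycleProd α ξ b y) * cocycleProd α ξ i y‖ ≤ γ y - γ x := by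
    intro x hx y hy hxy
    rw [hprod, hprod]
    refine (norm_prod_sub_prod_le _ (fun j => hξ1 _) fun j => hξ1 _).trans ?_
    rw [hγ]
    simp only
    rw [← Finset.sum_sub_distrib]
    refine Finset.sum_le_sum fun j hj => ?_
    have := hξM (x + t j) (y + t j) (hmem j hj x hx).1 (by linarith) (hmem j hj y hy).2
    linarith
  refine sq_mul_le_norm_integral_sq (γ := γ) hℓ.le
    (aestronglyMeasurable_coe_addCircle (F := fun x =>
      starRingEnd ℂ (cocycleProd α ξ b x) * cocycleProd α ξ i x)
      ((continuous_star.comp_aestronglyMeasurable (aestronglyMeasurable_cocycleProd hm α b)).mul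
      (aestronglyMeasurable_cocycleProd hm α i)) hℓ1)
    (fun x => by simp [norm_cocycleProd hξ1]) hγmono (fun x hx => ?_) (fun x hx => ?_)
    fun x hx y hy => ?_
  · refine Finset.sum_nonneg fun j hj => ?_
    have := hM (a := t j) ⟨ht0 j, by linarith [htℓ j hj]⟩ (hmem j hj x hx) (by linarith [hx.1])
    linarith
  · refine (hγmono hx ⟨hℓ.le, le_rfl⟩ hx.2).trans (le_of_eq ?_)
    exact Finset.sum_congr rfl fun j _ => by rw [add_comm ℓ]
  · rcases le_total x y with hxy | hxy
    · rw [abs_sub_comm]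
      exact (hosc x hx y hy hxy).trans (le_abs_self _)
    · rw [norm_sub_rev]
      exact (hosc y hy x hx hxy).trans (le_abs_self _)

/-- Towers for a cocycle whose increments are dominated by those of a monotone function of total
increment at most `n w`. -/
lemma spectralMultiplicityAtMost_of_monotone {α : ℝ} (hα : Irrational α)
    {ξ : AddCircle (1 : ℝ) → ℂ} (hξ1 : ∀ x, ‖ξ x‖ = 1) {M : ℝ → ℝ}
    (hM : MonotoneOn M (Set.Icc 0 1))
    (hξM : ∀ x y, 0 ≤ x → x ≤ y → y ≤ 1 → ‖ξ (x : ℝ) - ξ (y : ℝ)‖ ≤ M y - M x)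
    {V : Lp ℂ 2 (volume : Measure (AddCircle (1 : ℝ))) ≃ₗᵢ[ℂ]
      Lp ℂ 2 (volume : Measure (AddCircle (1 : ℝ)))}
    (hV : IsWeightedOperator α ξ V) {n m : ℕ} (hn : 0 < n) {w : ℝ} (hw : 0 < w)
    (hw2 : w ^ 2 ≤ 8) (hMn : M 1 - M 0 ≤ n * w)
    (hm : 1 < (m + 1) * (3 / 5 / n * (1 - w ^ 2 / 8))) : SpectralMultiplicityAtMost V m := by
  refine spectralMultiplicityAtMost_of_cocycleTower hα hV hξ1 (C := M 1 - M 0) hm fun η hη => ?_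
  obtain ⟨ℓ, h, hℓ, hlt, hh, -, hh1, hsep⟩ := exists_rotation_tower_of_le hα
    (τ := 3 / 5) (by norm_num) le_rfl (η := min η 1) (by positivity)
  have hℓη := hlt.trans_le (min_le_left _ _)
  have hℓ1 := (hlt.trans_le (min_le_right _ _)).le
  set t : ℕ → ℝ := fun j => Int.fract (j * α) with ht
  set v : ℕ → ℝ := fun j => M (t j + ℓ) - M (t j) with hv
  have hv0 : ∀ j < h, 0 ≤ v j := fun j hj => by
    have h1 := fract_add_le_one hℓ1 hsep hj
    have h2 : 0 ≤ t j := Int.fract_nonneg _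
    have := hM (a := t j) (b := t j + ℓ) ⟨h2, by linarith⟩ ⟨by linarith, h1⟩ (by linarith)
    simp only [hv]
    linarith
  have hvsum : ∀ i ≤ h, ∑ j ∈ Finset.range i, v j ≤ M 1 - M 0 := fun i hi => by
    refine sum_sub_le_of_separated hM hℓ.le _ (fun j _ => Int.fract_nonneg _)
      (fun j hj k hk hjk => ?_) zero_le_one le_rfl fun j hj => ?_
    · exact le_abs_fract_sub_fract hsep ((Finset.mem_range.1 hj).trans_le hi)
        ((Finset.mem_range.1 hk).trans_le hi) hjk
    · exact fract_add_le_one hℓ1 hsep ((Finset.mem_range.1 hj).trans_le hi)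
  set p : ℕ → ℝ := fun i => ∑ j ∈ Finset.range i, v j with hp
  have hhpos : 0 < h := by
    rcases Nat.eq_zero_or_pos h with rfl | h0
    · norm_num at hh
    · exact h0
  obtain ⟨b, hb, hbsum⟩ := exists_le_sum_max_one_sub_sq hhpos hn hw hw2 (p := p)
    (fun i hi => Finset.sum_nonneg fun j hj => hv0 j ((Finset.mem_range.1 hj).trans hi))
    fun i hi => (hvsum i hi.le).trans hMn
  have hpIco : ∀ {a c}, a ≤ c → p c - p a = ∑ j ∈ Finset.Ico a c, v j := fun hac =>
    (Finset.sum_Ico_eq_sub _ hac).symm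
  refine ⟨ℓ, h, b, fun i => ℓ * max 0 (1 - (p i - p b) ^ 2 / 4), hℓη, hℓ, hℓ1,
    ⟨fun i => by positivity, fun i => ?_, hh1, ?_⟩, hsep, ?_, fun i hi => ?_⟩
  · have : max 0 (1 - (p i - p b) ^ 2 / 4) ≤ 1 :=
      max_le zero_le_one (by linarith [sq_nonneg (p i - p b)])
    nlinarith
  · calc ∑ i ∈ Finset.range h, |ℓ * max 0 (1 - (p (i + 1) - p b) ^ 2 / 4) -
          ℓ * max 0 (1 - (p i - p b) ^ 2 / 4)| ≤ ∑ i ∈ Finset.range h, ℓ * v i := by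
          refine Finset.sum_le_sum fun i hi => ?_
          rw [← mul_sub, abs_mul, abs_of_pos hℓ]
          refine mul_le_mul_of_nonneg_left ((abs_max_one_sub_sq_sub_le _ _).trans ?_) hℓ.le
          have : p (i + 1) - p b - (p i - p b) = v i := by
            simp only [hp, Finset.sum_range_succ]; ring
          rw [this, abs_of_nonneg (hv0 i (Finset.mem_range.1 hi))]
      _ ≤ _ := by
          rw [← Finset.mul_sum, mul_comm]
          exact mul_le_mul_of_nonneg_right (hvsum h le_rfl) hℓ.le
  · rw [← Finset.mul_sum]
    have hn' : (0 : ℝ) < n := by exact_mod_cast hn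
    calc 3 / 5 / n * (1 - w ^ 2 / 8) ≤ h * ℓ / n * (1 - w ^ 2 / 8) := by
          refine mul_le_mul_of_nonneg_right ?_ (by linarith)
          gcongr
      _ = ℓ * (h / n * (1 - w ^ 2 / 8)) := by ring
      _ ≤ _ := mul_le_mul_of_nonneg_left hbsum hℓ.le
  · rcases max_cases 0 (1 - (p i - p b) ^ 2 / 4) with ⟨h1, -⟩ | ⟨h1, -⟩
    · rw [h1]; simp
    rw [h1, ← mul_assoc, ← sq]
    rcases le_total b i with hbi | hbi
    · rw [hpIco hbi]
      exact sq_mul_le_norm_integral_cocycleProd hV.aestronglyMeasurable hξ1 hM hξM hℓ hℓ1 hsep hbi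
        hi.le
    · have h2 := sq_mul_le_norm_integral_cocycleProd hV.aestronglyMeasurable hξ1 hM hξM hℓ hℓ1 hsep
        hbi hb.le
      have h3 : (p i - p b) ^ 2 = (∑ j ∈ Finset.Ico i b, v j) ^ 2 := by rw [← hpIco hbi]; ring
      have h4 : ∀ x : ℝ, starRingEnd ℂ (cocycleProd α ξ b x) * cocycleProd α ξ i x =
          starRingEnd ℂ (starRingEnd ℂ (cocycleProd α ξ i x) * cocycleProd α ξ b x) := fun x => by
        rw [map_mul, Complex.conj_conj, mul_comm]
      simp only [h4]
      rw [intervalIntegral.integral_of_le hℓ.le, integral_conj, RCLike.norm_conj,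
        ← intervalIntegral.integral_of_le hℓ.le, h3]
      exact h2

lemma le_mul_one_sub_sq {w : ℝ} (h1 : 9 / 10 ≤ w) (h2 : w ≤ 11 / 5) :
    4 / 5 ≤ w * (1 - w ^ 2 / 8) := by
  nlinarith [mul_nonneg (sub_nonneg.2 h1) (sub_nonneg.2 h2),
    mul_nonneg (mul_nonneg (sub_nonneg.2 h1) (sub_nonneg.2 h2)) (by linarith : 0 ≤ w)]

theorem spectralMultiplicityAtMost_of_boundedVariation {α : ℝ} (hα : Irrational α) {ξr : ℝ → ℂ}
    {ξ : AddCircle (1 : ℝ) → ℂ} (hmod : ∀ x : ℝ, ‖ξr x‖ = 1)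
    (hBV : BoundedVariationOn ξr (Set.Icc (0 : ℝ) 1))
    (hξ : ∀ x : ℝ, ξ (x : AddCircle (1 : ℝ)) = ξr x)
    {V : Lp ℂ 2 (volume : Measure (AddCircle (1 : ℝ))) ≃ₗᵢ[ℂ]
      Lp ℂ 2 (volume : Measure (AddCircle (1 : ℝ)))}
    (hV : IsWeightedOperator α ξ V) :
    SpectralMultiplicityAtMost V
      (Nat.floor (max 2 (2 * π * (eVariationOn ξr (Set.Icc (0 : ℝ) 1)).toReal / 3))) := by
  set W : ℝ := (eVariationOn ξr (Set.Icc (0 : ℝ) 1)).toReal with hW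
  have hξ1 : ∀ x, ‖ξ x‖ = 1 := fun x => by
    obtain ⟨y, rfl⟩ := QuotientAddGroup.mk_surjective x
    exact hξ y ▸ hmod y
  set M : ℝ → ℝ := variationOnFromTo ξr (Set.Icc 0 1) 0 with hMdef
  have hloc := hBV.locallyBoundedVariationOn
  have h0mem : (0 : ℝ) ∈ Set.Icc (0 : ℝ) 1 := ⟨le_rfl, zero_le_one⟩
  have hM : MonotoneOn M (Set.Icc 0 1) := variationOnFromTo.monotoneOn hloc h0mem
  have hM1 : M 1 - M 0 = W := by
    rw [hMdef, variationOnFromTo.self, sub_zero, variationOnFromTo.eq_of_le _ _ zero_le_one,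
      Set.inter_self]
  have hξM : ∀ x y, 0 ≤ x → x ≤ y → y ≤ 1 → ‖ξ (x : ℝ) - ξ (y : ℝ)‖ ≤ M y - M x := by
    intro x y hx hxy hy
    have hxm : x ∈ Set.Icc (0 : ℝ) 1 := ⟨hx, hxy.trans hy⟩
    have hym : y ∈ Set.Icc (0 : ℝ) 1 := ⟨hx.trans hxy, hy⟩
    have h1 : M y - M x = variationOnFromTo ξr (Set.Icc 0 1) x y := by
      have := variationOnFromTo.add hloc h0mem hxm hym
      rw [hMdef]; linarith
    rw [h1, variationOnFromTo.eq_of_le _ _ hxy, hξ, hξ, ← dist_eq_norm, dist_edist]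
    exact ENNReal.toReal_mono (hloc x y hxm hym)
      (eVariationOn.edist_le _ ⟨hxm, le_rfl, hxy⟩ ⟨hym, hxy, le_rfl⟩)
  have hW0 : 0 ≤ W := ENNReal.toReal_nonneg
  set X : ℝ := max 2 (2 * π * W / 3) with hX
  have hfl : X < ⌊X⌋₊ + 1 := Nat.lt_floor_add_one X
  rcases le_or_gt W (9 / 10) with hWs | hWs
  · refine spectralMultiplicityAtMost_of_monotone hα hξ1 hM hξM hV (n := 1) one_pos
      (w := 9 / 10) (by norm_num) (by norm_num) (by rw [hM1]; simpa using hWs) ?_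
    have h2 : (2 : ℝ) ≤ ⌊X⌋₊ := by
      have : 2 ≤ ⌊X⌋₊ := Nat.le_floor (by push_cast; exact le_max_left _ _)
      exact_mod_cast this
    norm_num
    linarith
  · set n : ℕ := ⌈W / (11 / 5)⌉₊ with hn
    have hnpos : 0 < n := Nat.ceil_pos.2 (by positivity)
    have hn' : (0 : ℝ) < n := by exact_mod_cast hnpos
    have hnle : W ≤ n * (11 / 5) := (div_le_iff₀ (by norm_num)).1 (Nat.le_ceil _)
    set w : ℝ := W / n with hw
    have hwn : n * w = W := by rw [hw]; field_simp
    have hw2 : w ≤ 11 / 5 := by rw [hw, div_le_iff₀ hn']; linarith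
    have hw1 : 9 / 10 ≤ w := by
      rw [hw, le_div_iff₀ hn']
      rcases Nat.lt_or_ge 1 n with h1 | h1
      · have h2 : ((n - 1 : ℕ) : ℝ) < W / (11 / 5) := Nat.lt_ceil.1 (by omega)
        rw [lt_div_iff₀ (by norm_num), Nat.cast_sub (by omega : 1 ≤ n)] at h2
        have h3 : (2 : ℝ) ≤ n := by exact_mod_cast h1
        push_cast at h2
        linarith
      · have : n = 1 := by omega
        rw [this]; push_cast; linarith
    have hw3 := le_mul_one_sub_sq hw1 hw2
    refine spectralMultiplicityAtMost_of_monotone hα hξ1 hM hξM hV (n := n) hnpos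
      (w := w) (by linarith) (by nlinarith) (by rw [hM1, hwn]) ?_
    have h1 : 2 * π * W / 3 < ⌊X⌋₊ + 1 := (le_max_right _ _).trans_lt hfl
    have h2 : 0 < 3 / 5 / n * (1 - w ^ 2 / 8) :=
      mul_pos (by positivity) (by nlinarith)
    calc (1 : ℝ) < 2 / 5 * π * (4 / 5) := by linarith [Real.pi_gt_d2]
      _ ≤ 2 / 5 * π * (w * (1 - w ^ 2 / 8)) := by gcongr
      _ = 2 * π * W / 3 * (3 / 5 / n * (1 - w ^ 2 / 8)) := by rw [← hwn]; field_simp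
      _ < _ := mul_lt_mul_of_pos_right h1 h2

end BoundedVariationCocycle

section Character

/-- The normalized squared modulus of the integral of the character of frequency `θ` over
`[0, ℓ]`. -/
noncomputable def fejerWeight (ℓ θ : ℝ) : ℝ :=
  ‖∫ x in (0 : ℝ)..ℓ, Complex.exp (Complex.I * (θ * x : ℝ))‖ ^ 2 / ℓ

lemma norm_integral_exp_sq {θ : ℝ} (hθ : θ ≠ 0) (ℓ : ℝ) :
    ‖∫ x in (0 : ℝ)..ℓ, Complex.exp (Complex.I * (θ * x : ℝ))‖ ^ 2 =
      (2 * Real.sin (θ * ℓ / 2)) ^ 2 / θ ^ 2 := by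
  have h0 : Complex.I * θ ≠ 0 := mul_ne_zero Complex.I_ne_zero (by exact_mod_cast hθ)
  have h1 : ∀ x : ℝ, Complex.exp (Complex.I * (θ * x : ℝ)) = Complex.exp (Complex.I * θ * x) :=
    fun x => by push_cast; ring_nf
  simp only [h1]
  rw [integral_exp_mul_complex h0, ← h1, ← h1, mul_zero, Complex.ofReal_zero, mul_zero,
    Complex.exp_zero, norm_div, Complex.norm_exp_I_mul_ofReal_sub_one, norm_mul Complex.I,
    Complex.norm_I, one_mul, Complex.norm_real, div_pow, Real.norm_eq_abs, Real.norm_eq_abs, sq_abs, sq_abs]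

lemma fejerWeight_of_ne_zero {θ : ℝ} (hθ : θ ≠ 0) (ℓ : ℝ) :
    fejerWeight ℓ θ = 2 * (1 - Real.cos (θ * ℓ)) / (θ ^ 2 * ℓ) := by
  have h := Real.sin_sq_eq_half_sub (θ * ℓ / 2)
  rw [fejerWeight, norm_integral_exp_sq hθ, mul_pow, h, div_div]
  ring_nf

lemma fejerWeight_zero (ℓ : ℝ) : fejerWeight ℓ 0 = ℓ := by
  rcases eq_or_ne ℓ 0 with rfl | hℓ
  · simp [fejerWeight]
  · simp [fejerWeight, pow_two, hℓ]

lemma fejerWeight_neg (ℓ θ : ℝ) : fejerWeight ℓ (-θ) = fejerWeight ℓ θ := by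
  rcases eq_or_ne θ 0 with rfl | hθ
  · simp
  · rw [fejerWeight_of_ne_zero hθ, fejerWeight_of_ne_zero (neg_ne_zero.2 hθ)]
    simp

lemma fejerWeight_nonneg {ℓ : ℝ} (hℓ : 0 ≤ ℓ) (θ : ℝ) : 0 ≤ fejerWeight ℓ θ := by
  unfold fejerWeight; positivity

lemma norm_integral_exp_le {ℓ : ℝ} (hℓ : 0 ≤ ℓ) (θ : ℝ) :
    ‖∫ x in (0 : ℝ)..ℓ, Complex.exp (Complex.I * (θ * x : ℝ))‖ ≤ ℓ := by
  refine (intervalIntegral.norm_integral_le_of_norm_le_const (C := 1) fun x _ => ?_).trans ?_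
  · rw [Complex.norm_exp_I_mul_ofReal]
  · rw [sub_zero, abs_of_nonneg hℓ, one_mul]

lemma fejerWeight_le {ℓ : ℝ} (hℓ : 0 < ℓ) (θ : ℝ) : fejerWeight ℓ θ ≤ ℓ := by
  rw [fejerWeight, div_le_iff₀ hℓ, ← pow_two]
  gcongr
  exact norm_integral_exp_le hℓ.le θ

lemma abs_fejerWeight_add_sub_le {ℓ : ℝ} (hℓ : 0 < ℓ) (θ δ : ℝ) :
    |fejerWeight ℓ (θ + δ) - fejerWeight ℓ θ| ≤ 2 * |δ| * ℓ ^ 2 := by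
  set I : ℝ → ℂ := fun θ => ∫ x in (0 : ℝ)..ℓ, Complex.exp (Complex.I * (θ * x : ℝ)) with hI
  have hi : ∀ θ : ℝ, IntervalIntegrable (fun x : ℝ => Complex.exp (Complex.I * (θ * x : ℝ)))
      volume 0 ℓ := fun θ => Continuous.intervalIntegrable (by fun_prop) _ _
  have h1 : ‖I (θ + δ) - I θ‖ ≤ |δ| * ℓ * ℓ := by
    rw [hI]
    simp only
    rw [← intervalIntegral.integral_sub (hi _) (hi _)]
    refine (intervalIntegral.norm_integral_le_of_norm_le_const (C := |δ| * ℓ)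
      fun x hx => ?_).trans (by rw [sub_zero, abs_of_pos hℓ])
    rw [Set.uIoc_of_le hℓ.le] at hx
    have h2 : Complex.exp (Complex.I * ((θ + δ) * x : ℝ)) - Complex.exp (Complex.I * (θ * x : ℝ)) =
        Complex.exp (Complex.I * (θ * x : ℝ)) * (Complex.exp (Complex.I * (δ * x : ℝ)) - 1) := by
      rw [mul_sub, ← Complex.exp_add, mul_one]
      push_cast
      ring_nf
    rw [h2, norm_mul, Complex.norm_exp_I_mul_ofReal, one_mul]
    refine Real.norm_exp_I_mul_ofReal_sub_one_le.trans ?_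
    rw [Real.norm_eq_abs, abs_mul, abs_of_pos hx.1]
    gcongr
    exact hx.2
  have h3 : |‖I (θ + δ)‖ - ‖I θ‖| ≤ |δ| * ℓ * ℓ := (abs_norm_sub_norm_le _ _).trans h1
  have h4 : ‖I (θ + δ)‖ ≤ ℓ := norm_integral_exp_le hℓ.le _
  have h5 : ‖I θ‖ ≤ ℓ := norm_integral_exp_le hℓ.le _
  have h6 : fejerWeight ℓ (θ + δ) - fejerWeight ℓ θ =
      (‖I (θ + δ)‖ - ‖I θ‖) * (‖I (θ + δ)‖ + ‖I θ‖) / ℓ := by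
    rw [fejerWeight, fejerWeight]; ring
  rw [h6, abs_div, abs_mul, abs_of_pos hℓ, div_le_iff₀ hℓ,
    abs_of_nonneg (add_nonneg (norm_nonneg _) (norm_nonneg (I θ)))]
  calc _ ≤ |δ| * ℓ * ℓ * (ℓ + ℓ) := by gcongr
    _ = _ := by ring

lemma le_fejerWeight {ℓ : ℝ} (hℓ : 0 < ℓ) (θ : ℝ) :
    ℓ * (1 - θ ^ 2 * ℓ ^ 2 / 12) ≤ fejerWeight ℓ θ := by
  wlog hpos : 0 < θ generalizing θ with H
  · rcases (not_lt.1 hpos).eq_or_lt with rfl | hneg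
    · simp [fejerWeight_zero]
    · have := H (-θ) (neg_pos.2 hneg)
      rwa [fejerWeight_neg, neg_sq] at this
  set u := θ * ℓ / 2 with hu
  have hu0 : 0 < u := by positivity
  rw [fejerWeight, norm_integral_exp_sq hpos.ne', le_div_iff₀ hℓ, le_div_iff₀ (by positivity), ← hu]
  have h1 := Real.sin_ge_sub_cube hu0.le
  have h2 : ℓ * (1 - θ ^ 2 * ℓ ^ 2 / 12) * ℓ * θ ^ 2 = 4 * (u ^ 2 * (1 - u ^ 2 / 3)) := by
    rw [hu]; ring
  rw [h2, mul_pow]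
  rcases le_total 0 (1 - u ^ 2 / 6) with h3 | h3
  · have h4 : (u - u ^ 3 / 6) ^ 2 ≤ Real.sin u ^ 2 := by
      have : 0 ≤ u - u ^ 3 / 6 := by
        have := mul_nonneg hu0.le h3
        nlinarith
      gcongr
    nlinarith [sq_nonneg (u ^ 3)]
  · nlinarith [sq_nonneg (Real.sin u), sq_nonneg u]

lemma sum_sq_sub_le {h b : ℕ} (hb : 2 * b ≤ h) (hb' : h ≤ 2 * b + 1) :
    ∑ i ∈ Finset.range h, ((i : ℝ) - b) ^ 2 ≤ (h : ℝ) ^ 3 / 12 + h / 6 := by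
  have h1 : ∀ n : ℕ, ∑ i ∈ Finset.range n, ((i : ℝ) - b) ^ 2 =
      (n : ℝ) * (n ^ 2 - 1) / 12 + n * (b - (n - 1) / 2) ^ 2 := fun n => by
    induction n with
    | zero => simp
    | succ n ih => rw [Finset.sum_range_succ, ih]; push_cast; ring
  rw [h1]
  have h2 : 2 * (b : ℝ) ≤ h := by exact_mod_cast hb
  have h3 : (h : ℝ) ≤ 2 * b + 1 := by exact_mod_cast hb'
  have h4 : ((b : ℝ) - (h - 1) / 2) ^ 2 ≤ (1 / 2) ^ 2 :=
    pow_le_pow_left₀ (by linarith) (by linarith) 2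
  nlinarith [Nat.cast_nonneg (α := ℝ) h]

/-- Lower bound for the total Fejér weight, sharp for small frequencies. -/
lemma le_sum_fejerWeight_of_small {ℓ : ℝ} (hℓ : 0 < ℓ) (θ : ℝ) {h b : ℕ}
    (hb : 2 * b ≤ h) (hb' : h ≤ 2 * b + 1) :
    h * ℓ * (1 - θ ^ 2 / 144 * ((h * ℓ) ^ 2 + 2 * ℓ ^ 2)) ≤
      ∑ i ∈ Finset.range h, fejerWeight ℓ (θ * (i - b)) := by
  calc _ = h * ℓ - ℓ ^ 3 * θ ^ 2 / 12 * ((h : ℝ) ^ 3 / 12 + h / 6) := by ring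
    _ ≤ h * ℓ - ℓ ^ 3 * θ ^ 2 / 12 * ∑ i ∈ Finset.range h, ((i : ℝ) - b) ^ 2 := by
        have := sum_sq_sub_le hb hb'
        gcongr
    _ = ∑ i ∈ Finset.range h, ℓ * (1 - (θ * (i - b)) ^ 2 * ℓ ^ 2 / 12) := by
        rw [Finset.mul_sum]
        simp only [mul_sub, Finset.sum_sub_distrib]
        simp only [Finset.sum_const, Finset.card_range, nsmul_eq_mul, mul_one]
        congr 1
        exact Finset.sum_congr rfl fun i _ => by ring
    _ ≤ _ := Finset.sum_le_sum fun i _ => le_fejerWeight hℓ _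

lemma hasSum_one_sub_cos_div_sq {x : ℝ} (hx : x ∈ Set.Icc (0 : ℝ) 1) :
    HasSum (fun n : ℕ => (1 - Real.cos (2 * π * n * x)) / (n : ℝ) ^ 2) (π ^ 2 * (x - x ^ 2)) := by
  have h1 := hasSum_zeta_two.sub (hasSum_one_div_nat_pow_mul_cos (k := 1) one_ne_zero hx)
  have h2 : (Polynomial.map (algebraMap ℚ ℝ) (Polynomial.bernoulli 2)).eval x =
      x ^ 2 - x + 1 / 6 := by
    rw [Polynomial.bernoulli]
    simp [Finset.sum_range_succ, Polynomial.eval_add]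
    ring
  rw [mul_one, h2] at h1
  have h3 : π ^ 2 * (x - x ^ 2) = π ^ 2 / 6 -
      (-1) ^ (1 + 1) * (2 * π) ^ 2 / 2 / (Nat.factorial 2 : ℕ) * (x ^ 2 - x + 1 / 6) := by
    simp only [Nat.factorial]
    push_cast
    ring
  rw [h3]
  exact h1.congr_fun fun n => by ring

lemma le_sum_one_sub_cos_div_sq {x : ℝ} (hx : x ∈ Set.Icc (0 : ℝ) 1) {n : ℕ} (hn : n ≠ 0) :
    π ^ 2 * (x - x ^ 2) - 2 / n ≤
      ∑ k ∈ Finset.range (n + 1), (1 - Real.cos (2 * π * k * x)) / (k : ℝ) ^ 2 := by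
  rw [sub_le_iff_le_add]
  refine le_of_tendsto (hasSum_one_sub_cos_div_sq hx).tendsto_sum_nat ?_
  filter_upwards [Filter.eventually_ge_atTop (n + 1)] with N hN
  rw [← Finset.sum_range_add_sum_Ico _ hN]
  gcongr
  obtain ⟨M, rfl⟩ : ∃ M, N = M + 1 := ⟨N - 1, by omega⟩
  calc ∑ k ∈ Finset.Ico (n + 1) (M + 1), (1 - Real.cos (2 * π * k * x)) / (k : ℝ) ^ 2
      ≤ ∑ k ∈ Finset.Ioc n M, 2 * ((k : ℝ) ^ 2)⁻¹ := by
        have : Finset.Ico (n + 1) (M + 1) = Finset.Ioc n M := by ext; simp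
        rw [this]
        refine Finset.sum_le_sum fun k _ => ?_
        rw [div_eq_mul_inv]
        gcongr
        linarith [Real.neg_one_le_cos (2 * π * k * x)]
    _ ≤ 2 * ((n : ℝ)⁻¹ - (M : ℝ)⁻¹) := by
        rw [← Finset.mul_sum]
        gcongr
        exact sum_Ioc_inv_sq_le_sub hn (by omega)
    _ ≤ 2 / n := by
        rw [div_eq_mul_inv]
        gcongr
        exact sub_le_self _ (by positivity)

lemma le_sum_fejerWeight_nat {c ℓ : ℝ} (hc : 0 < c) (hℓ : 0 < ℓ) (hcℓ : c * ℓ ≤ 1) {n : ℕ}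
    (hn : n ≠ 0) :
    1 / (2 * c) - ℓ / 2 - 1 / (π ^ 2 * c ^ 2 * (n * ℓ)) ≤
      ∑ k ∈ Finset.range n, fejerWeight ℓ (2 * π * c * (k + 1)) := by
  have hn' : (0 : ℝ) < n := by exact_mod_cast Nat.pos_of_ne_zero hn
  have h1 := le_sum_one_sub_cos_div_sq (x := c * ℓ) ⟨by positivity, hcℓ⟩ hn
  rw [Finset.sum_range_succ'] at h1
  simp only [Nat.cast_zero, mul_zero, zero_mul, Real.cos_zero, sub_self, zero_div, add_zero] at h1
  have h2 : ∀ k : ℕ, fejerWeight ℓ (2 * π * c * (k + 1)) = 1 / (2 * π ^ 2 * c ^ 2 * ℓ) *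
      ((1 - Real.cos (2 * π * (k + 1 : ℕ) * (c * ℓ))) / ((k + 1 : ℕ) : ℝ) ^ 2) := fun k => by
    have : (k : ℝ) + 1 ≠ 0 := by positivity
    rw [fejerWeight_of_ne_zero (by positivity)]
    push_cast
    rw [show 2 * π * c * ((k : ℝ) + 1) * ℓ = 2 * π * (k + 1) * (c * ℓ) by ring]
    field_simp
  simp only [h2]
  rw [← Finset.mul_sum]
  calc _ = 1 / (2 * π ^ 2 * c ^ 2 * ℓ) * (π ^ 2 * (c * ℓ - (c * ℓ) ^ 2) - 2 / n) := by
        field_simp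
    _ ≤ _ := by gcongr

/-- Lower bound for the total Fejér weight, sharp for large frequencies. -/
lemma le_sum_fejerWeight_of_large {c ℓ : ℝ} (hc : 0 < c) (hℓ : 0 < ℓ) (hcℓ : c * ℓ ≤ 1) {n : ℕ}
    (hn : n ≠ 0) {h b : ℕ} (hb : n ≤ b) (hbh : b + 1 + n ≤ h) :
    1 / c - 2 / (π ^ 2 * c ^ 2 * (n * ℓ)) ≤
      ∑ i ∈ Finset.range h, fejerWeight ℓ (2 * π * c * (i - b)) := by
  obtain ⟨m, rfl⟩ : ∃ m, h = b + (m + 1) := ⟨h - b - 1, by omega⟩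
  have h1 := le_sum_fejerWeight_nat hc hℓ hcℓ hn
  have hmono : ∀ j, n ≤ j → ∑ k ∈ Finset.range n, fejerWeight ℓ (2 * π * c * (k + 1)) ≤
      ∑ k ∈ Finset.range j, fejerWeight ℓ (2 * π * c * (k + 1)) := fun j hj =>
    Finset.sum_le_sum_of_subset_of_nonneg (Finset.range_mono hj)
      fun _ _ _ => fejerWeight_nonneg hℓ.le _
  have h2 : ∑ i ∈ Finset.range b, fejerWeight ℓ (2 * π * c * (i - b)) =
      ∑ k ∈ Finset.range b, fejerWeight ℓ (2 * π * c * (k + 1)) := by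
    rw [← Finset.sum_range_reflect]
    refine Finset.sum_congr rfl fun i hi => ?_
    have hi := Finset.mem_range.1 hi
    rw [← fejerWeight_neg, Nat.cast_sub (by omega), Nat.cast_sub (by omega)]
    congr 1
    push_cast
    ring
  have h3 : ∑ i ∈ Finset.range (m + 1), fejerWeight ℓ (2 * π * c * ((b + i : ℕ) - b)) =
      ∑ k ∈ Finset.range m, fejerWeight ℓ (2 * π * c * (k + 1)) + ℓ := by
    rw [Finset.sum_range_succ']
    simp [fejerWeight_zero]
  rw [Finset.sum_range_add, h2, h3]
  have h4 := hmono b hb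
  have h5 := hmono m (by omega)
  have h6 : 1 / c - 2 / (π ^ 2 * c ^ 2 * (n * ℓ)) =
      2 * (1 / (2 * c) - ℓ / 2 - 1 / (π ^ 2 * c ^ 2 * (n * ℓ))) + ℓ := by
    field_simp
    ring
  linarith

end Character

section CharacterCocycle

lemma norm_eq_one_of_character {c : ℝ} {ξ : AddCircle (1 : ℝ) → ℂ}
    (hξ : ∀ x ∈ Set.Ico (0 : ℝ) 1, ξ (x : AddCircle (1 : ℝ)) =
      Complex.exp (2 * π * Complex.I * c * x)) (x : AddCircle (1 : ℝ)) : ‖ξ x‖ = 1 := by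
  obtain ⟨y, hy, rfl⟩ := (AddCircle.coe_image_Ico_eq (1 : ℝ) 0).symm ▸ Set.mem_univ x
  rw [zero_add] at hy
  rw [hξ y hy, show 2 * π * Complex.I * c * y = (2 * π * c * y : ℝ) * Complex.I by push_cast; ring,
    Complex.norm_exp_ofReal_mul_I]

lemma cocycleProd_of_character {α c : ℝ} {ξ : AddCircle (1 : ℝ) → ℂ}
    (hξ : ∀ x ∈ Set.Ico (0 : ℝ) 1, ξ (x : AddCircle (1 : ℝ)) =
      Complex.exp (2 * π * Complex.I * c * x)) {ℓ : ℝ} {h : ℕ} (hℓ1 : ℓ ≤ 1)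
    (hsep : ∀ k : ℕ, 0 < k → k < h → ∀ p : ℤ, ℓ ≤ |k * α - p|) {i : ℕ} (hi : i ≤ h) {x : ℝ}
    (hx : x ∈ Set.Ico 0 ℓ) :
    cocycleProd α ξ i x =
      Complex.exp (Complex.I * (2 * π * c * ∑ j ∈ Finset.range i, Int.fract (j * α) : ℝ)) *
        Complex.exp (Complex.I * (2 * π * c * i * x : ℝ)) := by
  rw [cocycleProd_coe_eq_prod_fract, ← Complex.exp_add]
  have h1 : ∀ j ∈ Finset.range i, ξ ((x + Int.fract (j * α) : ℝ) : AddCircle (1 : ℝ)) =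
      Complex.exp (Complex.I * (2 * π * c * (x + Int.fract (j * α)) : ℝ)) := fun j hj => by
    have h2 := fract_add_le_one hℓ1 hsep ((Finset.mem_range.1 hj).trans_le hi)
    rw [hξ _ ⟨add_nonneg hx.1 (Int.fract_nonneg _), by linarith [hx.2]⟩]
    congr 1
    push_cast
    ring
  rw [Finset.prod_congr rfl h1, ← Complex.exp_sum, ← Finset.mul_sum, ← Complex.ofReal_sum,
    ← Finset.mul_sum, Finset.sum_add_distrib, ← mul_add, ← Complex.ofReal_add]
  congr 3
  simp
  ring

lemma isCocycleTower_of_character {α c : ℝ} {ξ : AddCircle (1 : ℝ) → ℂ}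
    (hξ : ∀ x ∈ Set.Ico (0 : ℝ) 1, ξ (x : AddCircle (1 : ℝ)) =
      Complex.exp (2 * π * Complex.I * c * x)) {ℓ r : ℝ} {h b : ℕ} (hℓ : 0 < ℓ) (hℓ1 : ℓ ≤ 1)
    (hhℓ : h * ℓ ≤ 1) (hsep : ∀ k : ℕ, 0 < k → k < h → ∀ p : ℤ, ℓ ≤ |k * α - p|) (hb : b ≤ h)
    (hr : r ≤ ∑ i ∈ Finset.range h, fejerWeight ℓ (2 * π * c * (i - b))) :
    IsCocycleTower α ξ (2 * |2 * π * c|) r ℓ h b fun i => fejerWeight ℓ (2 * π * c * (i - b)) := by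
  refine ⟨hℓ, hℓ1, ⟨fun _ => fejerWeight_nonneg hℓ.le _, fun _ => fejerWeight_le hℓ _, hhℓ, ?_⟩,
    hsep, hr, fun i hi => le_of_eq ?_⟩
  · calc ∑ i ∈ Finset.range h, |fejerWeight ℓ (2 * π * c * ((i + 1 : ℕ) - b)) -
          fejerWeight ℓ (2 * π * c * (i - b))|
        ≤ ∑ i ∈ Finset.range h, 2 * |2 * π * c| * ℓ ^ 2 := by
          refine Finset.sum_le_sum fun i _ => ?_
          have := abs_fejerWeight_add_sub_le hℓ (2 * π * c * (i - b)) (2 * π * c)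
          rwa [show 2 * π * c * ((i : ℝ) - b) + 2 * π * c = 2 * π * c * ((i + 1 : ℕ) - b) by
            push_cast; ring] at this
      _ = (h * ℓ) * (2 * |2 * π * c| * ℓ) := by
          rw [Finset.sum_const, Finset.card_range, nsmul_eq_mul]; ring
      _ ≤ 2 * |2 * π * c| * ℓ := mul_le_of_le_one_left (by positivity) hhℓ
  · set a : ℕ → ℝ := fun i => 2 * π * c * ∑ j ∈ Finset.range i, Int.fract (j * α) with ha
    have h1 : ∫ x in (0 : ℝ)..ℓ, starRingEnd ℂ (cocycleProd α ξ b x) * cocycleProd α ξ i x =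
        ∫ x in (0 : ℝ)..ℓ, Complex.exp (Complex.I * (a i - a b : ℝ)) *
          Complex.exp (Complex.I * (2 * π * c * (i - b) * x : ℝ)) := by
      refine intervalIntegral.integral_congr_ae ?_
      filter_upwards [compl_mem_ae_iff.2 (measure_singleton ℓ)] with x hxℓ hx
      rw [Set.uIoc_of_le hℓ.le] at hx
      have hx' : x ∈ Set.Ico 0 ℓ := ⟨hx.1.le, lt_of_le_of_ne hx.2 hxℓ⟩
      rw [cocycleProd_of_character hξ hℓ1 hsep hb hx',
        cocycleProd_of_character hξ hℓ1 hsep hi.le hx', map_mul, ← Complex.exp_conj,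
        ← Complex.exp_conj, ← Complex.exp_add, ← Complex.exp_add, ← Complex.exp_add,
        ← Complex.exp_add]
      simp only [map_mul, Complex.conj_I, Complex.conj_ofReal, ha]
      congr 1
      push_cast
      ring
    rw [h1, intervalIntegral.integral_const_mul, norm_mul, Complex.norm_exp_I_mul_ofReal, one_mul,
      fejerWeight]
    field_simp

theorem spectralMultiplicityAtMost_of_character {α : ℝ} (hα : Irrational α) {c : ℝ}
    {ξ : AddCircle (1 : ℝ) → ℂ}
    (hξ : ∀ x ∈ Set.Ico (0 : ℝ) 1, ξ (x : AddCircle (1 : ℝ)) =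
      Complex.exp (2 * π * Complex.I * c * x))
    {V : Lp ℂ 2 (volume : Measure (AddCircle (1 : ℝ))) ≃ₗᵢ[ℂ]
      Lp ℂ 2 (volume : Measure (AddCircle (1 : ℝ)))}
    (hV : IsWeightedOperator α ξ V) : SpectralMultiplicityAtMost V (Nat.floor |c| + 1) := by
  have hnorm := norm_eq_one_of_character hξ
  have hpi1 := Real.pi_gt_d4
  have hpi2 := Real.pi_lt_d4
  have hpi3 : (9.869 : ℝ) < π ^ 2 := by nlinarith
  have hpi4 : π ^ 2 < 9.87 := by nlinarith
  have hsq : (2 * π * c) ^ 2 = 4 * π ^ 2 * |c| ^ 2 := by rw [sq_abs]; ring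
  have hc0 := abs_nonneg c
  have hfl := Nat.lt_floor_add_one |c|
  rcases lt_or_ge |c| 1 with h1 | h1
  · refine spectralMultiplicityAtMost_of_cocycleTower hα hV hnorm (C := 2 * |2 * π * c|)
      (r := 51 / 100) (by push_cast; nlinarith [Nat.cast_nonneg (α := ℝ) (Nat.floor |c|)])
      fun η hη => ?_
    obtain ⟨ℓ, h, hℓ, hlt, hh, hh', hh1, hsep⟩ := exists_rotation_tower_of_le hα
      (τ := 3 / 5) (by norm_num) le_rfl (η := min η (1 / 1000)) (by positivity)
    have hℓs := hlt.trans_le (min_le_right _ _)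
    refine ⟨ℓ, h, h / 2, _, hlt.trans_le (min_le_left _ _), isCocycleTower_of_character hξ hℓ
      (by linarith) hh1 hsep (by omega)
      (le_trans ?_ (le_sum_fejerWeight_of_small hℓ _ (by omega) (by omega)))⟩
    have e1 : (h * ℓ) ^ 2 + 2 * ℓ ^ 2 ≤ 37 / 100 := by nlinarith
    have e2 : (2 * π * c) ^ 2 ≤ 40 := by rw [hsq]; nlinarith
    have e3 : (2 * π * c) ^ 2 / 144 * ((h * ℓ) ^ 2 + 2 * ℓ ^ 2) ≤ 40 / 144 * (37 / 100) := by
      gcongr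
    nlinarith
  rcases le_or_gt |c| (17 / 8) with h2 | h2
  · have h3 : 1 ≤ Nat.floor |c| := Nat.le_floor (by simpa using h1)
    have h3' : (1 : ℝ) ≤ Nat.floor |c| := by exact_mod_cast h3
    refine spectralMultiplicityAtMost_of_cocycleTower hα hV hnorm (C := 2 * |2 * π * c|)
      (r := 34 / 100) (by push_cast; linarith) fun η hη => ?_
    obtain ⟨ℓ, h, hℓ, hlt, hh, hh', hh1, hsep⟩ := exists_rotation_tower_of_le hα
      (τ := 1 / 2) (by norm_num) (by norm_num) (η := min η (1 / 1000)) (by positivity)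
    have hℓs := hlt.trans_le (min_le_right _ _)
    refine ⟨ℓ, h, h / 2, _, hlt.trans_le (min_le_left _ _), isCocycleTower_of_character hξ hℓ
      (by linarith) hh1 hsep (by omega)
      (le_trans ?_ (le_sum_fejerWeight_of_small hℓ _ (by omega) (by omega)))⟩
    have e1 : (h * ℓ) ^ 2 + 2 * ℓ ^ 2 ≤ 252 / 1000 := by nlinarith
    have e2 : (2 * π * c) ^ 2 ≤ 178.3 := by
      have : |c| ^ 2 ≤ (17 / 8) ^ 2 := by gcongr
      rw [hsq]; nlinarith
    have e3 : (2 * π * c) ^ 2 / 144 * ((h * ℓ) ^ 2 + 2 * ℓ ^ 2) ≤ 178.3 / 144 * (252 / 1000) := by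
      gcongr
    nlinarith
  · refine spectralMultiplicityAtMost_of_cocycleTower hα hV hnorm (C := 2 * |2 * π * c|)
      (r := 1 / (|c| + 1)) ?_ fun η hη => ?_
    · rw [mul_one_div, lt_div_iff₀ (by linarith)]
      push_cast
      linarith
    obtain ⟨ℓ, h, hℓ, hlt, hh, hh', hh1, hsep⟩ := exists_rotation_tower_of_le hα
      (τ := 3 / 5) (by norm_num) le_rfl (η := min η (min (1 / 1000) (1 / |c|))) (by positivity)
    have hℓs := hlt.trans_le ((min_le_right _ _).trans (min_le_left _ _))
    have hℓc := hlt.trans_le ((min_le_right _ _).trans (min_le_right _ _))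
    have hcℓ : |c| * ℓ ≤ 1 := by
      rw [lt_div_iff₀ (by linarith)] at hℓc
      linarith
    have hh3 : (3 : ℝ) < h := by
      by_contra hcon
      nlinarith [not_lt.1 hcon]
    replace hh3 : 3 < h := by exact_mod_cast hh3
    refine ⟨ℓ, h, h / 2, _, hlt.trans_le (min_le_left _ _), isCocycleTower_of_character hξ hℓ
      (by linarith) hh1 hsep (by omega) ?_⟩
    have habs : ∀ k : ℝ, fejerWeight ℓ (2 * π * c * k) = fejerWeight ℓ (2 * π * |c| * k) :=
      fun k => by
        rcases abs_choice c with hc | hc <;> rw [hc]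
        rw [← fejerWeight_neg]
        ring_nf
    rw [Finset.sum_congr rfl fun (i : ℕ) _ => habs (i - (h / 2 : ℕ))]
    obtain ⟨n, hn⟩ : ∃ n, n = (h - 1) / 2 := ⟨_, rfl⟩
    refine le_trans ?_ (le_sum_fejerWeight_of_large (n := n) (by linarith) hℓ hcℓ (by omega)
      (by omega) (by omega))
    have hnh : h ≤ 2 * n + 2 := by omega
    replace hnh : (h : ℝ) ≤ 2 * n + 2 := by exact_mod_cast hnh
    have hnℓ : 299 / 1000 ≤ n * ℓ := by nlinarith
    set d := |c|
    have e1 : 2 / (π ^ 2 * d ^ 2 * (n * ℓ)) ≤ 2 / (9.869 * d ^ 2 * (299 / 1000)) := by gcongr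
    have e2 : 2 / (9.869 * d ^ 2 * (299 / 1000)) ≤ 1 / d - 1 / (d + 1) := by
      rw [div_sub_div _ _ (by linarith) (by linarith), div_le_div_iff₀ (by positivity)
        (by positivity)]
      nlinarith
    exact le_sub_comm.1 (e1.trans e2)

end CharacterCocycle

/-- **(Guenais).**  Let `T x = x + α` be an irrational rotation of `[0,1)` and `ξ : [0,1) → 𝕋`
a cocycle.
(i) If `ξ(x) = e^{2πicx}` then the spectral multiplicity of `V_{ξ,T}` is bounded by `|c| + 1`.
(ii) If `ξ` is absolutely continuous of topological degree zero (written via a lift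
`φ : ℝ → ℝ`, `ξ = e^{2πiφ}`, `φ(x+1) = φ(x)`, `φ(x) = φ(0) + ∫₀ˣ g`), then `V_{ξ,T}` has a
simple spectrum.
(iii) If `ξ` is of bounded variation then the spectral multiplicity of `V_{ξ,T}` is at most
`max (2, 2π·Var(ξ)/3)`. -/
theorem guenais_multiplicity (α : ℝ) (hα : Irrational α) :
    (∀ (c : ℝ) (ξ : AddCircle (1 : ℝ) → ℂ)
        (hξ : ∀ x ∈ Set.Ico (0:ℝ) 1, ξ (x : AddCircle (1 : ℝ)) =
          Complex.exp (2 * π * Complex.I * c * x))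
        (V : Lp ℂ 2 (volume : Measure (AddCircle (1 : ℝ))) ≃ₗᵢ[ℂ]
             Lp ℂ 2 (volume : Measure (AddCircle (1 : ℝ)))),
        IsWeightedOperator α ξ V → SpectralMultiplicityAtMost V (Nat.floor |c| + 1)) ∧
    (∀ (φ g : ℝ → ℝ) (ξ : AddCircle (1 : ℝ) → ℂ)
        (hdeg : ∀ x : ℝ, φ (x + 1) = φ x)
        (hgint : ∀ a b : ℝ, IntervalIntegrable g volume a b)
        (hac : ∀ x : ℝ, φ x = φ 0 + ∫ t in (0:ℝ)..x, g t)
        (hξ : ∀ x : ℝ, ξ (x : AddCircle (1 : ℝ)) = Complex.exp (2 * π * Complex.I * φ x))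
        (V : Lp ℂ 2 (volume : Measure (AddCircle (1 : ℝ))) ≃ₗᵢ[ℂ]
             Lp ℂ 2 (volume : Measure (AddCircle (1 : ℝ)))),
        IsWeightedOperator α ξ V → SpectralMultiplicityAtMost V 1) ∧
    (∀ (ξr : ℝ → ℂ) (ξ : AddCircle (1 : ℝ) → ℂ)
        (hper : ∀ x : ℝ, ξr (x + 1) = ξr x)
        (hmod : ∀ x : ℝ, ‖ξr x‖ = 1)
        (hBV : BoundedVariationOn ξr (Set.Icc (0:ℝ) 1))
        (hξ : ∀ x : ℝ, ξ (x : AddCircle (1 : ℝ)) = ξr x)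
        (V : Lp ℂ 2 (volume : Measure (AddCircle (1 : ℝ))) ≃ₗᵢ[ℂ]
             Lp ℂ 2 (volume : Measure (AddCircle (1 : ℝ)))),
        IsWeightedOperator α ξ V → SpectralMultiplicityAtMost V
          (Nat.floor (max 2 (2 * π * (eVariationOn ξr (Set.Icc (0:ℝ) 1)).toReal / 3)))) := by
  exact ⟨fun c ξ hξ V hV => spectralMultiplicityAtMost_of_character hα hξ hV,
    fun φ g ξ hdeg hgint hac hξ V hV =>
      spectralMultiplicityAtMost_one_of_absolutelyContinuous hα hdeg hgint hac hξ hV,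
    fun ξr ξ _ hmod hBV hξ V hV =>
      spectralMultiplicityAtMost_of_boundedVariation hα hmod hBV hξ hV⟩
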